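/- Let d ≥ 2 and p₀ > p_c(d). There exist ν = ν(p₀, d) > 0 and κ = κ(p₀, d) > 0 such that for all p ≥ p₀, all N ≥ 1 and all m ≥ 1, ℙ(T_{m,N}(p)) ≤ κ N^{2d} exp(−ν m), where T_{m,N}(p) is the event that the box B_N = [−N, N)^d ∩ ℤ^d has a p-crossing cluster and contains some other p-open cluster of diameter at least m. -/

import Mathlib

open MeasureTheory Filter Topology
open scoped ENNReal

namespace Perco

/-- Vertices of the hypercubic lattice `ℤ^d`. -/
abbrev V (d : ℕ) := Fin d → ℤ

/-- The `ℓ¹` distance on `ℤ^d`. -/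
def dist1 {d : ℕ} (x y : V d) : ℕ := ∑ i, (x i - y i).natAbs

/-- The `ℓ¹` norm, as a real number. -/
def norm1 {d : ℕ} (x : V d) : ℝ := (dist1 x 0 : ℝ)

/-- The `ℓ¹` distance, descended to unordered pairs. -/
def sym2dist1 {d : ℕ} : Sym2 (V d) → ℕ :=
  Sym2.lift ⟨fun x y => dist1 x y, fun x y => by
    unfold dist1
    exact Finset.sum_congr rfl fun i _ => by rw [← Int.natAbs_neg, neg_sub]⟩

/-- Edges of the lattice `(ℤ^d, 𝔼^d)`: unordered pairs of nearest neighbours. -/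
def Edge (d : ℕ) : Type := {e : Sym2 (V d) // sym2dist1 e = 1}

/-- A bond percolation configuration: every edge is open (`true`) or closed (`false`). -/
abbrev Config (d : ℕ) := Edge d → Bool

/-- The unordered pair `e` is an open edge of the configuration `ω`. -/
def openE {d : ℕ} (ω : Config d) (e : Sym2 (V d)) : Prop :=
  ∃ h : sym2dist1 e = 1, ω ⟨e, h⟩ = true

/-- `⟨x, y⟩` is an open edge of the configuration `ω`. -/
def edgeOpen {d : ℕ} (ω : Config d) (x y : V d) : Prop := openE ω s(x, y)

/-- `f 0, f 1, …, f n` is an `ω`-open path (with `n` edges). -/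
def IsOpenPath {d : ℕ} (ω : Config d) (n : ℕ) (f : ℕ → V d) : Prop :=
  ∀ i < n, edgeOpen ω (f i) (f (i + 1))

/-- `f 0, …, f n` is a (not necessarily open) lattice path of `ℤ^d`. -/
def IsLatticePath {d : ℕ} (n : ℕ) (f : ℕ → V d) : Prop :=
  ∀ i < n, dist1 (f i) (f (i + 1)) = 1

/-- The chemical distance between `x` and `y` in the configuration `ω`:
the minimal number of edges of an `ω`-open path from `x` to `y` (`⊤` if there is none). -/
noncomputable def chemDist {d : ℕ} (ω : Config d) (x y : V d) : ℝ≥0∞ :=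
  sInf {r : ℝ≥0∞ | ∃ (n : ℕ) (f : ℕ → V d),
    IsOpenPath ω n f ∧ f 0 = x ∧ f n = y ∧ r = (n : ℝ≥0∞)}

/-- `x` and `y` are connected by an `ω`-open path. -/
def Connected {d : ℕ} (ω : Config d) (x y : V d) : Prop := chemDist ω x y ≠ ⊤

/-- The open cluster of the vertex `x`. -/
def cluster {d : ℕ} (ω : Config d) (x : V d) : Set (V d) := {y | Connected ω x y}

/-- `x` lies in an infinite open cluster. -/
def InInfiniteCluster {d : ℕ} (ω : Config d) (x : V d) : Prop := (cluster ω x).Infinite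

open Classical in
/-- The regularized point `x̃`: a point of the infinite cluster minimizing the `ℓ¹`
distance to `x` (with a deterministic rule to break ties); `x` itself if there is none. -/
noncomputable def regPoint {d : ℕ} (ω : Config d) (x : V d) : V d :=
  if h : ∃ y : V d, InInfiniteCluster ω y ∧
      ∀ z : V d, InInfiniteCluster ω z → dist1 x y ≤ dist1 x z
  then h.choose else x

/-- Real-valued chemical distance (in the configuration `ωdist`) between the
regularizations (w.r.t. the configuration `ωreg`) of `x` and `y`. -/
noncomputable def DReg {d : ℕ} (ωdist ωreg : Config d) (x y : V d) : ℝ :=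
  (chemDist ωdist (regPoint ωreg x) (regPoint ωreg y)).toReal

open Classical in
/-- The number of elements of a set, as an element of `ℝ≥0∞` (`⊤` for infinite sets). -/
noncomputable def eSize {α : Type*} (A : Set α) : ℝ≥0∞ :=
  if h : A.Finite then (h.toFinset.card : ℝ≥0∞) else ⊤

/-!  ### Boxes and renormalization  -/

/-- The box of "radius" `R` centered at `c`: `∏ₖ [c k - R, c k + R)`. -/
def boxC {d : ℕ} (c : V d) (R : ℕ) : Set (V d) :=
  {x | ∀ k, c k - (R : ℤ) ≤ x k ∧ x k < c k + (R : ℤ)}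

/-- The center `i(2N+1)` of the `N`-box of macroscopic index `i`. -/
def center {d : ℕ} (N : ℕ) (i : V d) : V d := fun k => i k * (2 * (N : ℤ) + 1)

/-- The `N`-box `B_N(i) = i(2N+1) + [-N, N)^d`. -/
def macroBox {d : ℕ} (N : ℕ) (i : V d) : Set (V d) := boxC (center N i) N

/-- The enlarged box `B'_N(i) = i(2N+1) + [-3N, 3N)^d`. -/
def macroBox' {d : ℕ} (N : ℕ) (i : V d) : Set (V d) := boxC (center N i) (3 * N)

/-- An open path all of whose vertices stay in the set `S`. -/
def IsOpenPathIn {d : ℕ} (ω : Config d) (S : Set (V d)) (n : ℕ) (f : ℕ → V d) : Prop :=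
  IsOpenPath ω n f ∧ ∀ i ≤ n, f i ∈ S

/-- `x` and `y` are connected by an open path inside `S`. -/
def ConnectedIn {d : ℕ} (ω : Config d) (S : Set (V d)) (x y : V d) : Prop :=
  ∃ (n : ℕ) (f : ℕ → V d), IsOpenPathIn ω S n f ∧ f 0 = x ∧ f n = y

/-- The open cluster of `x` inside the set `S`. -/
def clusterIn {d : ℕ} (ω : Config d) (S : Set (V d)) (x : V d) : Set (V d) :=
  {y | ConnectedIn ω S x y}

/-- `C` is an open cluster of the region `S`. -/
def IsClusterIn {d : ℕ} (ω : Config d) (S : Set (V d)) (C : Set (V d)) : Prop :=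
  ∃ x ∈ S, C = clusterIn ω S x

/-- The cluster `C` has diameter at least `m`. -/
def diamGE {d : ℕ} (C : Set (V d)) (m : ℕ) : Prop :=
  ∃ x ∈ C, ∃ y ∈ C, ∃ k, (m : ℤ) ≤ |x k - y k|

/-- The cluster `C` is crossing for the box `boxC c R`: for each of the `d` directions,
`C ∩ boxC c R` contains an open path connecting the two opposite faces of the box. -/
def CrossingFor {d : ℕ} (ω : Config d) (C : Set (V d)) (c : V d) (R : ℕ) : Prop :=
  ∀ k : Fin d, ∃ (n : ℕ) (f : ℕ → V d), IsOpenPath ω n f ∧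
    (∀ m ≤ n, f m ∈ C ∩ boxC c R) ∧ f 0 k = c k - (R : ℤ) ∧ f n k = c k + (R : ℤ) - 1

/-- The `N`-box `B_N(i)` is good (for the configuration `ω`, with parameter `β`):
(i) there is a unique open cluster `C` of `B'_N(i)` of diameter at least `N`;
(ii) `C` is crossing for each of the `3^d` `N`-boxes included in `B'_N(i)`;
(iii) any two points of `C ∩ B'_N(i)` are at chemical distance at most `12βN`. -/
def IsGoodBox {d : ℕ} (ω : Config d) (N : ℕ) (β : ℝ) (i : V d) : Prop :=
  ∃ C : Set (V d),
    IsClusterIn ω (macroBox' N i) C ∧ diamGE C N ∧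
    (∀ C', IsClusterIn ω (macroBox' N i) C' → diamGE C' N → C' = C) ∧
    (∀ j : V d, (∀ k, |j k - i k| ≤ 1) → CrossingFor ω C (center N j) N) ∧
    (∀ x ∈ macroBox' N i, ∀ y ∈ macroBox' N i, x ∈ C → y ∈ C →
      chemDist ω x y ≤ ENNReal.ofReal (12 * β * N))

/-- `x` belongs to the crossing cluster of the good box `B_N(j)`, i.e. to a cluster of
`B'_N(j)` of diameter at least `N`. -/
def InCrossingCluster {d : ℕ} (ω : Config d) (N : ℕ) (j : V d) (x : V d) : Prop :=
  ∃ C : Set (V d), IsClusterIn ω (macroBox' N j) C ∧ diamGE C N ∧ x ∈ C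

/-!  ### Macroscopic site percolation -/

/-- A nearest-neighbour path of macroscopic sites staying in `S`. -/
def IsSitePathIn {d : ℕ} (S : Set (V d)) (n : ℕ) (f : ℕ → V d) : Prop :=
  (∀ m ≤ n, f m ∈ S) ∧ ∀ m < n, dist1 (f m) (f (m + 1)) = 1

/-- The sites `i` and `j` are connected by a nearest-neighbour path inside `S`. -/
def SiteConnectedIn {d : ℕ} (S : Set (V d)) (i j : V d) : Prop :=
  ∃ (n : ℕ) (f : ℕ → V d), IsSitePathIn S n f ∧ f 0 = i ∧ f n = j

/-- A `*`-path of macroscopic sites staying in `S` (consecutive sites are `*`-neighbours: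
their `ℓ^∞` distance is `1`). -/
def IsStarPathIn {d : ℕ} (S : Set (V d)) (n : ℕ) (f : ℕ → V d) : Prop :=
  (∀ m ≤ n, f m ∈ S) ∧ ∀ m < n, f m ≠ f (m + 1) ∧ ∀ k, |f (m + 1) k - f m k| ≤ 1

/-- The set of good macroscopic sites. -/
def goodSites {d : ℕ} (ω : Config d) (N : ℕ) (β : ℝ) : Set (V d) :=
  {i | IsGoodBox ω N β i}

/-- The macroscopic site `i` belongs to an infinite cluster of good boxes. -/
def InInfiniteGoodCluster {d : ℕ} (ω : Config d) (N : ℕ) (β : ℝ) (i : V d) : Prop :=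
  IsGoodBox ω N β i ∧ {j | SiteConnectedIn (goodSites ω N β) i j}.Infinite

/-- The union of the bad connected components (of the macroscopic site percolation)
meeting the set `Γ`; its size is `Σ_{C ∈ Bad, C ∩ Γ ≠ ∅} |C|`. -/
def badTouching {d : ℕ} (ω : Config d) (N : ℕ) (β : ℝ) (Γ : Set (V d)) : Set (V d) :=
  {j | ∃ i ∈ Γ, i ∉ goodSites ω N β ∧ SiteConnectedIn {k | k ∉ goodSites ω N β} i j}

/-!  ### Edges and sites of a path -/

/-- The set of edges of the path `f 0, …, f n`. -/
def pathEdges {d : ℕ} (n : ℕ) (f : ℕ → V d) : Set (Sym2 (V d)) :=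
  {e | ∃ i < n, e = s(f i, f (i + 1))}

/-- The set of vertices of the path `f 0, …, f n`. -/
def pathVerts {d : ℕ} (n : ℕ) (f : ℕ → V d) : Set (V d) :=
  {v | ∃ i ≤ n, f i = v}

/-- The set of `ω`-closed edges of the path `f 0, …, f n`. -/
def closedEdges {d : ℕ} (ω : Config d) (n : ℕ) (f : ℕ → V d) : Set (Sym2 (V d)) :=
  {e | e ∈ pathEdges n f ∧ ¬ openE ω e}

/-- The set `Γ` of macroscopic sites whose `N`-box is visited by the path `f 0, …, f n`. -/
def visitedSites {d : ℕ} (N : ℕ) (n : ℕ) (f : ℕ → V d) : Set (V d) :=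
  {i | ∃ m ≤ n, f m ∈ macroBox N i}

/-!  ### Probability: i.i.d. Bernoulli bond percolation -/

/-- A family of i.i.d. Bernoulli bond percolation measures on the configurations:
`P p` is a probability measure under which the states of the edges are independent
Bernoulli variables of parameter `p`. -/
structure BernoulliFamily (d : ℕ) where
  P : ℝ → Measure (Config d)
  prob : ∀ p, IsProbabilityMeasure (P p)
  iid : ∀ p, 0 ≤ p → p ≤ 1 → ∀ (s : Finset (Edge d)) (f : Edge d → Bool),
    P p {ω : Config d | ∀ e ∈ s, ω e = f e}
      = ∏ e ∈ s, ENNReal.ofReal (if f e then p else 1 - p)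

/-- The critical parameter `p_c(d)` of the family. -/
noncomputable def pc {d : ℕ} (F : BernoulliFamily d) : ℝ :=
  sInf {p : ℝ | 0 ≤ p ∧ p ≤ 1 ∧ 0 < F.P p {ω : Config d | InInfiniteCluster ω 0}}

/-- `t` is the time constant of the percolation measure `P`: for every `x ∈ ℤ^d`,
`D^{𝒞}(0̃, ñx)/n → t x` almost surely. -/
def ASTimeConstant {d : ℕ} (P : Measure (Config d)) (t : V d → ℝ) : Prop :=
  ∀ x : V d, ∀ᵐ ω ∂P, Tendsto (fun n : ℕ => DReg ω ω 0 (n • x) / n) atTop (𝓝 (t x))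

/-!  ### Couplings -/

/-- Two-stage coupling configurations: each edge carries a pair `(V, Z)` of Booleans. -/
abbrev CConfig (d : ℕ) := Edge d → Bool × Bool

/-- The `q`-configuration of a coupled configuration: `e` is `q`-open iff `V e = 1`. -/
def cfgQ {d : ℕ} (u : CConfig d) : Config d := fun e => (u e).1

/-- The `p`-configuration of a coupled configuration: `e` is `p`-open iff `V e Z e = 1`. -/
def cfgP {d : ℕ} (u : CConfig d) : Config d := fun e => (u e).1 && (u e).2

/-- Two-stage coupling of the `p`- and `q`-percolations: on each edge, independently,
`V` is Bernoulli of parameter `q` and `Z` is an independent Bernoulli of parameter `p/q`. -/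
structure CouplingMeasure (d : ℕ) (p q : ℝ) where
  Q : Measure (CConfig d)
  prob : IsProbabilityMeasure Q
  iid : ∀ (s : Finset (Edge d)) (f : Edge d → Bool × Bool),
    Q {u : CConfig d | ∀ e ∈ s, u e = f e}
      = ∏ e ∈ s,
          (ENNReal.ofReal (if (f e).1 then q else 1 - q) *
            ENNReal.ofReal (if (f e).2 then p / q else 1 - p / q))

/-- Standard coupling: i.i.d. uniform variables on `[0,1]`, one for each edge. -/
structure UniformCoupling (d : ℕ) where
  Q : Measure (Edge d → ℝ)
  prob : IsProbabilityMeasure Q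
  iid : ∀ (s : Finset (Edge d)) (a : Edge d → ℝ), (∀ e ∈ s, 0 ≤ a e ∧ a e ≤ 1) →
    Q {u | ∀ e ∈ s, u e ≤ a e} = ∏ e ∈ s, ENNReal.ofReal (a e)

open Classical in
/-- The `p`-configuration of the standard coupling: `e` is `p`-open iff `U e ≤ p`. -/
noncomputable def cfgAt {d : ℕ} (u : Edge d → ℝ) (p : ℝ) : Config d :=
  fun e => if u e ≤ p then true else false

/-- The critical parameter `p_c(d)` read on the standard coupling. -/
noncomputable def pcU {d : ℕ} (U : UniformCoupling d) : ℝ :=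
  sInf {p : ℝ | 0 ≤ p ∧ p ≤ 1 ∧ 0 < U.Q {u | InInfiniteCluster (cfgAt u p) 0}}

open Classical in
/-- A deterministically chosen geodesic (open path of minimal length) from `x` to `y`
in the configuration `ω` (a trivial constant path if there is none). -/
noncomputable def geod {d : ℕ} (ω : Config d) (x y : V d) : ℕ × (ℕ → V d) :=
  if h : ∃ nf : ℕ × (ℕ → V d), IsOpenPath ω nf.1 nf.2 ∧ nf.2 0 = x ∧ nf.2 nf.1 = y ∧
      (nf.1 : ℝ≥0∞) = chemDist ω x y
  then h.choose else (0, fun _ => x)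

/-!  ### Norms on `ℝ^d` -/

/-- `f` is a norm on the Euclidean space `ℝ^d`. -/
def IsNorm {d : ℕ} (f : EuclideanSpace ℝ (Fin d) → ℝ) : Prop :=
  (∀ x, 0 ≤ f x) ∧ (∀ x, f x = 0 ↔ x = 0) ∧
  (∀ (c : ℝ) (x), f (c • x) = |c| * f x) ∧ ∀ x y, f (x + y) ≤ f x + f y

/-- The canonical embedding of `ℤ^d` into the Euclidean space `ℝ^d`. -/
noncomputable def toEuc {d : ℕ} (x : V d) : EuclideanSpace ℝ (Fin d) :=
  (WithLp.equiv 2 (Fin d → ℝ)).symm fun i => (x i : ℝ)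

/-- Property (1) of the path-modification lemma: the edges of `γ' \ γ` decompose as a
disjoint union of self-avoiding `p`-open paths intersecting `γ' ∩ γ` at their endpoints. -/
def DisjointPathDecomposition {d : ℕ} (ωp : Config d) (n : ℕ) (f : ℕ → V d)
    (n' : ℕ) (g : ℕ → V d) : Prop :=
  ∃ (K : ℕ) (m : ℕ → ℕ) (h : ℕ → ℕ → V d),
    (⋃ j ∈ Finset.range K, pathEdges (m j) (h j)) = pathEdges n' g \ pathEdges n f ∧
    (∀ j < K, IsOpenPath ωp (m j) (h j)) ∧
    (∀ j < K, ∀ a ≤ m j, ∀ b ≤ m j, h j a = h j b → a = b) ∧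
    (∀ j < K, ∀ l < K, j ≠ l → Disjoint (pathEdges (m j) (h j)) (pathEdges (m l) (h l))) ∧
    (∀ j < K, h j 0 ∈ pathVerts n f ∧ h j (m j) ∈ pathVerts n f) ∧
    (∀ j < K, ∀ a, 0 < a → a < m j → h j a ∉ pathVerts n f)

/-- The conclusion of the path-modification lemma, for the constant `ρ`:
any `q`-open path between well-connected points of `𝒞_p` can be turned into a `p`-open
path, the total length of the bypasses being controlled by the bad clusters met and the
number of `p`-closed edges. -/
def BypassProperty (d : ℕ) (ρ : ℕ) : Prop :=
  ∀ (N : ℕ), 1 ≤ N → ∀ (β : ℝ), 1 ≤ β → ∀ (ωp ωq : Config d),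
    (∀ e, ωp e = true → ωq e = true) →
    ∀ y z : V d, InInfiniteCluster ωp y → InInfiniteCluster ωp z →
    (∃ i, y ∈ macroBox N i ∧ InInfiniteGoodCluster ωp N β i) →
    (∃ i, z ∈ macroBox N i ∧ InInfiniteGoodCluster ωp N β i) →
    ∀ (n : ℕ) (f : ℕ → V d), IsOpenPath ωq n f → f 0 = y → f n = z →
    ∃ (n' : ℕ) (g : ℕ → V d), IsOpenPath ωp n' g ∧ g 0 = y ∧ g n' = z ∧
      DisjointPathDecomposition ωp n f n' g ∧
      eSize (pathEdges n' g \ pathEdges n f) ≤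
        ((ρ * N : ℕ) : ℝ≥0∞) *
          (eSize (badTouching ωp N β (visitedSites N n f)) + eSize (closedEdges ωp n f))


/-! ### Finite product Bernoulli measures -/
section FiniteProb
variable {ι : Type*}

open Classical in
/-- Expectation of `f` under the product Bernoulli measure on the finite index set `s`. -/
noncomputable def Ex (p : ι → ℝ) (s : Finset ι) (f : Set ι → ℝ) : ℝ :=
  ∑ t ∈ s.powerset, (∏ i ∈ s, if i ∈ t then p i else 1 - p i) * f (t : Set ι)

open Classical in
/-- The indicator of a predicate. -/
noncomputable def ind (A : Prop) : ℝ := if A then 1 else 0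

/-- Probability under the product Bernoulli measure. -/
noncomputable def Pr (p : ι → ℝ) (s : Finset ι) (A : Set ι → Prop) : ℝ :=
  Ex p s (fun t => ind (A t))

lemma ind_nonneg (A : Prop) : 0 ≤ ind A := by unfold ind; split <;> norm_num
lemma ind_le_one (A : Prop) : ind A ≤ 1 := by unfold ind; split <;> norm_num
lemma ind_pos {A : Prop} (h : A) : ind A = 1 := by simp [ind, h]
lemma ind_neg {A : Prop} (h : ¬ A) : ind A = 0 := by simp [ind, h]
lemma ind_mono {A B : Prop} (h : A → B) : ind A ≤ ind B := by
  by_cases hA : A <;> by_cases hB : B <;> simp_all [ind]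
lemma ind_not (A : Prop) : ind (¬ A) = 1 - ind A := by
  by_cases hA : A <;> simp [ind, hA]
lemma ind_and (A B : Prop) : ind (A ∧ B) = ind A * ind B := by
  by_cases hA : A <;> by_cases hB : B <;> simp [ind, hA, hB]
lemma ind_congr {A B : Prop} (h : A ↔ B) : ind A = ind B := by
  by_cases hA : A <;> simp_all [ind]

/-- Weights are probabilities. -/
def IsW (p : ι → ℝ) : Prop := ∀ i, 0 ≤ p i ∧ p i ≤ 1

variable {p q : ι → ℝ} {s s' : Finset ι} {f g : Set ι → ℝ} {A B : Set ι → Prop}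

lemma Ex_empty : Ex p ∅ f = f ∅ := by simp [Ex]

lemma Ex_insert [DecidableEq ι] {i : ι} (hi : i ∉ s) :
    Ex p (insert i s) f = p i * Ex p s (fun t => f (insert i t)) + (1 - p i) * Ex p s f := by
  classical
  unfold Ex
  rw [Finset.sum_powerset_insert hi, add_comm, Finset.mul_sum, Finset.mul_sum]
  congr 1
  · refine Finset.sum_congr rfl fun t ht => ?_
    rw [Finset.prod_insert hi]
    simp only [Finset.mem_insert, true_or, if_true, Finset.coe_insert, mul_assoc]
    congr 2
    refine Finset.prod_congr rfl fun j hj => ?_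
    have : j ≠ i := fun h => hi (h ▸ hj)
    simp [this]
  · refine Finset.sum_congr rfl fun t ht => ?_
    have hit : i ∉ t := fun h => hi (Finset.mem_powerset.1 ht h)
    rw [Finset.prod_insert hi]
    simp [hit, mul_assoc]

lemma Ex_mono (hp : IsW p) (h : ∀ t : Set ι, t ⊆ s → f t ≤ g t) : Ex p s f ≤ Ex p s g := by
  classical
  unfold Ex
  refine Finset.sum_le_sum fun t ht => ?_
  refine mul_le_mul_of_nonneg_left (h _ (by simpa using ht)) ?_
  refine Finset.prod_nonneg fun i _ => ?_
  split_ifs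
  · exact (hp i).1
  · linarith [(hp i).2]

lemma Ex_congr (h : ∀ t : Set ι, t ⊆ s → f t = g t) : Ex p s f = Ex p s g := by
  classical
  unfold Ex
  refine Finset.sum_congr rfl fun t ht => ?_
  rw [h _ (by simpa using ht)]

lemma Ex_congr_p (h : ∀ i ∈ s, p i = q i) : Ex p s f = Ex q s f := by
  classical
  unfold Ex
  refine Finset.sum_congr rfl fun t ht => ?_
  congr 1
  refine Finset.prod_congr rfl fun i hi => ?_
  rw [h i hi]

lemma Ex_add : Ex p s (fun t => f t + g t) = Ex p s f + Ex p s g := by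
  simp [Ex, mul_add, Finset.sum_add_distrib]

lemma Ex_sub : Ex p s (fun t => f t - g t) = Ex p s f - Ex p s g := by
  simp [Ex, mul_sub, Finset.sum_sub_distrib]

lemma Ex_mul_left (c : ℝ) : Ex p s (fun t => c * f t) = c * Ex p s f := by
  unfold Ex
  rw [Finset.mul_sum]
  exact Finset.sum_congr rfl fun t _ => by ring

lemma Ex_mul_right (c : ℝ) : Ex p s (fun t => f t * c) = Ex p s f * c := by
  rw [mul_comm, ← Ex_mul_left]
  simp_rw [mul_comm c]

lemma Ex_sum {κ : Type*} (K : Finset κ) (F : κ → Set ι → ℝ) :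
    Ex p s (fun t => ∑ k ∈ K, F k t) = ∑ k ∈ K, Ex p s (F k) := by
  unfold Ex
  rw [Finset.sum_comm]
  simp_rw [Finset.mul_sum]

lemma Ex_const (c : ℝ) : Ex p s (fun _ => c) = c := by
  classical
  induction s using Finset.induction_on with
  | empty => exact Ex_empty
  | insert i s hi ih => rw [Ex_insert hi, ih]; ring

lemma Ex_nonneg (hp : IsW p) (h : ∀ t : Set ι, t ⊆ s → 0 ≤ f t) : 0 ≤ Ex p s f := by
  have := Ex_mono (p := p) (s := s) (f := fun _ => 0) hp h
  rwa [Ex_const] at this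

lemma Ex_le (hp : IsW p) {c : ℝ} (h : ∀ t : Set ι, t ⊆ s → f t ≤ c) : Ex p s f ≤ c := by
  have := Ex_mono (p := p) (s := s) (g := fun _ => c) hp h
  rwa [Ex_const] at this

lemma Ex_union [DecidableEq ι] (hd : Disjoint s s') :
    Ex p (s ∪ s') f = Ex p s (fun t => Ex p s' (fun t' => f (t ∪ t'))) := by
  induction s using Finset.induction_on generalizing f with
  | empty => simp [Ex_empty]
  | insert i s hi ih =>
    rw [Finset.disjoint_insert_left] at hd
    have h1 : i ∉ s ∪ s' := by simp [hi, hd.1]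
    rw [Finset.insert_union, Ex_insert h1, ih hd.2, ih hd.2, Ex_insert hi]
    simp [Set.insert_union]

/-- Dropping irrelevant coordinates. -/
lemma Ex_local (hs : s' ⊆ s) (h : ∀ t : Set ι, t ⊆ s → f t = f (t ∩ s')) :
    Ex p s f = Ex p s' f := by
  classical
  have e : s' ∪ (s \ s') = s := Finset.union_sdiff_of_subset hs
  have hd : Disjoint s' (s \ s') := Finset.disjoint_sdiff
  calc Ex p s f = Ex p (s' ∪ (s \ s')) f := by rw [e]
    _ = Ex p s' (fun t => Ex p (s \ s') (fun t' => f (t ∪ t'))) := Ex_union hd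
    _ = Ex p s' (fun t => Ex p (s \ s') (fun _ => f t)) := by
        refine Ex_congr fun t ht => Ex_congr fun t' ht' => ?_
        rw [h]
        · congr 1
          ext x
          have := @ht x
          have h3 := @ht' x
          simp at *
          tauto
        · intro x hx
          rcases hx with hx | hx
          · exact hs (ht hx)
          · have := ht' hx
            simp at this
            exact this.1
    _ = Ex p s' f := by simp_rw [Ex_const]

/-- Independence of functions of disjoint coordinate sets. -/
lemma Ex_mul_indep {s1 s2 : Finset ι} (h1 : s1 ⊆ s) (h2 : s2 ⊆ s) (hd : Disjoint s1 s2)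
    (hf : ∀ t : Set ι, t ⊆ s → f t = f (t ∩ s1)) (hg : ∀ t : Set ι, t ⊆ s → g t = g (t ∩ s2)) :
    Ex p s (fun t => f t * g t) = Ex p s1 f * Ex p s2 g := by
  classical
  have hu : s1 ∪ s2 ⊆ s := Finset.union_subset h1 h2
  rw [Ex_local (s' := s1 ∪ s2) hu, Ex_union hd, ← Ex_mul_right]
  · refine Ex_congr fun t ht => ?_
    rw [← Ex_mul_left]
    refine Ex_congr fun t' ht' => ?_
    have hsub : t ∪ t' ⊆ s := by
      apply Set.union_subset (ht.trans (by exact_mod_cast h1)) (ht'.trans (by exact_mod_cast h2))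
    have a1 : (t ∪ t') ∩ s1 = t := by
      ext x
      have := @ht x; have := @ht' x
      have := fun h h' => (Finset.disjoint_left.1 hd : ∀ ⦃a⦄, a ∈ s1 → a ∉ s2) (a := x) h h'
      simp at *; tauto
    have a2 : (t ∪ t') ∩ s2 = t' := by
      ext x
      have := @ht x; have := @ht' x
      have := fun h h' => (Finset.disjoint_left.1 hd : ∀ ⦃a⦄, a ∈ s1 → a ∉ s2) (a := x) h h'
      simp at *; tauto
    rw [hf _ hsub, hg _ hsub, a1, a2]
  · intro t ht
    have k : t ∩ ((s1 ∪ s2 : Finset ι) : Set ι) ⊆ s := fun x hx => ht hx.1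
    rw [hf t ht, hg t ht, hf _ k, hg _ k]
    congr 2 <;> · ext x; simp; tauto

/-- Harris–FKG inequality. -/
lemma Ex_fkg (hp : IsW p) (hf : Monotone f) (hg : Monotone g) :
    Ex p s f * Ex p s g ≤ Ex p s (fun t => f t * g t) := by
  classical
  induction s using Finset.induction_on generalizing f g with
  | empty => simp [Ex_empty]
  | insert i s hi ih =>
    rw [Ex_insert hi, Ex_insert hi, Ex_insert hi]
    have m1 : Monotone (fun t : Set ι => f (insert i t)) :=
      fun a b h => hf (Set.insert_subset_insert h)
    have m2 : Monotone (fun t : Set ι => g (insert i t)) :=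
      fun a b h => hg (Set.insert_subset_insert h)
    have i1 := ih m1 m2
    have i2 := ih hf hg
    have j1 : Ex p s f ≤ Ex p s (fun t => f (insert i t)) :=
      Ex_mono hp fun t _ => hf (Set.subset_insert i t)
    have j2 : Ex p s g ≤ Ex p s (fun t => g (insert i t)) :=
      Ex_mono hp fun t _ => hg (Set.subset_insert i t)
    obtain ⟨h0, h1⟩ := hp i
    have h2 : 0 ≤ 1 - p i := by linarith
    have k1 := mul_le_mul_of_nonneg_left i1 h0
    have k2 := mul_le_mul_of_nonneg_left i2 h2
    have k3 := mul_nonneg (mul_nonneg h0 h2) (mul_nonneg (sub_nonneg.2 j1) (sub_nonneg.2 j2))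
    nlinarith

/-- Monotonicity in the parameters. -/
lemma Ex_mono_p (hp : IsW p) (hq : IsW q) (h : ∀ i ∈ s, p i ≤ q i) (hf : Monotone f) :
    Ex p s f ≤ Ex q s f := by
  classical
  induction s using Finset.induction_on generalizing f with
  | empty => simp [Ex_empty]
  | insert i s hi ih =>
    rw [Ex_insert hi, Ex_insert hi]
    have m1 : Monotone (fun t : Set ι => f (insert i t)) :=
      fun a b h => hf (Set.insert_subset_insert h)
    have h' : ∀ i ∈ s, p i ≤ q i := fun j hj => h j (Finset.mem_insert_of_mem hj)
    have i1 := ih h' m1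
    have i2 := ih h' hf
    have j1 : Ex q s f ≤ Ex q s (fun t => f (insert i t)) :=
      Ex_mono hq fun t _ => hf (Set.subset_insert i t)
    have hi' := h i (Finset.mem_insert_self _ _)
    obtain ⟨h0, h1⟩ := hp i
    have k1 := mul_le_mul_of_nonneg_left i1 h0
    have k2 := mul_le_mul_of_nonneg_left i2 (sub_nonneg.2 h1)
    have k3 := mul_nonneg (sub_nonneg.2 hi') (sub_nonneg.2 j1)
    nlinarith

/-- Reindexing along an embedding. -/
lemma Ex_map {κ : Type*} (φ : ι ↪ κ) {r : κ → ℝ} {F : Set κ → ℝ} :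
    Ex r (s.map φ) F = Ex (fun i => r (φ i)) s (fun t => F (φ '' t)) := by
  classical
  induction s using Finset.induction_on generalizing F with
  | empty => simp [Ex_empty]
  | insert i s hi ih =>
    rw [Finset.map_insert, Ex_insert (by simpa using hi), Ex_insert hi, ih, ih]
    simp [Set.image_insert_eq]

/-! Probabilities -/

lemma Pr_nonneg (hp : IsW p) : 0 ≤ Pr p s A := Ex_nonneg hp fun _ _ => ind_nonneg _
lemma Pr_le_one (hp : IsW p) : Pr p s A ≤ 1 := Ex_le hp fun _ _ => ind_le_one _
lemma Pr_mono (hp : IsW p) (h : ∀ t : Set ι, t ⊆ s → A t → B t) : Pr p s A ≤ Pr p s B :=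
  Ex_mono hp fun t ht => ind_mono (h t ht)
lemma Pr_congr (h : ∀ t : Set ι, t ⊆ s → (A t ↔ B t)) : Pr p s A = Pr p s B :=
  Ex_congr fun t ht => ind_congr (h t ht)
lemma Pr_not : Pr p s (fun t => ¬ A t) = 1 - Pr p s A := by
  unfold Pr
  simp_rw [ind_not]
  rw [Ex_sub, Ex_const]
lemma Pr_true (h : ∀ t : Set ι, t ⊆ s → A t) : Pr p s A = 1 := by
  unfold Pr
  rw [Ex_congr (g := fun _ => 1) fun t ht => ind_pos (h t ht), Ex_const]
lemma Pr_false (h : ∀ t : Set ι, t ⊆ s → ¬ A t) : Pr p s A = 0 := by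
  unfold Pr
  rw [Ex_congr (g := fun _ => 0) fun t ht => ind_neg (h t ht), Ex_const]

lemma Pr_union_le {κ : Type*} (hp : IsW p) (K : Finset κ) (F : κ → Set ι → Prop)
    (h : ∀ t : Set ι, t ⊆ s → A t → ∃ k ∈ K, F k t) :
    Pr p s A ≤ ∑ k ∈ K, Pr p s (F k) := by
  unfold Pr
  rw [← Ex_sum]
  refine Ex_mono hp fun t ht => ?_
  by_cases hA : A t
  · obtain ⟨k, hk, hF⟩ := h t ht hA
    rw [ind_pos hA]
    calc (1 : ℝ) = ind (F k t) := (ind_pos hF).symm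
      _ ≤ _ := Finset.single_le_sum (f := fun k => ind (F k t)) (fun _ _ => ind_nonneg _) hk
  · rw [ind_neg hA]
    exact Finset.sum_nonneg fun _ _ => ind_nonneg _

lemma Pr_or_le (hp : IsW p) : Pr p s (fun t => A t ∨ B t) ≤ Pr p s A + Pr p s B := by
  unfold Pr
  rw [← Ex_add]
  refine Ex_mono hp fun t _ => ?_
  by_cases hA : A t <;> by_cases hB : B t <;> simp [ind, hA, hB]

lemma Pr_local (hs : s' ⊆ s) (h : ∀ t : Set ι, t ⊆ s → (A t ↔ A (t ∩ s'))) :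
    Pr p s A = Pr p s' A := Ex_local hs fun t ht => ind_congr (h t ht)

lemma Pr_indep {s1 s2 : Finset ι} (h1 : s1 ⊆ s) (h2 : s2 ⊆ s) (hd : Disjoint s1 s2)
    (hA : ∀ t : Set ι, t ⊆ s → (A t ↔ A (t ∩ s1))) (hB : ∀ t : Set ι, t ⊆ s → (B t ↔ B (t ∩ s2))) :
    Pr p s (fun t => A t ∧ B t) = Pr p s1 A * Pr p s2 B := by
  unfold Pr
  simp_rw [ind_and]
  exact Ex_mul_indep h1 h2 hd (fun t ht => ind_congr (hA t ht)) (fun t ht => ind_congr (hB t ht))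

/-- increasing events -/
def Inc (A : Set ι → Prop) : Prop := ∀ t t' : Set ι, t ⊆ t' → A t → A t'

lemma Inc.mono (h : Inc A) : Monotone (fun t => ind (A t)) := fun t t' ht => ind_mono (h t t' ht)

lemma Pr_fkg (hp : IsW p) (hA : Inc A) (hB : Inc B) :
    Pr p s A * Pr p s B ≤ Pr p s (fun t => A t ∧ B t) := by
  unfold Pr
  simp_rw [ind_and]
  exact Ex_fkg hp hA.mono hB.mono

lemma Pr_mono_p (hp : IsW p) (hq : IsW q) (h : ∀ i ∈ s, p i ≤ q i) (hA : Inc A) :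
    Pr p s A ≤ Pr q s A := Ex_mono_p hp hq h hA.mono

lemma Pr_mono_s (hp : IsW p) (hs : s' ⊆ s) (hA : Inc A) : Pr p s' A ≤ Pr p s A := by
  have h1 : Pr p s' A = Pr p s' (fun t => A (t ∩ s')) := Pr_congr fun t ht => by
    rw [Set.inter_eq_left.2 ht]
  rw [h1, ← Pr_local hs (fun t _ => by rw [Set.inter_assoc, Set.inter_self])]
  exact Pr_mono hp fun t _ h => hA _ _ Set.inter_subset_left h

/-- all coordinates open -/
lemma Pr_all (u : Finset ι) (hu : u ⊆ s) : Pr p s (fun t => ↑u ⊆ t) = ∏ i ∈ u, p i := by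
  classical
  rw [Pr_local hu (fun t _ => by simp)]
  clear hu
  unfold Pr
  induction u using Finset.induction_on with
  | empty => simp [Ex_empty, ind]
  | insert i u hi ih =>
    rw [Ex_insert hi, Finset.prod_insert hi]
    have : Ex p u (fun t => ind (((insert i u : Finset ι) : Set ι) ⊆ t)) = 0 := by
      rw [Ex_congr (g := fun _ => 0), Ex_const]
      intro t ht
      apply ind_neg
      intro h
      exact hi (by simpa using ht (h (by simp)))
    rw [this, ← ih, mul_zero, add_zero]
    congr 1
    refine Ex_congr fun t ht => ind_congr ?_
    constructor
    · intro h x hx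
      have := h (show x ∈ ((insert i u : Finset ι) : Set ι) by simp at hx ⊢; tauto)
      rcases this with rfl | this
      · exact absurd hx (by simpa using hi)
      · exact this
    · intro h
      simpa using Set.insert_subset_insert h

/-- all coordinates closed -/
lemma Pr_none (u : Finset ι) (hu : u ⊆ s) :
    Pr p s (fun t => ∀ i ∈ u, i ∉ t) = ∏ i ∈ u, (1 - p i) := by
  classical
  rw [Pr_local hu (fun t _ => by
    constructor
    · intro h i hi h'
      exact h i hi h'.1
    · intro h i hi h'
      exact h i hi ⟨h', by simpa using hi⟩)]
  clear hu
  unfold Pr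
  induction u using Finset.induction_on with
  | empty => simp [Ex_empty, ind]
  | insert i u hi ih =>
    rw [Ex_insert hi, Finset.prod_insert hi]
    have : Ex p u (fun t => ind (∀ j ∈ insert i u, j ∉ insert i t)) = 0 := by
      rw [Ex_congr (g := fun _ => 0), Ex_const]
      intro t ht
      apply ind_neg
      intro h
      exact h i (by simp) (by simp)
    rw [this, ← ih, mul_zero, zero_add]
    congr 1
    refine Ex_congr fun t ht => ind_congr ?_
    constructor
    · intro h x hx
      exact h x (by simp [hx])
    · intro h x hx
      rcases Finset.mem_insert.1 hx with rfl | hx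
      · exact fun h' => hi (by simpa using ht h')
      · exact h x hx

/-- Exploration lemma. -/
lemma explore {α : Type*} (hp : IsW p) (X : Set ι → α) (E : Set ι → Prop)
    (sa sb : α → Finset ι) (Bv : α → Set ι → Prop) (gv : α → ℝ)
    (hsa : ∀ t : Set ι, t ⊆ s → sa (X t) ⊆ s) (hsb : ∀ t : Set ι, t ⊆ s → sb (X t) ⊆ s)
    (hdis : ∀ t : Set ι, t ⊆ s → Disjoint (sa (X t)) (sb (X t)))
    (hX : ∀ t t' : Set ι, t ⊆ s → t' ⊆ s → t ∩ sa (X t) = t' ∩ sa (X t) → X t' = X t)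
    (hE : ∀ t : Set ι, t ⊆ s → Bv (X t) (t ∩ sb (X t)) → E t)
    (hg : ∀ t : Set ι, t ⊆ s → gv (X t) ≤ Pr p (sb (X t)) (Bv (X t))) :
    Ex p s (fun t => gv (X t)) ≤ Pr p s E := by
  classical
  set T : Finset α := s.powerset.image (fun t : Finset ι => X t) with hT
  have hmem : ∀ t : Set ι, t ⊆ s → X t ∈ T := by
    intro t ht
    have hfin : t.Finite := s.finite_toSet.subset ht
    refine Finset.mem_image.2 ⟨hfin.toFinset, ?_, by simp⟩
    rw [Finset.mem_powerset]
    intro x hx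
    exact ht (by simpa using hx)
  have hTt : ∀ a ∈ T, ∃ t : Set ι, t ⊆ s ∧ X t = a := by
    intro a ha
    obtain ⟨t, ht, rfl⟩ := Finset.mem_image.1 ha
    exact ⟨t, by simpa using ht, rfl⟩
  have key : ∀ a ∈ T, Pr p s (fun t => X t = a) * gv a ≤
      Pr p s (fun t => X t = a ∧ Bv a (t ∩ sb a)) := by
    intro a ha
    obtain ⟨t0, ht0, rfl⟩ := hTt a ha
    set a := X t0
    have hXa : ∀ t : Set ι, t ⊆ s → (X t = a ↔ X (t ∩ sa a) = a) := by
      intro t ht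
      have hts : t ∩ sa a ⊆ s := fun x hx => ht hx.1
      constructor
      · intro h
        have := hX t (t ∩ sa a) ht hts (by rw [h]; simp [Set.inter_assoc])
        rw [this, h]
      · intro h
        have := hX (t ∩ sa a) t hts ht (by rw [h]; simp [Set.inter_assoc])
        rw [this, h]
    rw [Pr_indep (hsa t0 ht0) (hsb t0 ht0) (hdis t0 ht0) hXa
      (fun t _ => by rw [Set.inter_assoc, Set.inter_self]), Pr_local (hsa t0 ht0) hXa]
    refine mul_le_mul_of_nonneg_left ?_ (Pr_nonneg hp)
    refine (hg t0 ht0).trans (le_of_eq (Pr_congr fun t ht => ?_))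
    rw [Set.inter_eq_left.2 ht]
  calc Ex p s (fun t => gv (X t)) = Ex p s (fun t => ∑ a ∈ T, ind (X t = a) * gv a) := by
        refine Ex_congr fun t ht => ?_
        rw [Finset.sum_eq_single (X t)]
        · simp [ind]
        · intro b _ hb
          simp [ind, Ne.symm hb]
        · intro h
          exact absurd (hmem t ht) h
    _ = ∑ a ∈ T, Pr p s (fun t => X t = a) * gv a := by
        rw [Ex_sum]
        refine Finset.sum_congr rfl fun a _ => ?_
        rw [Ex_mul_right]
        rfl
    _ ≤ ∑ a ∈ T, Pr p s (fun t => X t = a ∧ Bv a (t ∩ sb a)) := Finset.sum_le_sum key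
    _ = Ex p s (fun t => ∑ a ∈ T, ind (X t = a ∧ Bv a (t ∩ sb a))) := by
        rw [Ex_sum]; rfl
    _ ≤ Pr p s E := by
        refine Ex_mono hp fun t ht => ?_
        rw [Finset.sum_eq_single (X t)]
        · exact ind_mono fun h => hE t ht h.2
        · intro b _ hb
          exact ind_neg fun h => hb h.1.symm
        · intro h
          exact absurd (hmem t ht) h

end FiniteProb

section FiniteProb2
variable {ι : Type*} {p : ι → ℝ} {s s' : Finset ι}

lemma Pr_forall_indep {κ : Type*} (S : Finset κ) (E : κ → Finset ι) (B : κ → Set ι → Prop)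
    (hs : ∀ q ∈ S, E q ⊆ s) (hd : ∀ q ∈ S, ∀ q' ∈ S, q ≠ q' → Disjoint (E q) (E q'))
    (hB : ∀ q ∈ S, ∀ t : Set ι, t ⊆ s → (B q t ↔ B q (t ∩ E q))) :
    Pr p s (fun t => ∀ q ∈ S, B q t) = ∏ q ∈ S, Pr p (E q) (B q) := by
  classical
  induction S using Finset.induction_on with
  | empty => simp [Pr_true]
  | insert a S ha ih =>
    have ih' := ih (fun q hq => hs q (by simp [hq]))
      (fun q hq q' hq' h => hd q (by simp [hq]) q' (by simp [hq']) h)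
      (fun q hq => hB q (by simp [hq]))
    rw [Finset.prod_insert ha, ← ih']
    have hloc : ∀ t : Set ι, t ⊆ s → ((∀ q ∈ S, B q t) ↔
        (∀ q ∈ S, B q (t ∩ ((S.biUnion E : Finset ι) : Set ι)))) := by
      intro t ht
      refine forall₂_congr fun q hq => ?_
      rw [hB q (by simp [hq]) t ht,
        hB q (by simp [hq]) (t ∩ ((S.biUnion E : Finset ι) : Set ι)) (fun x hx => ht hx.1),
        Set.inter_assoc]
      rw [Set.inter_eq_right.2 (show (E q : Set ι) ⊆ ((S.biUnion E : Finset ι) : Set ι) from ?_)]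
      exact_mod_cast Finset.subset_biUnion_of_mem E hq
    have hsub : S.biUnion E ⊆ s := Finset.biUnion_subset.2 fun q hq => hs q (by simp [hq])
    rw [Pr_local hsub hloc, ← Pr_indep (hs a (by simp)) hsub ?_ (hB a (by simp)) hloc]
    · refine Pr_congr fun t _ => ?_
      simp
    · rw [Finset.disjoint_biUnion_right]
      intro q hq
      exact hd a (by simp) q (by simp [hq]) (fun h => ha (h ▸ hq))

/-- Independent families of coordinates, none of which is fully open. -/
lemma Pr_none_family {κ : Type*} (S : Finset κ) (E : κ → Finset ι)
    (hs : ∀ q ∈ S, E q ⊆ s) (hd : ∀ q ∈ S, ∀ q' ∈ S, q ≠ q' → Disjoint (E q) (E q')) :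
    Pr p s (fun t => ∀ q ∈ S, ¬ (E q : Set ι) ⊆ t) = ∏ q ∈ S, (1 - ∏ i ∈ E q, p i) := by
  rw [Pr_forall_indep S E (fun q t => ¬ (E q : Set ι) ⊆ t) hs hd]
  · refine Finset.prod_congr rfl fun q _ => ?_
    rw [Pr_not, Pr_all _ (Finset.Subset.refl _)]
  · intro q _ t _
    simp

/-- Domination of layered percolation. -/
lemma Ex_layer {κ : Type*} {r : κ → ℝ} (hr : IsW r) (hp : IsW p) (π : κ → ι) (u : Finset ι)
    (w : Finset κ) {f : Set ι → ℝ} (hf : Monotone f) (hw : ∀ i ∈ w, π i ∈ u)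
    (h : ∀ e ∈ u, ∀ w' : Finset κ, w' ⊆ w → (∀ i ∈ w', π i = e) →
      1 - p e ≤ ∏ i ∈ w', (1 - r i)) :
    Ex r w (fun t => f (π '' t)) ≤ Ex p u f := by
  classical
  induction u using Finset.induction_on generalizing w f with
  | empty =>
    have : w = ∅ := Finset.eq_empty_of_forall_notMem fun i hi => by simpa using hw i hi
    subst this
    simp [Ex_empty]
  | insert e u he ih =>
    set w1 := w.filter (fun i => π i = e) with hw1
    set w2 := w.filter (fun i => ¬ π i = e) with hw2
    have hu : w1 ∪ w2 = w := Finset.filter_union_filter_not_eq _ _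
    have hdj : Disjoint w1 w2 := Finset.disjoint_filter_filter_not _ _ _
    have m1 : Monotone (fun t : Set ι => f (insert e t)) :=
      fun a b h => hf (Set.insert_subset_insert h)
    have hw' : ∀ i ∈ w2, π i ∈ u := by
      intro i hi
      rw [hw2, Finset.mem_filter] at hi
      have := hw i hi.1
      simp at this
      tauto
    have h' : ∀ e ∈ u, ∀ w' : Finset κ, w' ⊆ w2 → (∀ i ∈ w', π i = e) →
      1 - p e ≤ ∏ i ∈ w', (1 - r i) := fun e' he' w' hw' =>
        h e' (by simp [he']) w' (hw'.trans (Finset.filter_subset _ _))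
    have i0 := ih w2 hf hw' h'
    have i1 := ih w2 m1 hw' h'
    rw [Ex_insert he]
    set X0 := Ex r w2 (fun t => f (π '' t)) with hX0
    set X1 := Ex r w2 (fun t => f (insert e (π '' t))) with hX1
    have h01 : X0 ≤ X1 := Ex_mono hr fun t _ => hf (Set.subset_insert _ _)
    have hc : Ex r w (fun t => f (π '' t)) =
        Ex r w1 (fun t => ind (∀ i ∈ w1, i ∉ t) * X0 + (1 - ind (∀ i ∈ w1, i ∉ t)) * X1) := by
      conv_lhs => rw [← hu]
      rw [Ex_union hdj]
      refine Ex_congr fun t ht => ?_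
      by_cases hc : ∀ i ∈ w1, i ∉ t
      · have : t = ∅ := Set.eq_empty_of_forall_notMem fun i hi => hc i (by simpa using ht hi) hi
        rw [ind_pos hc]
        simp [this, hX0]
      · rw [ind_neg hc]
        have : π '' t = {e} := by
          push Not at hc
          obtain ⟨i, hi, hit⟩ := hc
          have hall : ∀ j ∈ t, π j = e := fun j hj => by
            have := ht hj
            simp [hw1] at this
            exact this.2
          ext x
          simp only [Set.mem_image, Set.mem_singleton_iff]
          constructor
          · rintro ⟨j, hj, rfl⟩
            exact hall j hj
          · rintro rfl
            exact ⟨i, hit, hall i hit⟩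
        simp [Set.image_union, this, hX1]
    rw [hc, Ex_add, Ex_mul_right, Ex_mul_right, Ex_sub, Ex_const]
    have hpr : Ex r w1 (fun t => ind (∀ i ∈ w1, i ∉ t)) = ∏ i ∈ w1, (1 - r i) :=
      Pr_none w1 (Finset.Subset.refl _)
    rw [hpr]
    have hle := h e (by simp) w1 (Finset.filter_subset _ _) (fun i hi => by
      simp [hw1] at hi
      exact hi.2)
    obtain ⟨p0, p1⟩ := hp e
    have k1 := mul_le_mul_of_nonneg_left i1 p0
    have k2 := mul_le_mul_of_nonneg_left i0 (sub_nonneg.2 p1)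
    have k3 := mul_nonneg (sub_nonneg.2 hle) (sub_nonneg.2 h01)
    nlinarith

end FiniteProb2

/-! ### Reachability -/
section Reach
variable {α : Type*} {r : α → α → Prop}
open Relation

lemma first_exit {P : α → Prop} {a b : α} (h : ReflTransGen r a b) (ha : P a) (hb : ¬ P b) :
    ∃ c e, ReflTransGen (fun x y => P x ∧ P y ∧ r x y) a c ∧ P c ∧ r c e ∧ ¬ P e ∧
      ReflTransGen r e b := by
  induction h using ReflTransGen.head_induction_on with
  | refl => exact absurd ha hb
  | head hac hcb ih =>
    rename_i a c
    by_cases hc : P c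
    · obtain ⟨c', e, h1, h2, h3, h4, h5⟩ := ih hc
      exact ⟨c', e, ReflTransGen.head ⟨ha, hc, hac⟩ h1, h2, h3, h4, h5⟩
    · exact ⟨a, c, ReflTransGen.refl, ha, hac, hc, hcb⟩

lemma last_exit {P : α → Prop} {a b : α} (h : ReflTransGen r a b) (ha : P a) (hb : ¬ P b) :
    ∃ c e, ReflTransGen r a c ∧ P c ∧ r c e ∧ ¬ P e ∧
      ReflTransGen (fun x y => ¬ P x ∧ ¬ P y ∧ r x y) e b := by
  induction h with
  | refl => exact absurd ha hb
  | tail hac hcb ih =>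
    rename_i c b
    by_cases hc : P c
    · exact ⟨c, b, hac, hc, hcb, hb, ReflTransGen.refl⟩
    · obtain ⟨c', e, h1, h2, h3, h4, h5⟩ := ih hc
      exact ⟨c', e, h1, h2, h3, h4, h5.tail ⟨hc, hb, hcb⟩⟩

lemma rtg_inv {P : α → Prop} {a b : α} (h : ReflTransGen r a b) (ha : P a)
    (hs : ∀ x y, P x → r x y → P y) : P b := by
  induction h with
  | refl => exact ha
  | tail _ h ih => exact hs _ _ ih h

lemma rtg_symm (hr : ∀ x y, r x y → r y x) {a b : α} (h : ReflTransGen r a b) :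
    ReflTransGen r b a := by
  induction h with
  | refl => exact ReflTransGen.refl
  | tail _ h ih => exact ReflTransGen.head (hr _ _ h) ih

lemma rtg_mono {r' : α → α → Prop} (hr : ∀ x y, r x y → r' x y) {a b : α}
    (h : ReflTransGen r a b) : ReflTransGen r' a b := by
  induction h with
  | refl => exact ReflTransGen.refl
  | tail _ h ih => exact ih.tail (hr _ _ h)

lemma rtg_lift {β : Type*} {r' : β → β → Prop} (f : α → β) (hr : ∀ x y, r x y → r' (f x) (f y))
    {a b : α} (h : ReflTransGen r a b) : ReflTransGen r' (f a) (f b) := by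
  induction h with
  | refl => exact ReflTransGen.refl
  | tail _ h ih => exact ih.tail (hr _ _ h)

/-- conversion to a sequence -/
lemma rtg_path {a b : α} (h : ReflTransGen r a b) :
    ∃ (n : ℕ) (f : ℕ → α), f 0 = a ∧ f n = b ∧ ∀ i < n, r (f i) (f (i + 1)) := by
  induction h with
  | refl => exact ⟨0, fun _ => a, rfl, rfl, fun i hi => absurd hi (by omega)⟩
  | tail _ h ih =>
    rename_i b c _
    obtain ⟨n, f, h0, hn, hf⟩ := ih
    refine ⟨n + 1, fun i => if i ≤ n then f i else c, by simp [h0], by simp, fun i hi => ?_⟩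
    by_cases h' : i < n
    · have e1 : i ≤ n := h'.le
      have e2 : i + 1 ≤ n := h'
      simp only [e1, e2, if_true]
      exact hf i h'
    · have : i = n := by omega
      subst this
      simpa [hn] using h

lemma path_rtg {n : ℕ} {f : ℕ → α} (hf : ∀ i < n, r (f i) (f (i + 1))) {i j : ℕ} (hij : i ≤ j)
    (hj : j ≤ n) : ReflTransGen r (f i) (f j) := by
  induction j, hij using Nat.le_induction with
  | base => exact ReflTransGen.refl
  | succ j hij ih => exact (ih (by omega)).tail (hf j (by omega))

end Reach

/-! ### Lattice basics -/
section Lattice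
variable {d : ℕ}
open Relation

lemma dist1_comm (u v : V d) : dist1 u v = dist1 v u := by
  unfold dist1
  exact Finset.sum_congr rfl fun i _ => by rw [← Int.natAbs_neg, neg_sub]

lemma sym2dist1_mk (u v : V d) : sym2dist1 s(u, v) = dist1 u v := rfl

lemma dist1_eq_one_iff {u v : V d} :
    dist1 u v = 1 ↔ ∃ k, |u k - v k| = 1 ∧ ∀ l, l ≠ k → u l = v l := by
  unfold dist1
  constructor
  · intro h
    have hex : ∃ k, (u k - v k).natAbs ≠ 0 := by
      by_contra hc
      push Not at hc
      simp [hc] at h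
    obtain ⟨k, hk⟩ := hex
    rw [← Finset.add_sum_erase _ _ (Finset.mem_univ k)] at h
    have h0 : ∑ x ∈ Finset.univ.erase k, (u x - v x).natAbs = 0 := by omega
    refine ⟨k, by rw [Int.abs_eq_natAbs]; omega, fun l hl => ?_⟩
    have := (Finset.sum_eq_zero_iff.1 h0) l (by simp [hl])
    omega
  · rintro ⟨k, hk, hl⟩
    rw [Finset.sum_eq_single k]
    · rw [Int.abs_eq_natAbs] at hk; omega
    · intro l _ hlk
      simp [hl l hlk]
    · simp

lemma adj_abs {u v : V d} (h : dist1 u v = 1) (k : Fin d) : |u k - v k| ≤ 1 := by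
  obtain ⟨l, h1, h2⟩ := dist1_eq_one_iff.1 h
  by_cases hk : k = l
  · subst hk; omega
  · rw [h2 k hk]; simp

lemma adj_ne {u v : V d} (h : dist1 u v = 1) : u ≠ v := by
  rintro rfl
  simp [dist1] at h

/-- Open lattice step inside `S`. -/
def Stp (t : Set (Sym2 (V d))) (S : Set (V d)) (u v : V d) : Prop :=
  u ∈ S ∧ v ∈ S ∧ dist1 u v = 1 ∧ s(u, v) ∈ t

/-- Open connection inside `S`. -/
def Cn (t : Set (Sym2 (V d))) (S : Set (V d)) : V d → V d → Prop := ReflTransGen (Stp t S)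

variable {t t' : Set (Sym2 (V d))} {S S' : Set (V d)} {u v w : V d}

lemma Stp.symm (h : Stp t S u v) : Stp t S v u :=
  ⟨h.2.1, h.1, by rw [dist1_comm]; exact h.2.2.1, by rw [Sym2.eq_swap]; exact h.2.2.2⟩

lemma Cn.refl (u : V d) : Cn t S u u := ReflTransGen.refl
lemma Cn.symm (h : Cn t S u v) : Cn t S v u := rtg_symm (fun _ _ => Stp.symm) h
lemma Cn.trans (h : Cn t S u v) (h' : Cn t S v w) : Cn t S u w := ReflTransGen.trans h h'
lemma Cn.mono (h : Cn t S u v) (ht : t ⊆ t') (hS : S ⊆ S') : Cn t' S' u v :=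
  rtg_mono (fun _ _ h => ⟨hS h.1, hS h.2.1, h.2.2.1, ht h.2.2.2⟩) h
lemma Cn.mem (h : Cn t S u v) (hu : u ∈ S) : v ∈ S := rtg_inv h hu fun _ _ _ h => h.2.1

/-- Edges inside a finite region. -/
def Ed (S : Finset (V d)) : Finset (Sym2 (V d)) := S.sym2.filter (fun e => sym2dist1 e = 1)

lemma mem_Ed {S : Finset (V d)} : s(u, v) ∈ Ed S ↔ u ∈ S ∧ v ∈ S ∧ dist1 u v = 1 := by
  simp [Ed, sym2dist1_mk, and_assoc]

lemma Ed_mono {S S' : Finset (V d)} (h : S ⊆ S') : Ed S ⊆ Ed S' := by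
  intro e he
  induction e with | _ u v
  rw [mem_Ed] at *
  exact ⟨h he.1, h he.2.1, he.2.2⟩

lemma Cn_local {S : Finset (V d)} : Cn t S u v ↔ Cn (t ∩ Ed S) S u v := by
  constructor
  · refine rtg_mono fun a b h => ⟨h.1, h.2.1, h.2.2.1, h.2.2.2, ?_⟩
    exact mem_Ed.2 ⟨h.1, h.2.1, h.2.2.1⟩
  · intro h
    exact h.mono Set.inter_subset_left (le_refl _)

lemma Cn_local_of {S : Finset (V d)} {T : Finset (Sym2 (V d))} (hT : Ed S ⊆ T) :
    Cn t S u v ↔ Cn (t ∩ T) S u v := by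
  rw [Cn_local, Cn_local (t := t ∩ T), Set.inter_assoc,
    Set.inter_eq_right.2 (show (Ed S : Set (Sym2 (V d))) ⊆ T by exact_mod_cast hT)]

lemma Cn_inc {S : Set (V d)} : Inc (fun t : Set (Sym2 (V d)) => Cn t S u v) :=
  fun _ _ h h' => h'.mono h (le_refl _)

/-- Boxes are connected. -/
lemma Cn_box {lo hi : V d} {S : Set (V d)} (hS : ∀ x, lo ≤ x → x ≤ hi → x ∈ S)
    (ht : ∀ x y, lo ≤ x → x ≤ hi → lo ≤ y → y ≤ hi → dist1 x y = 1 → s(x, y) ∈ t)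
    (u v : V d) (hu : lo ≤ u) (hu' : u ≤ hi) (hv : lo ≤ v) (hv' : v ≤ hi) : Cn t S u v := by
  generalize hn : dist1 u v = n
  induction n using Nat.strong_induction_on generalizing u with
  | _ n ih =>
    by_cases huv : u = v
    · subst huv; exact Cn.refl _
    · have hex : ∃ k, u k ≠ v k := by
        by_contra hc
        push Not at hc
        exact huv (funext hc)
      obtain ⟨k, hk⟩ := hex
      set z : ℤ := if u k < v k then u k + 1 else u k - 1 with hz
      set w : V d := Function.update u k z with hw
      have hwk : w k = z := by simp [hw]
      have hwl : ∀ l, l ≠ k → w l = u l := fun l hl => by simp [hw, hl]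
      have hlo : lo ≤ w := by
        intro l
        by_cases hl : l = k
        · subst hl
          change lo l ≤ w l
          rw [hwk, hz]
          have h1 : lo l ≤ u l := hu l
          have h2 : lo l ≤ v l := hv l
          split_ifs <;> omega
        · rw [hwl l hl]; exact hu l
      have hhi : w ≤ hi := by
        intro l
        by_cases hl : l = k
        · subst hl
          change w l ≤ hi l
          rw [hwk, hz]
          have h1 : u l ≤ hi l := hu' l
          have h2 : v l ≤ hi l := hv' l
          split_ifs <;> omega
        · rw [hwl l hl]; exact hu' l
      have hadj : dist1 u w = 1 := by
        rw [dist1_eq_one_iff]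
        refine ⟨k, ?_, fun l hl => (hwl l hl).symm⟩
        rw [hwk, hz]
        split_ifs <;> simp
      have hlt : dist1 w v < n := by
        rw [← hn]
        unfold dist1
        refine Finset.sum_lt_sum (fun l _ => ?_) ⟨k, Finset.mem_univ _, ?_⟩
        · by_cases hl : l = k
          · subst hl
            rw [hwk, hz]
            split_ifs <;> omega
          · rw [hwl l hl]
        · rw [hwk, hz]
          split_ifs <;> omega
      refine ReflTransGen.head ⟨hS u hu hu', hS w hlo hhi, hadj, ht u w hu hu' hlo hhi hadj⟩ ?_
      exact ih _ hlt w hlo hhi rfl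

/-! Symmetries -/

/-- Lattice isometries. -/
structure Iso (d : ℕ) where
  e : V d ≃ V d
  iso : ∀ x y, dist1 (e x) (e y) = dist1 x y

lemma Ed_map (σ : Iso d) (S : Finset (V d)) :
    Ed (S.map σ.e.toEmbedding) = (Ed S).map ⟨Sym2.map σ.e, Sym2.map.injective σ.e.injective⟩ := by
  ext e
  induction e with | _ u v
  rw [mem_Ed]
  simp only [Finset.mem_map, Function.Embedding.coeFn_mk]
  constructor
  · rintro ⟨⟨a, ha, rfl⟩, ⟨b, hb, rfl⟩, h⟩
    exact ⟨s(a, b), mem_Ed.2 ⟨ha, hb, by rwa [σ.iso] at h⟩, rfl⟩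
  · rintro ⟨e, he, h⟩
    induction e with | _ a b
    rw [mem_Ed] at he
    rw [Sym2.map_mk, Sym2.eq_iff] at h
    rcases h with ⟨rfl, rfl⟩ | ⟨rfl, rfl⟩
    · exact ⟨⟨a, he.1, rfl⟩, ⟨b, he.2.1, rfl⟩, by rw [σ.iso]; exact he.2.2⟩
    · exact ⟨⟨b, he.2.1, rfl⟩, ⟨a, he.1, rfl⟩, by rw [σ.iso, dist1_comm]; exact he.2.2⟩

/-- Percolation probability in a finite region. -/
noncomputable def PrE (p : ℝ) (S : Finset (V d)) (A : Set (Sym2 (V d)) → Prop) : ℝ :=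
  Pr (fun _ => p) (Ed S) A

lemma PrE_map (σ : Iso d) (p : ℝ) (S : Finset (V d)) (A : Set (Sym2 (V d)) → Prop) :
    PrE p (S.map σ.e.toEmbedding) A = PrE p S (fun t => A (Sym2.map σ.e '' t)) := by
  unfold PrE Pr
  rw [Ed_map, Ex_map]
  rfl

lemma Stp_map (σ : Iso d) : Stp (Sym2.map σ.e '' t) (σ.e '' S) (σ.e u) (σ.e v) ↔ Stp t S u v := by
  unfold Stp
  rw [σ.iso, ← Sym2.map_mk]
  rw [σ.e.injective.mem_set_image, σ.e.injective.mem_set_image,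
    Function.Injective.mem_set_image (Sym2.map.injective σ.e.injective)]

lemma Cn_map (σ : Iso d) : Cn (Sym2.map σ.e '' t) (σ.e '' S) (σ.e u) (σ.e v) ↔ Cn t S u v := by
  constructor
  · intro h
    have := rtg_lift (r := Stp (Sym2.map σ.e '' t) (σ.e '' S)) (r' := Stp t S) σ.e.symm
      (fun a b hab => by
        rw [← Stp_map σ]
        simpa using hab) h
    simp only [Equiv.symm_apply_apply] at this
    exact this
  · intro h
    exact rtg_lift σ.e (fun a b hab => (Stp_map σ).2 hab) h

/-- translation -/
def trIso (b : V d) : Iso d where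
  e := Equiv.addRight b
  iso x y := by simp [dist1]

/-- signed permutation -/
def spIso (π : Equiv.Perm (Fin d)) (σ : Fin d → ℤˣ) : Iso d where
  e :=
    { toFun := fun x l => σ l * x (π l)
      invFun := fun y l => σ (π.symm l) * y (π.symm l)
      left_inv := fun x => by
        funext l
        simp only [Equiv.apply_symm_apply]
        rcases Int.units_eq_one_or (σ (π.symm l)) with h | h <;> simp [h]
      right_inv := fun x => by
        funext l
        simp only [Equiv.symm_apply_apply]
        rcases Int.units_eq_one_or (σ l) with h | h <;> simp [h] }
  iso x y := by
    unfold dist1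
    rw [← Equiv.sum_comp π (fun l => (x l - y l).natAbs)]
    refine Finset.sum_congr rfl fun l _ => ?_
    simp only [Equiv.coe_fn_mk]
    rcases Int.units_eq_one_or (σ l) with h | h <;> simp [h]
    rw [← Int.natAbs_neg]
    congr 1
    ring

end Lattice

section SeedBase
variable {d : ℕ}
open Relation

/-- The centred box of radius `n`. -/
noncomputable def Bx (d n : ℕ) : Finset (V d) := Finset.Icc (fun _ => -(n : ℤ)) (fun _ => (n : ℤ))

lemma mem_Bx {n : ℕ} {x : V d} : x ∈ Bx d n ↔ ∀ k, -(n : ℤ) ≤ x k ∧ x k ≤ n := by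
  simp only [Bx, Finset.mem_Icc, Pi.le_def]
  exact forall_and.symm

lemma Bx_mono {m n : ℕ} (h : m ≤ n) : Bx d m ⊆ Bx d n := by
  intro x hx
  rw [mem_Bx] at *
  intro k
  have := hx k
  omega

/-- Boundary points of the box. -/
def Bd (n : ℕ) (x : V d) : Prop := x ∈ Bx d n ∧ ∃ k, x k = n ∨ x k = -(n : ℤ)

lemma Bd_of_exit {n : ℕ} {x y : V d} (hx : x ∈ Bx d n) (hy : y ∉ Bx d n) (h : dist1 x y = 1) :
    Bd n x := by
  refine ⟨hx, ?_⟩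
  rw [mem_Bx] at *
  push Not at hy
  obtain ⟨k, hk⟩ := hy
  have h1 := hx k
  have h2 := abs_le.1 (adj_abs h k)
  exact ⟨k, by omega⟩

/-- one-arm probability -/
noncomputable def th (d : ℕ) (p : ℝ) (n : ℕ) : ℝ :=
  PrE p (Bx d n) (fun t => ∃ v, Bd n v ∧ Cn t (Bx d n) 0 v)

/-- The box of radius `m` is connected to the boundary of the box of radius `n`. -/
def Arm (m n : ℕ) (t : Set (Sym2 (V d))) : Prop :=
  ∃ u ∈ Bx d m, ∃ v, Bd n v ∧ Cn t (Bx d n) u v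

noncomputable def fr (d : ℕ) (p : ℝ) (m n : ℕ) : ℝ := PrE p (Bx d n) (Arm m n)

lemma isW_const {ι : Type*} {p : ℝ} (h0 : 0 ≤ p) (h1 : p ≤ 1) : IsW (fun _ : ι => p) :=
  fun _ => ⟨h0, h1⟩

lemma zero_mem_Bx (n : ℕ) : (0 : V d) ∈ Bx d n := by
  rw [mem_Bx]; intro k; simp

lemma th_le {p : ℝ} (h0 : 0 ≤ p) (h1 : p ≤ 1) {m n : ℕ} (hmn : m < n) :
    th d p n ≤ th d p m * fr d p m n := by
  classical
  set A : Set (Sym2 (V d)) → Prop := fun t => ∃ v, Bd m v ∧ Cn t (Bx d m) 0 v with hA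
  set B : Set (Sym2 (V d)) → Prop := fun t => ∃ u ∈ Bx d m, ∃ v, Bd n v ∧
    Cn (t ∩ ((Ed (Bx d n) \ Ed (Bx d m) : Finset _) : Set _)) (Bx d n) u v with hB
  have hW : IsW (fun _ : Sym2 (V d) => p) := isW_const h0 h1
  have hsub : Ed (Bx d m) ⊆ Ed (Bx d n) := Ed_mono (Bx_mono hmn.le)
  have s1 : th d p n ≤ Pr (fun _ => p) (Ed (Bx d n)) (fun t => A t ∧ B t) := by
    unfold th PrE
    refine Pr_mono hW fun t ht => ?_
    rintro ⟨v, hv, hc⟩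
    have hvm : v ∉ Bx d m := by
      intro h
      obtain ⟨k, hk⟩ := hv.2
      have := mem_Bx.1 h k
      omega
    constructor
    · obtain ⟨c, e, h1, h2, h3, h4, -⟩ := first_exit (P := fun x => x ∈ Bx d m) hc
        (zero_mem_Bx m) hvm
      exact ⟨c, Bd_of_exit h2 h4 h3.2.2.1,
        rtg_mono (fun x y h => ⟨h.1, h.2.1, h.2.2.2.2.1, h.2.2.2.2.2⟩) h1⟩
    · obtain ⟨c, e, h1, h2, h3, h4, h5⟩ := last_exit (P := fun x => x ∈ Bx d m) hc
        (zero_mem_Bx m) hvm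
      refine ⟨c, h2, v, hv, ReflTransGen.head (b := e) ?_ (rtg_mono (fun x y h => ?_) h5)⟩
      · refine ⟨h3.1, h3.2.1, h3.2.2.1, h3.2.2.2, ?_⟩
        simp only [Finset.coe_sdiff, Set.mem_diff, Finset.mem_coe, mem_Ed]
        exact ⟨⟨h3.1, h3.2.1, h3.2.2.1⟩, fun h => h4 h.2.1⟩
      · obtain ⟨hx, hy, h⟩ := h
        refine ⟨h.1, h.2.1, h.2.2.1, h.2.2.2, ?_⟩
        simp only [Finset.coe_sdiff, Set.mem_diff, Finset.mem_coe, mem_Ed]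
        exact ⟨⟨h.1, h.2.1, h.2.2.1⟩, fun h => hx h.1⟩
  refine s1.trans ?_
  rw [Pr_indep hsub Finset.sdiff_subset Finset.disjoint_sdiff]
  · refine mul_le_mul_of_nonneg_left ?_ (Pr_nonneg hW)
    rw [← Pr_local (Finset.sdiff_subset (s := Ed (Bx d n)) (t := Ed (Bx d m))) (A := B)]
    · refine Pr_mono hW fun t _ => ?_
      rintro ⟨u, hu, v, hv, h⟩
      exact ⟨u, hu, v, hv, h.mono Set.inter_subset_left (le_refl _)⟩
    · intro t _
      simp only [hB, Set.inter_assoc, Set.inter_self]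
  · intro t _
    simp only [hA]
    refine exists_congr fun v => and_congr_right fun _ => Cn_local
  · intro t _
    simp only [hB, Set.inter_assoc, Set.inter_self]

lemma fr_large {p : ℝ} (h0 : 0 ≤ p) (h1 : p ≤ 1) {θ : ℝ} (hθ : 0 < θ) (hth : ∀ n, θ ≤ th d p n)
    {η : ℝ} (hη : 0 < η) : ∃ m, ∀ n, m < n → 1 - η ≤ fr d p m n := by
  have hW : IsW (fun _ : Sym2 (V d) => p) := isW_const h0 h1
  have hanti : Antitone (th d p) := by
    refine antitone_nat_of_succ_le fun n => ?_
    refine (th_le h0 h1 (Nat.lt_succ_self n)).trans ?_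
    exact mul_le_of_le_one_right (le_trans hθ.le (hth n)) (Pr_le_one hW)
  have hbdd : BddBelow (Set.range (th d p)) := ⟨θ, by rintro _ ⟨n, rfl⟩; exact hth n⟩
  set L := ⨅ n, th d p n with hL
  have hLn : ∀ n, L ≤ th d p n := fun n => ciInf_le hbdd n
  have hLθ : θ ≤ L := le_ciInf hth
  have hLpos : 0 < L := hθ.trans_le hLθ
  obtain ⟨m, hm⟩ : ∃ m, th d p m < L + η * L := by
    apply exists_lt_of_ciInf_lt
    have := mul_pos hη hLpos
    linarith
  refine ⟨m, fun n hn => ?_⟩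
  have h2 := th_le (d := d) h0 h1 hn
  have h3 := hLn n
  have h4 := hLn m
  have hf0 : 0 ≤ fr d p m n := Pr_nonneg hW
  by_contra hc
  push Not at hc
  by_cases hη1 : η ≤ 1
  · have a1 : th d p m * fr d p m n ≤ (L + η * L) * (1 - η) := by
      apply mul_le_mul hm.le hc.le hf0
      nlinarith
    nlinarith [mul_pos (mul_pos hη hη) hLpos]
  · linarith

open Classical in
/-- reached boundary points -/
noncomputable def RS (m n : ℕ) (t : Set (Sym2 (V d))) : Finset (V d) :=
  (Bx d n).filter (fun v => Bd n v ∧ ∃ u ∈ Bx d m, Cn t (Bx d n) u v)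

lemma mem_RS {m n : ℕ} {t : Set (Sym2 (V d))} {v : V d} :
    v ∈ RS m n t ↔ Bd n v ∧ ∃ u ∈ Bx d m, Cn t (Bx d n) u v := by
  simp only [RS, Finset.mem_filter]
  exact ⟨fun h => h.2, fun h => ⟨h.1.1, h⟩⟩

lemma RS_nonempty {m n : ℕ} {t : Set (Sym2 (V d))} : (RS m n t).Nonempty ↔ Arm m n t := by
  constructor
  · rintro ⟨v, hv⟩
    obtain ⟨h1, u, h2, h3⟩ := mem_RS.1 hv
    exact ⟨u, h2, v, h1, h3⟩
  · rintro ⟨u, h2, v, h1, h3⟩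
    exact ⟨v, mem_RS.2 ⟨h1, u, h2, h3⟩⟩

/-- edges at a vertex -/
def incE (v : V d) : Finset (Sym2 (V d)) :=
  (Finset.univ : Finset (Fin d × Bool)).image
    (fun kb => s(v, Function.update v kb.1 (v kb.1 + if kb.2 then 1 else -1)))

lemma card_incE (v : V d) : (incE v).card ≤ 2 * d := by
  refine Finset.card_image_le.trans ?_
  simp [mul_comm]

lemma mem_incE {u v : V d} (h : dist1 u v = 1) : s(u, v) ∈ incE u := by
  obtain ⟨k, h1, h2⟩ := dist1_eq_one_iff.1 h
  unfold incE
  rw [Finset.mem_image]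
  refine ⟨(k, decide (u k < v k)), Finset.mem_univ _, ?_⟩
  congr 1
  funext l
  by_cases hl : l = k
  · subst hl
    simp only [Function.update_self, decide_eq_true_eq]
    rcases (abs_eq (by norm_num : (0:ℤ) ≤ 1)).1 h1 with h | h
    · rw [if_neg (by omega)]; omega
    · rw [if_pos (by omega)]; omega
  · simp [hl, h2 l hl]

lemma arm_local {m n : ℕ} {T : Finset (Sym2 (V d))} (hT : Ed (Bx d n) ⊆ T)
    (t : Set (Sym2 (V d))) : Arm m n t ↔ Arm m n (t ∩ T) := by
  unfold Arm
  refine exists_congr fun u => and_congr_right fun _ => exists_congr fun v =>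
    and_congr_right fun _ => Cn_local_of hT

lemma RS_local {m n : ℕ} {T : Finset (Sym2 (V d))} (hT : Ed (Bx d n) ⊆ T)
    (t : Set (Sym2 (V d))) : RS m n t = RS m n (t ∩ T) := by
  ext v
  rw [mem_RS, mem_RS]
  refine and_congr_right fun _ => exists_congr fun u => and_congr_right fun _ => Cn_local_of hT

lemma arm_succ_arm {m n : ℕ} (hmn : m ≤ n) {t : Set (Sym2 (V d))} (h : Arm m (n + 1) t) :
    ∃ c ∈ RS m n t, ∃ e, e ∉ Bx d n ∧ e ∈ Bx d (n + 1) ∧ dist1 c e = 1 ∧ s(c, e) ∈ t := by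
  obtain ⟨u, hu, v, hv, hc⟩ := h
  have hvn : v ∉ Bx d n := by
    intro h
    obtain ⟨k, hk⟩ := hv.2
    have := mem_Bx.1 h k
    push_cast at hk
    omega
  obtain ⟨c, e, h1, h2, h3, h4, -⟩ := first_exit (P := fun x => x ∈ Bx d n) hc
    (Bx_mono hmn hu) hvn
  refine ⟨c, mem_RS.2 ⟨Bd_of_exit h2 h4 h3.2.2.1, u, hu, ?_⟩, e, h4, h3.2.1, h3.2.2⟩
  exact rtg_mono (fun x y h => ⟨h.1, h.2.1, h.2.2.2.2.1, h.2.2.2.2.2⟩) h1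

/-- closing the exits of a small reached set -/
lemma close_exits {p : ℝ} (h0 : 0 ≤ p) (h1 : p ≤ 1) {m n : ℕ} (hmn : m ≤ n) (J : ℕ) :
    PrE p (Bx d n) (fun t => (RS m n t).Nonempty ∧ (RS m n t).card < J) * (1 - p) ^ (2 * d * J) ≤
      fr d p m n - fr d p m (n + 1) := by
  classical
  have hW : IsW (fun _ : Sym2 (V d) => p) := isW_const h0 h1
  set s1 := Ed (Bx d n) with hs1
  set s2 := Ed (Bx d (n + 1)) with hs2
  have hsub : s1 ⊆ s2 := Ed_mono (Bx_mono (Nat.le_succ n))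
  have e1 : fr d p m n - fr d p m (n + 1) =
      Pr (fun _ => p) s2 (fun t => Arm m n t ∧ ¬ Arm m (n + 1) t) := by
    have a1 : fr d p m n = Pr (fun _ => p) s2 (Arm m n) :=
      (Pr_local hsub fun t _ => arm_local (Finset.Subset.refl _) t).symm
    rw [a1]
    unfold fr PrE Pr
    rw [← Ex_sub]
    refine Ex_congr fun t _ => ?_
    by_cases hA : Arm m n t
    · by_cases hB : Arm m (n + 1) t <;> simp [ind, hA, hB]
    · have hB : ¬ Arm m (n + 1) t := fun h => by
        obtain ⟨c, hc, -⟩ := arm_succ_arm hmn h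
        exact hA (RS_nonempty.1 ⟨c, hc⟩)
      simp [ind, hA, hB]
  have hs : s1 ∪ (s2 \ s1) = s2 := Finset.union_sdiff_of_subset hsub
  rw [e1]
  unfold PrE Pr
  conv_rhs => rw [← hs]
  rw [Ex_union Finset.disjoint_sdiff, ← Ex_mul_right]
  refine Ex_mono hW fun t ht => ?_
  by_cases hC : (RS m n t).Nonempty ∧ (RS m n t).card < J
  swap
  · rw [ind_neg hC, zero_mul]
    exact Ex_nonneg hW fun _ _ => ind_nonneg _
  rw [ind_pos hC, one_mul]
  set K := (RS m n t).biUnion incE ∩ (s2 \ s1) with hK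
  have hKc : K.card ≤ 2 * d * J := by
    calc K.card ≤ ((RS m n t).biUnion incE).card := Finset.card_le_card Finset.inter_subset_left
      _ ≤ (RS m n t).card * (2 * d) := Finset.card_biUnion_le_card_mul _ _ _ fun v _ => card_incE v
      _ ≤ J * (2 * d) := Nat.mul_le_mul_right _ hC.2.le
      _ = 2 * d * J := by ring
  calc (1 - p) ^ (2 * d * J) ≤ (1 - p) ^ K.card :=
        pow_le_pow_of_le_one (by linarith) (by linarith) hKc
    _ = Pr (fun _ => p) (s2 \ s1) (fun t' => ∀ i ∈ K, i ∉ t') := by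
        rw [Pr_none K Finset.inter_subset_right]; simp
    _ ≤ _ := by
        refine Ex_mono hW fun t' ht' => ind_mono fun h => ?_
        have hRS : RS m n (t ∪ t') = RS m n t := by
          rw [RS_local (T := s1) (Finset.Subset.refl _) (t ∪ t'),
            RS_local (T := s1) (Finset.Subset.refl _) t]
          congr 1
          ext x
          have := @ht' x
          simp at this ⊢
          tauto
        refine ⟨RS_nonempty.1 (hRS ▸ hC.1), fun hB => ?_⟩
        obtain ⟨c, hc, e, he, he', hce, hmem⟩ := arm_succ_arm hmn hB
        rw [hRS] at hc
        have hnot : s(c, e) ∉ s1 := fun h' => he (mem_Ed.1 h').2.1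
        have hin2 : s(c, e) ∈ s2 :=
          mem_Ed.2 ⟨Bx_mono (Nat.le_succ n) (mem_RS.1 hc).1.1, he', hce⟩
        have hinK : s(c, e) ∈ K := by
          rw [hK]
          simp only [Finset.mem_inter, Finset.mem_biUnion, Finset.mem_sdiff]
          exact ⟨⟨c, hc, mem_incE hce⟩, hin2, hnot⟩
        rcases hmem with hm | hm
        · exact hnot (by simpa using ht hm)
        · exact h _ hinK hm

/-- Facet quadrants. -/
noncomputable def Fq (n : ℕ) (a : Fin d) (σ : Fin d → ℤˣ) : Finset (V d) :=
  (Bx d n).filter (fun x => (σ a : ℤ) * x a = n ∧ ∀ l, 0 ≤ (σ l : ℤ) * x l)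

lemma exists_Fq {n : ℕ} {x : V d} (h : Bd n x) : ∃ a σ, x ∈ Fq n a σ := by
  obtain ⟨hx, k, hk⟩ := h
  refine ⟨k, fun l => if 0 ≤ x l then 1 else -1, ?_⟩
  simp only [Fq, Finset.mem_filter, hx, true_and]
  constructor
  · rcases hk with hk | hk
    · simp [hk]
    · by_cases h0 : 0 ≤ x k
      · simp only [h0, if_true]; simp; omega
      · simp only [h0, if_false]; simp; omega
  · intro l
    by_cases h0 : 0 ≤ x l
    · simp [h0]
    · simp [h0]; omega

open Classical in
/-- reached points in a facet quadrant -/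
noncomputable def RQ (m n : ℕ) (a : Fin d) (σ : Fin d → ℤˣ) (t : Set (Sym2 (V d))) :
    Finset (V d) := (Fq n a σ).filter (fun v => ∃ u ∈ Bx d m, Cn t (Bx d n) u v)

lemma mem_RQ {m n : ℕ} {a : Fin d} {σ : Fin d → ℤˣ} {t : Set (Sym2 (V d))} {v : V d} :
    v ∈ RQ m n a σ t ↔ v ∈ Fq n a σ ∧ ∃ u ∈ Bx d m, Cn t (Bx d n) u v := by
  simp [RQ]

lemma sp_mem_Bx (π : Equiv.Perm (Fin d)) (σ : Fin d → ℤˣ) {n : ℕ} {x : V d} :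
    (spIso π σ).e x ∈ Bx d n ↔ x ∈ Bx d n := by
  rw [mem_Bx, mem_Bx]
  have : ∀ l, (-(n : ℤ) ≤ (spIso π σ).e x l ∧ (spIso π σ).e x l ≤ n) ↔
      (-(n : ℤ) ≤ x (π l) ∧ x (π l) ≤ n) := by
    intro l
    change (-(n : ℤ) ≤ σ l * x (π l) ∧ σ l * x (π l) ≤ n) ↔ _
    rcases Int.units_eq_one_or (σ l) with h | h
    · simp [h]
    · simp only [h, Units.val_neg, Units.val_one]; omega
  simp_rw [this]
  constructor
  · intro h k
    simpa using h (π.symm k)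
  · intro h l
    exact h (π l)

lemma sp_image_Bx (π : Equiv.Perm (Fin d)) (σ : Fin d → ℤˣ) (n : ℕ) :
    (Bx d n).map (spIso π σ).e.toEmbedding = Bx d n := by
  ext x
  simp only [Finset.mem_map, Equiv.coe_toEmbedding]
  constructor
  · rintro ⟨y, hy, rfl⟩
    exact (sp_mem_Bx π σ).2 hy
  · intro hx
    refine ⟨(spIso π σ).e.symm x, ?_, by simp⟩
    rw [← sp_mem_Bx π σ]
    simpa using hx

lemma RQ_symm {p : ℝ} {m n J : ℕ} (a0 a : Fin d) (σ : Fin d → ℤˣ) :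
    PrE p (Bx d n) (fun t => (RQ m n a σ t).card < J) =
      PrE p (Bx d n) (fun t => (RQ m n a0 1 t).card < J) := by
  set φ := spIso (Equiv.swap a0 a) σ with hφ
  conv_lhs => rw [← sp_image_Bx (Equiv.swap a0 a) σ n, PrE_map]
  refine Pr_congr fun t _ => ?_
  suffices h : RQ m n a σ (Sym2.map φ.e '' t) = (RQ m n a0 1 t).map φ.e.toEmbedding by
    rw [h, Finset.card_map]
  have hB : φ.e '' (Bx d n : Set (V d)) = Bx d n := by
    have := congrArg (fun s : Finset (V d) => (s : Set (V d))) (sp_image_Bx (Equiv.swap a0 a) σ n)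
    simpa using this
  ext v
  obtain ⟨x, rfl⟩ := φ.e.surjective v
  have hmm : φ.e x ∈ (RQ m n a0 1 t).map φ.e.toEmbedding ↔ x ∈ RQ m n a0 1 t := by
    simp
  rw [hmm, mem_RQ, mem_RQ]
  refine and_congr ?_ ?_
  · simp only [Fq, Finset.mem_filter]
    refine and_congr (sp_mem_Bx _ _) ?_
    have hv : ∀ l, (σ l : ℤ) * φ.e x l = x (Equiv.swap a0 a l) := by
      intro l
      change (σ l : ℤ) * (σ l * x (Equiv.swap a0 a l)) = _
      rcases Int.units_eq_one_or (σ l) with h | h <;> simp [h]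
    simp only [hv, Equiv.swap_apply_right, Pi.one_apply, Units.val_one, one_mul]
    refine and_congr_right fun _ => ⟨fun h l => ?_, fun h l => h _⟩
    simpa using h (Equiv.swap a0 a l)
  · constructor
    · rintro ⟨u, hu, h⟩
      obtain ⟨y, rfl⟩ := φ.e.surjective u
      refine ⟨y, (sp_mem_Bx _ _).1 hu, ?_⟩
      rw [← hB, Cn_map] at h
      exact h
    · rintro ⟨y, hy, h⟩
      refine ⟨φ.e y, (sp_mem_Bx _ _).2 hy, ?_⟩
      rw [← hB, Cn_map]
      exact h

lemma Pr_fkg_dec {ι : Type*} {p : ι → ℝ} {s : Finset ι} {A B : Set ι → Prop} (hp : IsW p)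
    (hA : Inc (fun t => ¬ A t)) (hB : Inc (fun t => ¬ B t)) :
    Pr p s A * Pr p s B ≤ Pr p s (fun t => A t ∧ B t) := by
  have key : ∀ C : Set ι → Prop, Inc (fun t => ¬ C t) → Monotone (fun t => -1 * ind (C t)) := by
    intro C hC t t' h
    have := ind_mono (A := C t') (B := C t) (fun h' => by
      by_contra hc
      exact hC t t' h hc h')
    simp only
    linarith
  have := Ex_fkg (s := s) hp (key A hA) (key B hB)
  rw [Ex_mul_left, Ex_mul_left] at this
  unfold Pr
  simp_rw [ind_and]
  calc _ = -1 * Ex p s (fun t => ind (A t)) * (-1 * Ex p s fun t => ind (B t)) := by ring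
    _ ≤ _ := this
    _ = _ := Ex_congr fun t _ => by ring

lemma Pr_fkg_dec_finset {ι κ : Type*} {p : ι → ℝ} {s : Finset ι} (K : Finset κ)
    {A : κ → Set ι → Prop} (hp : IsW p) (hA : ∀ k, Inc (fun t => ¬ A k t)) :
    ∏ k ∈ K, Pr p s (A k) ≤ Pr p s (fun t => ∀ k ∈ K, A k t) := by
  classical
  induction K using Finset.induction_on with
  | empty => simp [Pr_true]
  | insert a K ha ih =>
    rw [Finset.prod_insert ha]
    refine (mul_le_mul_of_nonneg_left ih (Pr_nonneg hp)).trans ?_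
    refine (Pr_fkg_dec hp (hA a) ?_).trans (Pr_mono hp fun t _ h => by simpa using h)
    intro t t' h h1 h2
    exact h1 fun k hk => by
      by_contra hc
      exact hA k t t' h hc (h2 k hk)

/-- The base seed estimate. -/
lemma seed_base (hd : 0 < d) {p : ℝ} (h0 : 0 ≤ p) (h1 : p < 1) {θ : ℝ} (hθ : 0 < θ)
    (hth : ∀ n, θ ≤ th d p n) {η : ℝ} (hη : 0 < η) :
    ∃ m, ∀ J : ℕ, ∃ n, m < n ∧ ∀ a σ,
      PrE p (Bx d n) (fun t => (RQ m n a σ t).card < J) ≤ η := by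
  classical
  have hW : IsW (fun _ : Sym2 (V d) => p) := isW_const h0 h1.le
  set κ : Finset (Fin d × (Fin d → ℤˣ)) := Finset.univ with hκ
  set c := κ.card with hc
  obtain ⟨m, hm⟩ := fr_large (d := d) h0 h1.le hθ hth (η := η ^ c / 2) (by positivity)
  refine ⟨m, fun J => ?_⟩
  set ρ := (1 - p) ^ (2 * d * (c * J + 1)) with hρ
  have hρ0 : 0 < ρ := by
    rw [hρ]
    have : 0 < 1 - p := by linarith
    positivity
  -- a scale with small decrement
  obtain ⟨n, hmn, hn⟩ : ∃ n, m < n ∧ fr d p m n - fr d p m (n + 1) ≤ η ^ c / 2 * ρ := by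
    by_contra hcon
    push Not at hcon
    set ε := η ^ c / 2 * ρ with hε
    have hε0 : 0 < ε := by positivity
    have hdec : ∀ k : ℕ, fr d p m (m + 1 + k) ≤ 1 - k * ε := by
      intro k
      induction k with
      | zero =>
        simp only [Nat.cast_zero, zero_mul, sub_zero]
        exact Pr_le_one hW
      | succ k ih =>
        have := hcon (m + 1 + k) (by omega)
        push_cast
        rw [← add_assoc]
        linarith
    obtain ⟨k, hk⟩ := exists_nat_gt (1 / ε)
    have h2 := hdec k
    have h3 : 0 ≤ fr d p m (m + 1 + k) := Pr_nonneg hW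
    rw [div_lt_iff₀ hε0] at hk
    linarith
  refine ⟨n, hmn, fun a σ => ?_⟩
  set x := PrE p (Bx d n) (fun t => (RQ m n a σ t).card < J) with hx
  have hx0 : 0 ≤ x := Pr_nonneg hW
  have hsame : ∀ k ∈ κ, PrE p (Bx d n) (fun t => (RQ m n k.1 k.2 t).card < J) = x := by
    intro k _
    rw [hx, RQ_symm a k.1 k.2, RQ_symm a a σ]
  have hpow : x ^ c ≤ PrE p (Bx d n) (fun t => ∀ k ∈ κ, (RQ m n k.1 k.2 t).card < J) := by
    rw [hc, ← Finset.prod_const, ← Finset.prod_congr rfl hsame]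
    refine Pr_fkg_dec_finset (A := fun k t => (RQ m n k.1 k.2 t).card < J) κ hW ?_
    intro k t t' htt h h'
    apply h
    refine lt_of_le_of_lt (Finset.card_le_card ?_) h'
    intro v hv
    rw [mem_RQ] at *
    obtain ⟨h1, u, hu, h2⟩ := hv
    exact ⟨h1, u, hu, h2.mono htt (le_refl _)⟩
  have hle : x ^ c ≤ η ^ c := by
    refine hpow.trans ?_
    have step : PrE p (Bx d n) (fun t => ∀ k ∈ κ, (RQ m n k.1 k.2 t).card < J) ≤
        PrE p (Bx d n) (fun t => ¬ Arm m n t ∨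
          ((RS m n t).Nonempty ∧ (RS m n t).card < c * J + 1)) := by
      refine Pr_mono hW fun t _ h => ?_
      by_cases hA : Arm m n t
      · right
        refine ⟨RS_nonempty.2 hA, Nat.lt_succ_of_le ?_⟩
        calc (RS m n t).card ≤ (κ.biUnion (fun k => RQ m n k.1 k.2 t)).card := by
              refine Finset.card_le_card fun v hv => ?_
              rw [mem_RS] at hv
              obtain ⟨a', σ', h'⟩ := exists_Fq hv.1
              rw [Finset.mem_biUnion]
              exact ⟨(a', σ'), Finset.mem_univ _, mem_RQ.2 ⟨h', hv.2⟩⟩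
          _ ≤ c * J := Finset.card_biUnion_le_card_mul _ _ _ fun k hk => (h k hk).le
      · exact Or.inl hA
    refine step.trans ((Pr_or_le hW).trans ?_)
    have b1 : Pr (fun _ => p) (Ed (Bx d n)) (fun t => ¬ Arm m n t) ≤ η ^ c / 2 := by
      rw [Pr_not]
      have := hm n hmn
      unfold fr PrE at this
      linarith
    have b2 := close_exits (d := d) h0 h1.le hmn.le (c * J + 1)
    rw [← hρ] at b2
    have b3 : Pr (fun _ => p) (Ed (Bx d n))
        (fun t => (RS m n t).Nonempty ∧ (RS m n t).card < c * J + 1) ≤ η ^ c / 2 := by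
      have := b2.trans hn
      exact le_of_mul_le_mul_right this hρ0
    linarith
  have hc0 : c ≠ 0 := by
    rw [hc]
    have : (a, σ) ∈ κ := Finset.mem_univ _
    exact Finset.card_ne_zero_of_mem this
  exact le_of_pow_le_pow_left₀ hc0 hη.le hle

end SeedBase

section Attempt
variable {d : ℕ}
open Relation

/-- Layered edges. -/
inductive Lay (d : ℕ) where
  | base (e : Sym2 (V d)) : Lay d
  | lay (y : ℤ × ℤ) (e : Sym2 (V d)) : Lay d
  | seed (y : ℤ × ℤ) (q : V d) (e : Sym2 (V d)) : Lay d

/-- underlying edge -/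
def pe : Lay d → Sym2 (V d)
  | Lay.base e => e
  | Lay.lay _ e => e
  | Lay.seed _ _ e => e

/-- layer weights -/
def lw (p1 α β : ℝ) : Lay d → ℝ
  | Lay.base _ => p1
  | Lay.lay _ _ => α
  | Lay.seed _ _ _ => β

lemma lw_isW {p1 α β : ℝ} (h1 : 0 ≤ p1 ∧ p1 ≤ 1) (h2 : 0 ≤ α ∧ α ≤ 1) (h3 : 0 ≤ β ∧ β ≤ 1) :
    IsW (lw p1 α β : Lay d → ℝ) := by
  intro i
  cases i <;> simpa [lw]

def bE : Sym2 (V d) ↪ Lay d := ⟨Lay.base, fun _ _ h => by injection h⟩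
def lE (y : ℤ × ℤ) : Sym2 (V d) ↪ Lay d := ⟨Lay.lay y, fun _ _ h => by injection h⟩
def sE (y : ℤ × ℤ) (q : V d) : Sym2 (V d) ↪ Lay d := ⟨Lay.seed y q, fun _ _ h => by injection h⟩

/-- ball -/
noncomputable def Bl (b : V d) (n : ℕ) : Finset (V d) := (Bx d n).map (trIso b).e.toEmbedding

lemma mem_Bl {b v : V d} {n : ℕ} : v ∈ Bl b n ↔ ∀ k, b k - n ≤ v k ∧ v k ≤ b k + n := by
  simp only [Bl, Finset.mem_map, mem_Bx]
  constructor
  · rintro ⟨x, hx, rfl⟩ k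
    have := hx k
    simp [trIso]
    constructor <;> linarith
  · intro h
    refine ⟨v - b, fun k => ?_, by simp [trIso]⟩
    have := h k
    simp only [Pi.sub_apply]
    constructor <;> linarith

/-- translated facet quadrants -/
noncomputable def Qf (b : V d) (n : ℕ) (a : Fin d) (σ : Fin d → ℤˣ) : Finset (V d) :=
  (Fq n a σ).map (trIso b).e.toEmbedding

lemma mem_Qf {b v : V d} {n : ℕ} {a : Fin d} {σ : Fin d → ℤˣ} : v ∈ Qf b n a σ ↔
    v ∈ Bl b n ∧ (σ a : ℤ) * (v a - b a) = n ∧ ∀ l, 0 ≤ (σ l : ℤ) * (v l - b l) := by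
  simp only [Qf, Finset.mem_map, Fq, Finset.mem_filter, Bl]
  constructor
  · rintro ⟨x, ⟨hx, h1, h2⟩, rfl⟩
    exact ⟨⟨x, hx, rfl⟩, by simpa [trIso] using h1, by simpa [trIso] using h2⟩
  · rintro ⟨⟨x, hx, rfl⟩, h1, h2⟩
    exact ⟨x, ⟨hx, by simpa [trIso] using h1, by simpa [trIso] using h2⟩, rfl⟩

open Classical in
/-- reached points of a set -/
noncomputable def RP (Λ A Q : Finset (V d)) (t : Set (Sym2 (V d))) : Finset (V d) :=
  Q.filter (fun q => ∃ u ∈ A, Cn t Λ u q)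

lemma mem_RP {Λ A Q : Finset (V d)} {t : Set (Sym2 (V d))} {q : V d} :
    q ∈ RP Λ A Q t ↔ q ∈ Q ∧ ∃ u ∈ A, Cn t Λ u q := by simp [RP]

lemma RP_shift (b : V d) (m n : ℕ) (a : Fin d) (σ : Fin d → ℤˣ) (p : ℝ) (J : ℕ) :
    PrE p (Bl b n) (fun t => (RP (Bl b n) (Bl b m) (Qf b n a σ) t).card < J) =
    PrE p (Bx d n) (fun t => (RQ m n a σ t).card < J) := by
  unfold Bl
  rw [PrE_map]
  unfold PrE
  refine Pr_congr fun t _ => ?_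
  have : RP ((Bx d n).map (trIso b).e.toEmbedding) ((Bx d m).map (trIso b).e.toEmbedding)
      (Qf b n a σ) (Sym2.map (trIso b).e '' t) = (RQ m n a σ t).map (trIso b).e.toEmbedding := by
    ext v
    simp only [mem_RP, Finset.mem_map, mem_RQ, Qf]
    constructor
    · rintro ⟨⟨x, hx, rfl⟩, _, ⟨u, hu, rfl⟩, h⟩
      refine ⟨x, ⟨hx, u, hu, ?_⟩, rfl⟩
      rw [← Cn_map (trIso b)]
      simpa using h
    · rintro ⟨x, ⟨hx, u, hu, h⟩, rfl⟩
      refine ⟨⟨x, hx, rfl⟩, _, ⟨u, hu, rfl⟩, ?_⟩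
      rw [← Cn_map (trIso b)] at h
      simpa using h
  rw [this, Finset.card_map]

/-- base configuration -/
def bt (t : Set (Lay d)) : Set (Sym2 (V d)) := {e | Lay.base e ∈ t}

/-- seed edges -/
noncomputable def sds (y : ℤ × ℤ) (m : ℕ) (q : V d) : Finset (Lay d) := (Ed (Bl q m)).map (sE y q)

lemma sds_card (y : ℤ × ℤ) (m : ℕ) (q : V d) : (sds y m q).card = (Ed (Bx d m)).card := by
  rw [sds, Finset.card_map, Bl, Ed_map, Finset.card_map]

lemma prod_sds (p1 α β : ℝ) (y : ℤ × ℤ) (m : ℕ) (q : V d) :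
    ∏ i ∈ sds y m q, lw p1 α β i = β ^ (Ed (Bx d m)).card := by
  rw [← sds_card y m q]
  apply Finset.prod_eq_pow_card
  intro i hi
  simp only [sds, Finset.mem_map] at hi
  obtain ⟨e, _, rfl⟩ := hi
  rfl

lemma sds_disj (y : ℤ × ℤ) (m : ℕ) {q q' : V d} (h : q ≠ q') : Disjoint (sds y m q) (sds y m q') := by
  rw [Finset.disjoint_left]
  intro i hi hi'
  simp only [sds, Finset.mem_map] at hi hi'
  obtain ⟨e, _, rfl⟩ := hi
  obtain ⟨e', _, he⟩ := hi'
  apply h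
  have : Lay.seed y q' e' = Lay.seed y q e := he
  injection this with _ h2 _
  exact h2.symm

/-- points reached from `R` -/
def Rch (Λ R : Finset (V d)) (y : ℤ × ℤ) (t : Set (Lay d)) (v : V d) : Prop :=
  ∃ u w, u ∈ Λ ∧ u ∈ R ∧ w ∈ Λ ∧ w ∉ R ∧ dist1 u w = 1 ∧ Lay.lay y s(u, w) ∈ t ∧
    Cn (bt t) ((Λ : Set (V d)) \ R) w v

/-- attempt success -/
def Hit (Λ R Q : Finset (V d)) (m : ℕ) (y : ℤ × ℤ) (t : Set (Lay d)) (q : V d) : Prop :=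
  q ∈ Q ∧ ↑(sds y m q) ⊆ t ∧ (q ∈ R ∨ Rch Λ R y t q)

lemma bt_mono {t t' : Set (Lay d)} (h : t ⊆ t') : bt t ⊆ bt t' := fun _ he => h he

lemma Rch_mono {Λ R : Finset (V d)} {y : ℤ × ℤ} {t t' : Set (Lay d)} (h : t ⊆ t') {v : V d}
    (hv : Rch Λ R y t v) : Rch Λ R y t' v := by
  obtain ⟨u, w, h1, h2, h3, h4, h5, h6, h7⟩ := hv
  exact ⟨u, w, h1, h2, h3, h4, h5, h h6, h7.mono (bt_mono h) le_rfl⟩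

lemma Hit_mono {Λ R Q : Finset (V d)} {m : ℕ} {y : ℤ × ℤ} {t t' : Set (Lay d)} (h : t ⊆ t') {q : V d}
    (hq : Hit Λ R Q m y t q) : Hit Λ R Q m y t' q :=
  ⟨hq.1, hq.2.1.trans h, hq.2.2.imp id (Rch_mono h)⟩

/-- crossing edges -/
def crs (R : Finset (V d)) (e : Sym2 (V d)) : Prop := ∃ u w, e = s(u, w) ∧ u ∈ R ∧ w ∉ R

open Classical in
/-- index sets of an attempt -/
noncomputable def sExt (Λ R Q : Finset (V d)) (m : ℕ) (y : ℤ × ℤ) : Finset (Lay d) :=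
  (Ed (Λ \ R)).map bE ∪ Q.biUnion (sds y m)

open Classical in
noncomputable def sLay (Λ R : Finset (V d)) (y : ℤ × ℤ) : Finset (Lay d) :=
  ((Ed Λ).filter (crs R)).map (lE y)

open Classical in
noncomputable def sAtt (Λ R Q : Finset (V d)) (m : ℕ) (y : ℤ × ℤ) : Finset (Lay d) :=
  sExt Λ R Q m y ∪ sLay Λ R y

lemma mem_sExt {Λ R Q : Finset (V d)} {m : ℕ} {y : ℤ × ℤ} {i : Lay d} : i ∈ sExt Λ R Q m y ↔
    (∃ e ∈ Ed (Λ \ R), i = Lay.base e) ∨ ∃ q ∈ Q, i ∈ sds y m q := by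
  classical
  simp only [sExt, Finset.mem_union, Finset.mem_map, Finset.mem_biUnion]
  refine or_congr ⟨?_, ?_⟩ Iff.rfl
  · rintro ⟨e, he, rfl⟩; exact ⟨e, he, rfl⟩
  · rintro ⟨e, he, rfl⟩; exact ⟨e, he, rfl⟩

lemma mem_sLay {Λ R : Finset (V d)} {y : ℤ × ℤ} {i : Lay d} : i ∈ sLay Λ R y ↔
    ∃ e ∈ Ed Λ, crs R e ∧ i = Lay.lay y e := by
  classical
  simp only [sLay, Finset.mem_map, Finset.mem_filter]
  constructor
  · rintro ⟨e, he, rfl⟩; exact ⟨e, he.1, he.2, rfl⟩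
  · rintro ⟨e, he, he', rfl⟩; exact ⟨e, ⟨he, he'⟩, rfl⟩

lemma mem_sds {y : ℤ × ℤ} {m : ℕ} {q : V d} {i : Lay d} : i ∈ sds y m q ↔
    ∃ e ∈ Ed (Bl q m), i = Lay.seed y q e := by
  simp only [sds, Finset.mem_map]
  constructor
  · rintro ⟨e, he, rfl⟩; exact ⟨e, he, rfl⟩
  · rintro ⟨e, he, rfl⟩; exact ⟨e, he, rfl⟩

lemma sExt_sLay_disj {Λ R Q : Finset (V d)} {m : ℕ} {y : ℤ × ℤ} :
    Disjoint (sExt Λ R Q m y) (sLay Λ R y) := by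
  rw [Finset.disjoint_left]
  intro i hi hi'
  rw [mem_sExt] at hi
  obtain ⟨e, _, _, rfl⟩ := mem_sLay.1 hi'
  rcases hi with ⟨e', _, h⟩ | ⟨q, _, h⟩
  · cases h
  · obtain ⟨e', _, h⟩ := mem_sds.1 h
    cases h

/-- base version of attempt with seeds, all lay edges having weight `p1` -/
lemma attempt_base {p1 β : ℝ} (h0 : 0 ≤ p1) (h1 : p1 ≤ 1) (hb0 : 0 ≤ β) (hb1 : β ≤ 1)
    (Λ R Q A : Finset (V d)) (m : ℕ) (y : ℤ × ℤ) (J : ℕ) (η1 : ℝ) (hAR : A ⊆ R)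
    (hb : PrE p1 Λ (fun t => (RP Λ A Q t).card < J) ≤ η1) :
    Pr (lw p1 p1 β) (sAtt Λ R Q m y) (fun t => ¬ ∃ q, Hit Λ R Q m y t q) ≤
      η1 + (1 - β ^ (Ed (Bx d m)).card) ^ J := by
  classical
  set γ := β ^ (Ed (Bx d m)).card with hγ
  have hγ0 : 0 ≤ γ := pow_nonneg hb0 _
  have hγ1 : γ ≤ 1 := pow_le_one₀ hb0 hb1
  have hW : IsW (lw p1 p1 β : Lay d → ℝ) := lw_isW ⟨h0, h1⟩ ⟨h0, h1⟩ ⟨hb0, hb1⟩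
  let φf : Sym2 (V d) → Lay d := fun e => if crs R e then Lay.lay y e else Lay.base e
  have hφ : Function.Injective φf := by
    intro e e' h
    simp only [φf] at h
    split_ifs at h <;> injection h
  let φ : Sym2 (V d) ↪ Lay d := ⟨φf, hφ⟩
  have hφb : ∀ e, ¬ crs R e → φ e = Lay.base e := fun e he => by
    show φf e = _; simp [φf, he]
  have hφl : ∀ e, crs R e → φ e = Lay.lay y e := fun e he => by
    show φf e = _; simp [φf, he]
  set sS := Q.biUnion (sds y m) with hsS
  set s1 := (Ed Λ).map φ ∪ sS with hs1
  have hsub : sAtt Λ R Q m y ⊆ s1 := by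
    intro i hi
    rw [sAtt, Finset.mem_union, mem_sExt, mem_sLay] at hi
    rw [hs1, Finset.mem_union]
    rcases hi with (⟨e, he, rfl⟩ | ⟨q, hq, hi⟩) | ⟨e, he, hc, rfl⟩
    · left
      refine Finset.mem_map.2 ⟨e, Ed_mono Finset.sdiff_subset he, hφb e ?_⟩
      rintro ⟨u, w, rfl, hu, hw⟩
      rw [mem_Ed] at he
      exact (Finset.mem_sdiff.1 he.1).2 hu
    · right; exact Finset.mem_biUnion.2 ⟨q, hq, hi⟩
    · left; exact Finset.mem_map.2 ⟨e, he, hφl e hc⟩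
  have hdisj : Disjoint ((Ed Λ).map φ) sS := by
    rw [Finset.disjoint_left]
    intro i hi hi'
    obtain ⟨e, he, rfl⟩ := Finset.mem_map.1 hi
    obtain ⟨q, _, hq⟩ := Finset.mem_biUnion.1 hi'
    obtain ⟨e', _, h⟩ := mem_sds.1 hq
    by_cases hc : crs R e
    · rw [hφl e hc] at h; cases h
    · rw [hφb e hc] at h; cases h
  let Fl : Set (Lay d) → Prop := fun t => ∀ q ∈ RP Λ A Q {e | φ e ∈ t}, ¬ (sds y m q : Set (Lay d)) ⊆ t
  have step1 : Pr (lw p1 p1 β) (sAtt Λ R Q m y) (fun t => ¬ ∃ q, Hit Λ R Q m y t q) ≤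
      Pr (lw p1 p1 β) s1 Fl := by
    have e1 : Pr (lw p1 p1 β) (sAtt Λ R Q m y) (fun t => ¬ ∃ q, Hit Λ R Q m y t q) =
        Pr (lw p1 p1 β) s1 (fun t => ¬ ∃ q, Hit Λ R Q m y (t ∩ sAtt Λ R Q m y) q) := by
      rw [Pr_local hsub]
      · refine Pr_congr fun t ht => ?_
        rw [Set.inter_eq_left.2 ht]
      · intro t _
        rw [Set.inter_assoc, Set.inter_self]
    rw [e1]
    refine Pr_mono hW fun t ht hno q hq hsd => hno ⟨q, ?_⟩
    obtain ⟨hqQ, a, ha, hc⟩ := mem_RP.1 hq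
    refine ⟨hqQ, fun i hi => ⟨hsd hi, ?_⟩, ?_⟩
    · simp only [sAtt, Finset.coe_union]
      left
      exact mem_sExt.2 (Or.inr ⟨q, hqQ, hi⟩)
    by_cases hqR : q ∈ R
    · exact Or.inl hqR
    right
    obtain ⟨u, w, h1, h2, h3, h4, h5⟩ := last_exit (P := fun v => v ∈ R) hc (hAR ha) hqR
    refine ⟨u, w, h3.1, h2, h3.2.1, h4, h3.2.2.1, ⟨?_, ?_⟩, ?_⟩
    · have := h3.2.2.2
      simp only [Set.mem_ofPred_eq] at this
      rwa [hφl _ ⟨u, w, rfl, h2, h4⟩] at this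
    · simp only [sAtt, Finset.coe_union]
      right
      exact mem_sLay.2 ⟨_, mem_Ed.2 ⟨h3.1, h3.2.1, h3.2.2.1⟩, ⟨u, w, rfl, h2, h4⟩, rfl⟩
    · refine rtg_mono (fun x x' hx => ?_) h5
      obtain ⟨hx1, hx2, hx3⟩ := hx
      refine ⟨⟨hx3.1, hx1⟩, ⟨hx3.2.1, hx2⟩, hx3.2.2.1, ?_, ?_⟩
      · have := hx3.2.2.2
        simp only [Set.mem_ofPred_eq] at this
        rwa [hφb] at this
        rintro ⟨u', w', he, hu, hw⟩
        rw [Sym2.eq_iff] at he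
        rcases he with ⟨rfl, rfl⟩ | ⟨rfl, rfl⟩
        · exact hx1 hu
        · exact hx2 hu
      · simp only [sAtt, Finset.coe_union]
        left
        refine mem_sExt.2 (Or.inl ⟨_, mem_Ed.2 ⟨?_, ?_, hx3.2.2.1⟩, rfl⟩)
        · exact Finset.mem_sdiff.2 ⟨hx3.1, hx1⟩
        · exact Finset.mem_sdiff.2 ⟨hx3.2.1, hx2⟩
  refine step1.trans ?_
  unfold Pr
  rw [hs1, Ex_union hdisj, Ex_map]
  have inner : ∀ t : Set (Sym2 (V d)), t ⊆ (Ed Λ : Set (Sym2 (V d))) →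
      Ex (lw p1 p1 β) sS (fun t' => ind (Fl (φ '' t ∪ t'))) ≤
        ind ((RP Λ A Q t).card < J) + (1 - γ) ^ J := by
    intro t ht
    have e0 : Ex (lw p1 p1 β) sS (fun t' => ind (Fl (φ '' t ∪ t'))) =
        Pr (lw p1 p1 β) sS (fun t' => ∀ q ∈ RP Λ A Q t, ¬ (sds y m q : Set (Lay d)) ⊆ t') := by
      refine Pr_congr fun t' ht' => ?_
      have e2 : {e | φ e ∈ φ '' t ∪ t'} ∩ (Ed Λ : Set (Sym2 (V d))) = t ∩ (Ed Λ : Set (Sym2 (V d))) := by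
        ext e
        simp only [Set.mem_inter_iff, Set.mem_ofPred_eq, Set.mem_union,
          Finset.mem_coe]
        constructor
        · rintro ⟨⟨e', h1, h2⟩ | h, h'⟩
          · exact ⟨(φ.injective h2) ▸ h1, h'⟩
          · exact absurd (ht' h) (Finset.disjoint_left.1 hdisj (Finset.mem_map.2 ⟨e, h', rfl⟩))
        · rintro ⟨h, h'⟩
          exact ⟨Or.inl ⟨e, h, rfl⟩, h'⟩
      have e3 : RP Λ A Q {e | φ e ∈ φ '' t ∪ t'} = RP Λ A Q t := by
        ext q
        simp only [mem_RP]
        refine and_congr_right fun _ => exists_congr fun u => and_congr_right fun _ => ?_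
        rw [Cn_local, e2, ← Cn_local]
      show (∀ q ∈ RP Λ A Q {e | φ e ∈ φ '' t ∪ t'}, ¬ (sds y m q : Set (Lay d)) ⊆ φ '' t ∪ t') ↔ _
      rw [e3]
      refine forall_congr' fun q => forall_congr' fun hq => not_congr ⟨fun h i hi => ?_, fun h => h.trans Set.subset_union_right⟩
      rcases h hi with h | h
      · obtain ⟨e, he, rfl⟩ := h
        refine absurd ?_ (Finset.disjoint_left.1 hdisj (Finset.mem_map.2 ⟨e, ht he, rfl⟩))
        exact Finset.mem_biUnion.2 ⟨q, (mem_RP.1 hq).1, hi⟩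
      · exact h
    rw [e0, Pr_none_family]
    · have : ∏ q ∈ RP Λ A Q t, (1 - ∏ i ∈ sds y m q, lw p1 p1 β i) = (1 - γ) ^ (RP Λ A Q t).card := by
        apply Finset.prod_eq_pow_card
        intro q _
        rw [prod_sds]
      rw [this]
      by_cases hJ : (RP Λ A Q t).card < J
      · rw [ind_pos hJ]
        have a1 : (1 - γ) ^ (RP Λ A Q t).card ≤ 1 := pow_le_one₀ (by linarith) (by linarith)
        have a2 : 0 ≤ (1 - γ) ^ J := pow_nonneg (by linarith) _
        linarith
      · rw [ind_neg hJ, zero_add]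
        exact pow_le_pow_of_le_one (by linarith) (by linarith) (by omega)
    · intro q hq
      exact Finset.subset_biUnion_of_mem _ (mem_RP.1 hq).1
    · intro q _ q' _ h
      exact sds_disj y m h
  have hw : ∀ e ∈ Ed Λ, lw p1 p1 β (φ e) = p1 := by
    intro e _
    by_cases hc : crs R e
    · rw [hφl e hc]; rfl
    · rw [hφb e hc]; rfl
  rw [Ex_congr_p hw]
  refine (Ex_mono (isW_const h0 h1) inner).trans ?_
  rw [Ex_add, Ex_const]
  have : Ex (fun _ => p1) (Ed Λ) (fun t => ind ((RP Λ A Q t).card < J)) ≤ η1 := hb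
  linarith

lemma attempt {p1 α β : ℝ} (h0 : 0 ≤ p1) (h1 : p1 < 1) (ha0 : 0 ≤ α) (ha1 : α ≤ 1)
    (hb0 : 0 ≤ β) (hb1 : β ≤ 1)
    (Λ R Q A : Finset (V d)) (m : ℕ) (y : ℤ × ℤ) (J K : ℕ) (η1 η2 : ℝ) (hAR : A ⊆ R)
    (hb : PrE p1 Λ (fun t => (RP Λ A Q t).card < J) ≤ η1)
    (hη : (1 - α) ^ K + (η1 + (1 - β ^ (Ed (Bx d m)).card) ^ J) / (1 - p1) ^ K ≤ η2)
    (s : Finset (Lay d)) (hs : sAtt Λ R Q m y ⊆ s) :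
    1 - η2 ≤ Pr (lw p1 α β) s (fun t => ∃ q, Hit Λ R Q m y t q) := by
  classical
  have hW : ∀ x, 0 ≤ x → x ≤ 1 → IsW (lw p1 x β : Lay d → ℝ) :=
    fun x hx hx' => lw_isW ⟨h0, h1.le⟩ ⟨hx, hx'⟩ ⟨hb0, hb1⟩
  refine le_trans ?_ (Pr_mono_s (hW α ha0 ha1) hs (A := fun t => ∃ q, Hit Λ R Q m y t q)
    (fun t t' h ⟨q, hq⟩ => ⟨q, Hit_mono h hq⟩))
  have hnot := Pr_not (p := lw p1 α β) (s := sAtt Λ R Q m y) (A := fun t => ∃ q, Hit Λ R Q m y t q)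
  suffices hsuff : Pr (lw p1 α β) (sAtt Λ R Q m y) (fun t => ¬ ∃ q, Hit Λ R Q m y t q) ≤ η2 by linarith
  let H : Set (Lay d) → Prop := fun t => ∃ q ∈ Q, q ∈ R ∧ (sds y m q : Set (Lay d)) ⊆ t
  let Ue : Set (Lay d) → Finset (Lay d) := fun t => (sLay Λ R y).filter (fun i =>
    ∃ (u w q : V d), i = Lay.lay y s(u, w) ∧ u ∈ Λ ∧ u ∈ R ∧ w ∈ Λ ∧ w ∉ R ∧ dist1 u w = 1 ∧
      Cn (bt t) ((Λ : Set (V d)) \ R) w q ∧ q ∈ Q ∧ (sds y m q : Set (Lay d)) ⊆ t)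
  have formula : ∀ x, 0 ≤ x → x ≤ 1 →
      Pr (lw p1 x β) (sAtt Λ R Q m y) (fun t => ¬ ∃ q, Hit Λ R Q m y t q) =
      Ex (lw p1 α β) (sExt Λ R Q m y) (fun t => ind (¬ H t) * (1 - x) ^ (Ue t).card) := by
    intro x hx hx'
    unfold Pr sAtt
    rw [Ex_union sExt_sLay_disj]
    have hcp : ∀ i ∈ sExt Λ R Q m y, lw p1 x β i = lw p1 α β i := by
      intro i hi
      rcases mem_sExt.1 hi with ⟨e, _, rfl⟩ | ⟨q, _, hq⟩
      · rfl
      · obtain ⟨e, _, rfl⟩ := mem_sds.1 hq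
        rfl
    rw [Ex_congr_p hcp]
    refine Ex_congr fun t ht => ?_
    have e1 : ∀ t' : Set (Lay d), t' ⊆ (sLay Λ R y : Set (Lay d)) →
        ind (¬ ∃ q, Hit Λ R Q m y (t ∪ t') q) = ind (¬ H t) * ind (∀ i ∈ Ue t, i ∉ t') := by
      intro t' ht'
      rw [← ind_and]
      have hbt : bt (t ∪ t') = bt t := by
        ext e
        constructor
        · rintro (h | h)
          · exact h
          · obtain ⟨_, _, _, h⟩ := mem_sLay.1 (ht' h); cases h
        · exact fun h => Or.inl h
      have hsd : ∀ q : V d, (sds y m q : Set (Lay d)) ⊆ t ∪ t' → (sds y m q : Set (Lay d)) ⊆ t := by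
        intro q h i hi
        rcases h hi with h | h
        · exact h
        · obtain ⟨_, _, rfl⟩ := mem_sds.1 hi
          obtain ⟨_, _, _, h⟩ := mem_sLay.1 (ht' h); cases h
      have hlt : ∀ e, Lay.lay y e ∈ t → False := by
        intro e he
        rcases mem_sExt.1 (ht he) with ⟨_, _, h⟩ | ⟨q, _, hq⟩
        · cases h
        · obtain ⟨_, _, h⟩ := mem_sds.1 hq; cases h
      apply ind_congr
      rw [not_exists]
      constructor
      · intro h
        constructor
        · rintro ⟨q, hq, hqR, hs⟩
          exact h q ⟨hq, hs.trans Set.subset_union_left, Or.inl hqR⟩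
        · intro i hi hit
          obtain ⟨_, u, w, q, rfl, a1, a2, a3, a4, a5, a6, a7, a8⟩ := Finset.mem_filter.1 hi
          refine h q ⟨a7, a8.trans Set.subset_union_left, Or.inr ⟨u, w, a1, a2, a3, a4, a5, Or.inr hit, ?_⟩⟩
          rw [hbt]; exact a6
      · rintro ⟨h1, h2⟩ q ⟨hq, hs, hqR | ⟨u, w, a1, a2, a3, a4, a5, a6, a7⟩⟩
        · exact h1 ⟨q, hq, hqR, hsd q hs⟩
        · rcases a6 with a6 | a6
          · exact hlt _ a6
          · refine h2 _ (Finset.mem_filter.2 ⟨ht' a6, u, w, q, rfl, a1, a2, a3, a4, a5, ?_, hq, hsd q hs⟩) a6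
            rw [← hbt]; exact a7
    rw [Ex_congr e1, Ex_mul_left]
    congr 1
    have := Pr_none (p := lw p1 x β) (s := sLay Λ R y) (Ue t) (Finset.filter_subset _ _)
    unfold Pr at this
    rw [this]
    apply Finset.prod_eq_pow_card
    intro i hi
    obtain ⟨_, _, _, rfl⟩ := mem_sLay.1 (Finset.mem_filter.1 hi).1
    rfl
  have hbase := attempt_base h0 h1.le hb0 hb1 Λ R Q A m y J η1 hAR hb
  rw [formula p1 h0 h1.le] at hbase
  rw [formula α ha0 ha1]
  refine le_trans ?_ hη
  have hpK : 0 < (1 - p1) ^ K := pow_pos (by linarith) _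
  have hpt : ∀ t : Set (Lay d), t ⊆ sExt Λ R Q m y → ind (¬ H t) * (1 - α) ^ (Ue t).card ≤
      (1 - α) ^ K + ((1 - p1) ^ K)⁻¹ * (ind (¬ H t) * (1 - p1) ^ (Ue t).card) := by
    intro t _
    have i0 := ind_nonneg (¬ H t)
    have i1 := ind_le_one (¬ H t)
    have aK : 0 ≤ (1 - α) ^ K := pow_nonneg (by linarith) _
    have ak : 0 ≤ (1 - α) ^ (Ue t).card := pow_nonneg (by linarith) _
    have pk : 0 < (1 - p1) ^ (Ue t).card := pow_pos (by linarith) _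
    rcases le_or_gt K (Ue t).card with h | h
    · have : (1 - α) ^ (Ue t).card ≤ (1 - α) ^ K := pow_le_pow_of_le_one (by linarith) (by linarith) h
      have h3 : 0 ≤ ((1 - p1) ^ K)⁻¹ * (ind (¬ H t) * (1 - p1) ^ (Ue t).card) := by positivity
      nlinarith
    · have h3 : (1 - p1) ^ K ≤ (1 - p1) ^ (Ue t).card :=
        pow_le_pow_of_le_one (by linarith) (by linarith) h.le
      have h4 : 1 ≤ ((1 - p1) ^ K)⁻¹ * (1 - p1) ^ (Ue t).card := by
        rw [inv_mul_eq_div, le_div_iff₀ hpK]; linarith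
      have h5 : (1 - α) ^ (Ue t).card ≤ 1 := pow_le_one₀ (by linarith) (by linarith)
      have h6 : ((1 - p1) ^ K)⁻¹ * (ind (¬ H t) * (1 - p1) ^ (Ue t).card) =
        ind (¬ H t) * (((1 - p1) ^ K)⁻¹ * (1 - p1) ^ (Ue t).card) := by ring
      rw [h6]
      nlinarith
  refine (Ex_mono (hW α ha0 ha1) hpt).trans ?_
  rw [Ex_add, Ex_const, Ex_mul_left, div_eq_inv_mul]
  gcongr

end Attempt

section Dynamic
variable {d : ℕ}
open Relation

/-- macroscopic adjacency -/
def adj2 (x y : ℤ × ℤ) : Prop :=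
  (x.1 = y.1 ∧ (y.2 = x.2 + 1 ∨ x.2 = y.2 + 1)) ∨ (x.2 = y.2 ∧ (y.1 = x.1 + 1 ∨ x.1 = y.1 + 1))

/-- macroscopic connection -/
def Reach2 (S : Set (ℤ × ℤ)) (x z : ℤ × ℤ) : Prop :=
  ReflTransGen (fun a b => a ∈ S ∧ b ∈ S ∧ adj2 a b) x z

lemma Reach2.mono {S S' : Set (ℤ × ℤ)} {x z : ℤ × ℤ} (h : Reach2 S x z) (hS : S ⊆ S') : Reach2 S' x z :=
  rtg_mono (fun _ _ h => ⟨hS h.1, hS h.2.1, h.2.2⟩) h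

open Classical in
/-- layered index set -/
noncomputable def sIdx (G : Finset (V d)) (ctr : ℤ × ℤ → V d) (n m : ℕ) (R : Finset (V d))
    (U : Finset (ℤ × ℤ)) : Finset (Lay d) :=
  ((Ed G).filter (fun e => ∀ v ∈ e, v ∉ R)).map bE ∪
    (U.biUnion (fun y => (Ed (Bl (ctr y) (3 * n))).map (lE y)) ∪
      U.biUnion (fun y => (Bl (ctr y) n).biUnion (sds y m)))

lemma mem_sIdx {G : Finset (V d)} {ctr : ℤ × ℤ → V d} {n m : ℕ} {R : Finset (V d)}
    {U : Finset (ℤ × ℤ)} {i : Lay d} : i ∈ sIdx G ctr n m R U ↔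
    (∃ e ∈ Ed G, (∀ v ∈ e, v ∉ R) ∧ i = Lay.base e) ∨
    (∃ y ∈ U, ∃ e ∈ Ed (Bl (ctr y) (3 * n)), i = Lay.lay y e) ∨
    (∃ y ∈ U, ∃ q ∈ Bl (ctr y) n, ∃ e ∈ Ed (Bl q m), i = Lay.seed y q e) := by
  classical
  simp only [sIdx, Finset.mem_union, Finset.mem_map, Finset.mem_biUnion, Finset.mem_filter, mem_sds]
  refine or_congr ⟨?_, ?_⟩ (or_congr ⟨?_, ?_⟩ Iff.rfl)
  · rintro ⟨e, he, rfl⟩; exact ⟨e, he.1, he.2, rfl⟩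
  · rintro ⟨e, he, he', rfl⟩; exact ⟨e, ⟨he, he'⟩, rfl⟩
  · rintro ⟨y, hy, e, he, rfl⟩; exact ⟨y, hy, e, he, rfl⟩
  · rintro ⟨y, hy, e, he, rfl⟩; exact ⟨y, hy, e, he, rfl⟩

lemma Rch_mem {Λ R : Finset (V d)} {y : ℤ × ℤ} {t : Set (Lay d)} {v : V d} (h : Rch Λ R y t v) :
    v ∈ Λ ∧ v ∉ R := by
  obtain ⟨u, w, h1, h2, h3, h4, h5, h6, h7⟩ := h
  exact h7.mem ⟨h3, h4⟩

lemma Rch_agree {Λ R : Finset (V d)} {y : ℤ × ℤ} {t t' : Set (Lay d)}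
    (ha : ∀ u w, u ∈ Λ → w ∈ Λ → dist1 u w = 1 → (Lay.lay y s(u, w) ∈ t ↔ Lay.lay y s(u, w) ∈ t'))
    (hb : ∀ u w, u ∈ Λ → u ∉ R → w ∈ Λ → w ∉ R → dist1 u w = 1 → Rch Λ R y t u →
      (Lay.base s(u, w) ∈ t ↔ Lay.base s(u, w) ∈ t')) (v : V d) : Rch Λ R y t v ↔ Rch Λ R y t' v := by
  constructor
  · rintro ⟨u, w, h1, h2, h3, h4, h5, h6, h7⟩
    refine ⟨u, w, h1, h2, h3, h4, h5, (ha u w h1 h3 h5).1 h6, ?_⟩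
    suffices h : Cn (bt t') ((Λ : Set (V d)) \ R) w v ∧ Rch Λ R y t v from h.1
    refine rtg_inv (P := fun v => Cn (bt t') ((Λ : Set (V d)) \ R) w v ∧ Rch Λ R y t v) h7
      ⟨Cn.refl _, u, w, h1, h2, h3, h4, h5, h6, Cn.refl _⟩ ?_
    rintro x x' ⟨hx, hr⟩ hs
    refine ⟨hx.tail ⟨hs.1, hs.2.1, hs.2.2.1, ?_⟩, ?_⟩
    · exact (hb x x' hs.1.1 hs.1.2 hs.2.1.1 hs.2.1.2 hs.2.2.1 hr).1 hs.2.2.2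
    · obtain ⟨u', w', k1, k2, k3, k4, k5, k6, k7⟩ := hr
      exact ⟨u', w', k1, k2, k3, k4, k5, k6, k7.tail hs⟩
  · rintro ⟨u, w, h1, h2, h3, h4, h5, h6, h7⟩
    refine rtg_inv (P := fun v => Rch Λ R y t v) h7
      ⟨u, w, h1, h2, h3, h4, h5, (ha u w h1 h3 h5).2 h6, Cn.refl _⟩ ?_
    intro x x' hr hs
    have := (hb x x' hs.1.1 hs.1.2 hs.2.1.1 hs.2.1.2 hs.2.2.1 hr).2 hs.2.2.2
    obtain ⟨u', w', k1, k2, k3, k4, k5, k6, k7⟩ := hr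
    exact ⟨u', w', k1, k2, k3, k4, k5, k6, k7.tail ⟨hs.1, hs.2.1, hs.2.2.1, this⟩⟩

open Classical in
/-- canonical choice -/
noncomputable def pick {α : Type*} (P : α → Prop) : Option α := if h : ∃ q, P q then some h.choose else none

lemma pick_some {α : Type*} {P : α → Prop} {q : α} (h : pick P = some q) : P q := by
  classical
  unfold pick at h
  split_ifs at h with h'
  injection h with h
  rw [← h]
  exact h'.choose_spec

lemma pick_none {α : Type*} {P : α → Prop} (h : pick P = none) : ¬ ∃ q, P q := by
  classical
  unfold pick at h
  split_ifs at h with h'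
  exact h'

open Classical in
/-- new explored set -/
noncomputable def RR (Λ R Q : Finset (V d)) (m : ℕ) (y : ℤ × ℤ) (t : Set (Lay d)) : Finset (V d) :=
  R ∪ (Λ.filter (Rch Λ R y t) ∪ (Q.filter (Hit Λ R Q m y t)).biUnion (fun q => Bl q m))

lemma mem_RR {Λ R Q : Finset (V d)} {m : ℕ} {y : ℤ × ℤ} {t : Set (Lay d)} {v : V d} :
    v ∈ RR Λ R Q m y t ↔ v ∈ R ∨ Rch Λ R y t v ∨ ∃ q, Hit Λ R Q m y t q ∧ v ∈ Bl q m := by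
  classical
  simp only [RR, Finset.mem_union, Finset.mem_filter, Finset.mem_biUnion]
  refine or_congr Iff.rfl (or_congr ⟨fun h => h.2, fun h => ⟨(Rch_mem h).1, h⟩⟩ ?_)
  constructor
  · rintro ⟨q, ⟨_, h⟩, h'⟩; exact ⟨q, h, h'⟩
  · rintro ⟨q, h, h'⟩; exact ⟨q, ⟨h.1, h⟩, h'⟩

lemma self_mem_Bl (q : V d) (m : ℕ) : q ∈ Bl q m := by
  rw [mem_Bl]; intro k; constructor <;> omega

lemma Cn_Bl {t : Set (Sym2 (V d))} {S : Set (V d)} {q u v : V d} {m : ℕ} (hS : (Bl q m : Set (V d)) ⊆ S)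
    (ht : ∀ x y, x ∈ Bl q m → y ∈ Bl q m → dist1 x y = 1 → s(x, y) ∈ t) (hu : u ∈ Bl q m)
    (hv : v ∈ Bl q m) : Cn t S u v := by
  have key : ∀ x : V d, x ∈ Bl q m ↔ (fun k => q k - m : V d) ≤ x ∧ x ≤ (fun k => q k + m : V d) := by
    intro x
    rw [mem_Bl, Pi.le_def, Pi.le_def]
    exact forall_and
  refine Cn_box (lo := fun k => q k - m) (hi := fun k => q k + m) (fun x h1 h2 => hS ((key x).2 ⟨h1, h2⟩))
    (fun x y h1 h2 h3 h4 => ht x y ((key x).2 ⟨h1, h2⟩) ((key y).2 ⟨h3, h4⟩)) u v ?_ ?_ ?_ ?_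
  · exact ((key u).1 hu).1
  · exact ((key u).1 hu).2
  · exact ((key v).1 hv).1
  · exact ((key v).1 hv).2

lemma Bl_sub {b q : V d} {k m n : ℕ} (hq : q ∈ Bl b k) (h : k + m ≤ n) : Bl q m ⊆ Bl b n := by
  intro v hv
  rw [mem_Bl] at *
  intro l
  have h1 := hq l
  have h2 := hv l
  constructor <;> omega

theorem dyn (r : Lay d → ℝ) (hr : IsW r) (G : Finset (V d)) (ctr : ℤ × ℤ → V d) (n m : ℕ) (hmn : m ≤ n)
    {η : ℝ} (hηz : 0 ≤ η) (hη1 : η ≤ 1)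
    (hstep : ∀ x y, adj2 x y → ∀ b ∈ Bl (ctr x) n, ∃ Q : Finset (V d), Q ⊆ Bl (ctr y) n ∧
      Q ⊆ Bl b n ∧ Bl b n ⊆ Bl (ctr y) (3 * n) ∧ ∀ R, Bl b m ⊆ R → ∀ s, sAtt (Bl b n) R Q m y ⊆ s →
        1 - η ≤ Pr r s (fun t => ∃ q, Hit (Bl b n) R Q m y t q))
    (z : ℤ × ℤ) (U : Finset (ℤ × ℤ)) (hU : ∀ y ∈ U, Bl (ctr y) (3 * n) ⊆ G)
    (O : Set (ℤ × ℤ)) (R : Finset (V d)) (b : ℤ × ℤ → V d)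
    (hb : ∀ x ∈ O, b x ∈ Bl (ctr x) n ∧ Bl (b x) m ⊆ R) :
    Pr (fun _ => 1 - η) U (fun t => ∃ x ∈ O, Reach2 (t ∪ O) x z) ≤
      Pr r (sIdx G ctr n m R U) (fun t => ∃ a ∈ R, ∃ w ∈ Bl (ctr z) n, Cn (pe '' t) G a w) := by
  classical
  have hηW : IsW (fun _ : ℤ × ℤ => 1 - η) := isW_const (by linarith) (by linarith)
  induction hc : U.card generalizing U O R b with
  | zero =>
    by_cases hz : z ∈ O
    · rw [Pr_true (p := r)]
      · exact Pr_le_one hηW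
      · intro t _
        exact ⟨b z, (hb z hz).2 (self_mem_Bl _ _), b z, (hb z hz).1, Cn.refl _⟩
    · refine le_trans (le_of_eq (Pr_false fun t ht => ?_)) (Pr_nonneg hr)
      rintro ⟨x, hx, h⟩
      obtain ⟨c, e, _, h2, h3, h4, _⟩ := first_exit (P := fun v => v ∈ O) h hx hz
      have hU0 : U = ∅ := Finset.card_eq_zero.1 hc
      rcases h3.2.1 with h5 | h5
      · have := ht h5; rw [hU0] at this; simp at this
      · exact h4 h5
  | succ k ih =>
    by_cases hz : z ∈ O
    · rw [Pr_true (p := r)]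
      · exact Pr_le_one hηW
      · intro t _
        exact ⟨b z, (hb z hz).2 (self_mem_Bl _ _), b z, (hb z hz).1, Cn.refl _⟩
    by_cases hex : ∃ y ∈ U, ∃ x ∈ O, adj2 x y ∧ y ∉ O
    swap
    · refine le_trans (le_of_eq (Pr_false fun t ht => ?_)) (Pr_nonneg hr)
      rintro ⟨x, hx, h⟩
      obtain ⟨c, e, _, h2, h3, h4, _⟩ := first_exit (P := fun v => v ∈ O) h hx hz
      rcases h3.2.1 with h5 | h5
      · exact hex ⟨e, ht h5, c, h2, h3.2.2, h4⟩
      · exact h4 h5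
    obtain ⟨y, hyU, x, hxO, hxy, hyO⟩ := hex
    obtain ⟨Q, hQ, hQΛ, hΛ, hatt⟩ := hstep x y hxy (b x) (hb x hxO).1
    set Λ := Bl (b x) n with hΛdef
    set s := sIdx G ctr n m R U with hs
    set U' := U.erase y with hU'
    have hUU : U = insert y U' := (Finset.insert_erase hyU).symm
    have hyU' : y ∉ U' := Finset.notMem_erase y U
    have hΛG : Λ ⊆ G := hΛ.trans (hU y hyU)
    -- outcome
    let X : Set (Lay d) → Finset (V d) × Option (V d) := fun t =>
      (RR Λ R Q m y t, pick (Hit Λ R Q m y t))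
    let sa : Finset (V d) × Option (V d) → Finset (Lay d) := fun o => s.filter (fun i =>
      (∃ e, i = Lay.lay y e) ∨ (∃ q e, i = Lay.seed y q e) ∨ (∃ e, i = Lay.base e ∧ ∃ v ∈ e, v ∈ o.1))
    let sb : Finset (V d) × Option (V d) → Finset (Lay d) := fun o => sIdx G ctr n m o.1 U'
    let Bv : Finset (V d) × Option (V d) → Set (Lay d) → Prop := fun o t =>
      ∃ a ∈ o.1, ∃ w ∈ Bl (ctr z) n, Cn (pe '' t) G a w
    let W : Set (ℤ × ℤ) → ℝ := fun O => Pr (fun _ => 1 - η) U' (fun t => ∃ x ∈ O, Reach2 (t ∪ O) x z)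
    let gv : Finset (V d) × Option (V d) → ℝ := fun o => if o.2.isSome then W (insert y O) else W O
    have hRR : ∀ t, R ⊆ RR Λ R Q m y t := fun t v hv => mem_RR.2 (Or.inl hv)
    have main := explore (s := s) hr X
      (fun t => ∃ a ∈ R, ∃ w ∈ Bl (ctr z) n, Cn (pe '' t) G a w) sa sb Bv gv
      (fun t _ => Finset.filter_subset _ _) ?_ ?_ ?_ ?_ ?_
    · refine le_trans ?_ main
      -- evaluate
      have hWm : W O ≤ W (insert y O) := by
        refine Pr_mono hηW fun t _ => ?_
        rintro ⟨x, hx, h⟩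
        exact ⟨x, Or.inr hx, h.mono (Set.union_subset_union_right _ (Set.subset_insert _ _))⟩
      have hsucc : 1 - η ≤ Pr r s (fun t => ∃ q, Hit Λ R Q m y t q) := by
        refine hatt R (hb x hxO).2 s ?_
        intro i hi
        rw [sAtt, Finset.mem_union, mem_sExt, mem_sLay] at hi
        rw [hs, mem_sIdx]
        rcases hi with (⟨e, he, rfl⟩ | ⟨q, hq, hi⟩) | ⟨e, he, _, rfl⟩
        · left
          refine ⟨e, Ed_mono (Finset.sdiff_subset.trans hΛG) he, ?_, rfl⟩
          induction e with | _ u v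
          rw [mem_Ed, Finset.mem_sdiff, Finset.mem_sdiff] at he
          intro w hw
          rcases Sym2.mem_iff.1 hw with rfl | rfl
          · exact he.1.2
          · exact he.2.1.2
        · right; right
          exact ⟨y, hyU, q, hQ hq, mem_sds.1 hi⟩
        · right; left
          exact ⟨y, hyU, e, Ed_mono hΛ he, rfl⟩
      have e1 : Ex r s (fun t => gv (X t)) = W O + Pr r s (fun t => ∃ q, Hit Λ R Q m y t q) *
          (W (insert y O) - W O) := by
        have : ∀ t : Set (Lay d), t ⊆ s → gv (X t) =
            W O + ind (∃ q, Hit Λ R Q m y t q) * (W (insert y O) - W O) := by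
          intro t _
          by_cases h : ∃ q, Hit Λ R Q m y t q
          · rw [ind_pos h]
            simp [gv, X, pick, h]
          · rw [ind_neg h]
            simp [gv, X, pick, h]
        rw [Ex_congr this, Ex_add, Ex_const, Ex_mul_right]
        rfl
      rw [e1]
      have e2 : Pr (fun _ => 1 - η) U (fun t => ∃ x ∈ O, Reach2 (t ∪ O) x z) ≤
          (1 - η) * W (insert y O) + η * W O := by
        rw [hUU]
        unfold Pr
        rw [Ex_insert hyU']
        have a1 : Ex (fun _ => 1 - η) U' (fun t => ind (∃ x ∈ O, Reach2 (insert y t ∪ O) x z)) ≤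
            W (insert y O) := by
          refine Pr_mono hηW fun t _ => ?_
          rintro ⟨x, hx, h⟩
          refine ⟨x, Or.inr hx, h.mono ?_⟩
          intro v hv
          rcases hv with (hv | hv) | hv
          · exact Or.inr (Or.inl hv)
          · exact Or.inl hv
          · exact Or.inr (Or.inr hv)
        have a2 : 1 - (1 - η) = η := by ring
        rw [a2]
        exact add_le_add (mul_le_mul_of_nonneg_left a1 (by linarith)) le_rfl
      nlinarith
    · -- sb ⊆ s
      intro t _ i hi
      rw [mem_sIdx] at hi
      rw [hs, mem_sIdx]
      rcases hi with ⟨e, he, h, rfl⟩ | ⟨y', hy', h⟩ | ⟨y', hy', h⟩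
      · exact Or.inl ⟨e, he, fun v hv hR => h v hv (hRR t hR), rfl⟩
      · exact Or.inr (Or.inl ⟨y', Finset.mem_of_mem_erase hy', h⟩)
      · exact Or.inr (Or.inr ⟨y', Finset.mem_of_mem_erase hy', h⟩)
    · intro t _
      rw [Finset.disjoint_left]
      intro i hi hi'
      have h2 := (Finset.mem_filter.1 hi).2
      rw [mem_sIdx] at hi'
      rcases hi' with ⟨e, he, h, rfl⟩ | ⟨y', hy', e, he, rfl⟩ | ⟨y', hy', q, _, e, he, rfl⟩
      · rcases h2 with ⟨e', h2⟩ | ⟨q, e', h2⟩ | ⟨e', h2, v, hv, hv'⟩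
        · cases h2
        · cases h2
        · injection h2 with h2; subst h2; exact h v hv hv'
      · rcases h2 with ⟨e', h2⟩ | ⟨q, e', h2⟩ | ⟨e', h2, v, hv, hv'⟩
        · injection h2 with h2; subst h2; exact hyU' hy'
        · cases h2
        · cases h2
      · rcases h2 with ⟨e', h2⟩ | ⟨q, e', h2⟩ | ⟨e', h2, v, hv, hv'⟩
        · cases h2
        · injection h2 with h2; subst h2; exact hyU' hy'
        · cases h2
    · -- measurability
      intro t t' ht ht' hag
      have hag' : ∀ i ∈ sa (X t), (i ∈ t ↔ i ∈ t') := by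
        intro i hi
        have : i ∈ t ∩ sa (X t) ↔ i ∈ t' ∩ sa (X t) := by rw [hag]
        simpa [hi] using this
      have hR : ∀ v, Rch Λ R y t v ↔ Rch Λ R y t' v := by
        refine Rch_agree ?_ ?_
        · intro u w hu hw huw
          refine hag' _ (Finset.mem_filter.2 ⟨?_, Or.inl ⟨_, rfl⟩⟩)
          rw [hs, mem_sIdx]
          exact Or.inr (Or.inl ⟨y, hyU, _, mem_Ed.2 ⟨hΛ hu, hΛ hw, huw⟩, rfl⟩)
        · intro u w hu hu' hw hw' huw hru
          refine hag' _ (Finset.mem_filter.2 ⟨?_, Or.inr (Or.inr ⟨_, rfl, u, Sym2.mem_mk_left _ _, ?_⟩)⟩)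
          · rw [hs, mem_sIdx]
            refine Or.inl ⟨_, mem_Ed.2 ⟨hΛG hu, hΛG hw, huw⟩, ?_, rfl⟩
            intro v hv
            rcases Sym2.mem_iff.1 hv with rfl | rfl
            · exact hu'
            · exact hw'
          · exact mem_RR.2 (Or.inr (Or.inl hru))
      have hH : Hit Λ R Q m y t = Hit Λ R Q m y t' := by
        funext q
        refine propext (and_congr_right fun hq => and_congr ?_ (or_congr Iff.rfl (hR q)))
        refine forall_congr' fun i => forall_congr' fun hi => ?_
        obtain ⟨e, he, rfl⟩ := mem_sds.1 hi
        refine hag' _ (Finset.mem_filter.2 ⟨?_, Or.inr (Or.inl ⟨q, e, rfl⟩)⟩)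
        rw [hs, mem_sIdx]
        exact Or.inr (Or.inr ⟨y, hyU, q, hQ hq, e, he, rfl⟩)
      have hRRe : RR Λ R Q m y t = RR Λ R Q m y t' := by
        ext v
        rw [mem_RR, mem_RR, hH, hR]
      simp only [X, hH, hRRe]
    · -- hE
      intro t ht ⟨a, ha, w, hw, hcn⟩
      have hcn' : Cn (pe '' t) G a w := hcn.mono (Set.image_mono Set.inter_subset_left) le_rfl
      have hrch : ∀ v, Rch Λ R y t v → ∃ a0 ∈ R, Cn (pe '' t) G a0 v := by
        rintro v ⟨u, w, h1, h2, h3, h4, h5, h6, h7⟩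
        refine ⟨u, h2, ReflTransGen.head (b := w) ⟨hΛG h1, hΛG h3, h5, ⟨_, h6, rfl⟩⟩ ?_⟩
        refine h7.mono ?_ ?_
        · intro e he; exact ⟨_, he, rfl⟩
        · intro v hv; exact hΛG hv.1
      rcases mem_RR.1 ha with h | h | ⟨q, hq, h⟩
      · exact ⟨a, h, w, hw, hcn'⟩
      · obtain ⟨a0, h0, h1⟩ := hrch a h
        exact ⟨a0, h0, w, hw, h1.trans hcn'⟩
      · have hqa : Cn (pe '' t) G q a := by
          refine Cn_Bl (q := q) (m := m) ?_ ?_ (self_mem_Bl _ _) h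
          · have := (Bl_sub (m := m) (n := 3 * n) (hQ hq.1) (by omega)).trans (hU y hyU)
            exact_mod_cast this
          · intro u v hu hv huv
            exact ⟨Lay.seed y q s(u, v), hq.2.1 (mem_sds.2 ⟨_, mem_Ed.2 ⟨hu, hv, huv⟩, rfl⟩), rfl⟩
        rcases hq.2.2 with h' | h'
        · exact ⟨q, h', w, hw, hqa.trans hcn'⟩
        · obtain ⟨a0, h0, h1⟩ := hrch q h'
          exact ⟨a0, h0, w, hw, h1.trans (hqa.trans hcn')⟩
    · -- hg
      intro t ht
      have hU'' : ∀ y ∈ U', Bl (ctr y) (3 * n) ⊆ G := fun y hy => hU y (Finset.mem_of_mem_erase hy)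
      have hcard : U'.card = k := by rw [hU', Finset.card_erase_of_mem hyU]; omega
      cases hp : pick (Hit Λ R Q m y t) with
      | none =>
        have : gv (X t) = W O := by simp [gv, X, hp]
        rw [this]
        exact ih U' hU'' O _ b (fun x hx => ⟨(hb x hx).1, (hb x hx).2.trans (hRR t)⟩) hcard
      | some q =>
        have : gv (X t) = W (insert y O) := by simp [gv, X, hp]
        rw [this]
        have hq := pick_some hp
        refine ih U' hU'' (insert y O) _ (Function.update b y q) ?_ hcard
        intro x' hx'
        by_cases hxy' : x' = y
        · subst hxy'
          rw [Function.update_self]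
          exact ⟨hQ hq.1, fun v hv => mem_RR.2 (Or.inr (Or.inr ⟨q, hq, hv⟩))⟩
        · rw [Function.update_of_ne hxy']
          rcases hx' with h | h
          · exact absurd h hxy'
          · exact ⟨(hb x' h).1, (hb x' h).2.trans (hRR t)⟩

end Dynamic

section Macro
variable {d : ℕ}
open Relation

/-- macroscopic centers -/
def ctr (c : V d) (i j : Fin d) (n : ℕ) (x : ℤ × ℤ) : V d := fun k =>
  c k + if k = i then (n : ℤ) * x.1 else if k = j then (n : ℤ) * x.2 else 0

lemma ctr_step (c : V d) {i j : Fin d} (hij : i ≠ j) (n : ℕ) {x y : ℤ × ℤ} (hxy : adj2 x y) {b : V d}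
    (hb : b ∈ Bl (ctr c i j n x) n) :
    ∃ a σ, Qf b n a σ ⊆ Bl (ctr c i j n y) n ∧ Bl b n ⊆ Bl (ctr c i j n y) (3 * n) := by
  have key : ∃ (a : Fin d) (ε : ℤˣ), (∀ l, l ≠ a → ctr c i j n y l = ctr c i j n x l) ∧
      ctr c i j n y a = ctr c i j n x a + ε * n := by
    rcases hxy with ⟨h1, h2⟩ | ⟨h1, h2⟩
    · refine ⟨j, if y.2 = x.2 + 1 then 1 else -1, ?_, ?_⟩
      · intro l hl
        simp [ctr, hl, h1]
      · simp only [ctr, hij.symm, if_false, if_true]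
        rcases h2 with h2 | h2
        · rw [if_pos h2, h2]; push_cast; ring
        · rw [if_neg (by omega), h2]; push_cast; ring
    · refine ⟨i, if y.1 = x.1 + 1 then 1 else -1, ?_, ?_⟩
      · intro l hl
        simp [ctr, hl, h1]
      · simp only [ctr, if_true]
        rcases h2 with h2 | h2
        · rw [if_pos h2, h2]; push_cast; ring
        · rw [if_neg (by omega), h2]; push_cast; ring
  obtain ⟨a, ε, h1, h2⟩ := key
  rw [mem_Bl] at hb
  refine ⟨a, fun l => if l = a then ε else if 0 ≤ b l - ctr c i j n x l then -1 else 1, ?_, ?_⟩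
  · intro v hv
    rw [mem_Qf] at hv
    obtain ⟨hv1, hv2, hv3⟩ := hv
    rw [mem_Bl] at hv1 ⊢
    intro l
    have hbl := hb l
    have hvl := hv1 l
    by_cases hl : l = a
    · subst hl
      rw [if_pos rfl] at hv2
      rw [h2]
      rcases Int.units_eq_one_or ε with h | h <;> rw [h] at hv2 ⊢ <;> simp at hv2 ⊢ <;> omega
    · have h3 := hv3 l
      rw [if_neg hl] at h3
      rw [h1 l hl]
      split_ifs at h3 with h4
      · simp at h3; omega
      · simp at h3; omega
  · intro v hv
    rw [mem_Bl] at hv ⊢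
    intro l
    have hbl := hb l
    have hvl := hv l
    have h4 : ctr c i j n x l - n ≤ ctr c i j n y l ∧ ctr c i j n y l ≤ ctr c i j n x l + n := by
      by_cases hl : l = a
      · subst hl
        rw [h2]
        rcases Int.units_eq_one_or ε with h | h <;> rw [h] <;> simp <;> omega
      · rw [h1 l hl]; omega
    push_cast
    omega

lemma prod_ge_of_sub {ι : Type*} [DecidableEq ι] {s t : Finset ι} (h : s ⊆ t) {f : ι → ℝ} (h0 : ∀ i, 0 ≤ f i)
    (h1 : ∀ i, f i ≤ 1) : ∏ i ∈ t, f i ≤ ∏ i ∈ s, f i := by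
  rw [← Finset.prod_sdiff h]
  have a : ∏ i ∈ t \ s, f i ≤ 1 := Finset.prod_le_one (fun i _ => h0 i) (fun i _ => h1 i)
  have b : 0 ≤ ∏ i ∈ s, f i := Finset.prod_nonneg fun i _ => h0 i
  nlinarith

lemma layer_bound {p1 α β : ℝ} (h1 : 0 ≤ p1 ∧ p1 ≤ 1) (h2 : 0 ≤ α ∧ α ≤ 1) (h3 : 0 ≤ β ∧ β ≤ 1)
    {i j : Fin d} (hij : i ≠ j) (c : V d) {n m : ℕ} (hn : 0 < n) (hmn : m ≤ n)
    (G R : Finset (V d)) (U : Finset (ℤ × ℤ)) (e : Sym2 (V d)) (w : Finset (Lay d))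
    (hw : w ⊆ sIdx G (ctr c i j n) n m R U) (hwe : ∀ l ∈ w, pe l = e) :
    (1 - p1) * (1 - α) ^ 49 * (1 - β) ^ (49 * (Bx d m).card) ≤ ∏ l ∈ w, (1 - lw p1 α β l) := by
  classical
  have hW := lw_isW (d := d) h1 h2 h3
  induction e with | _ u v
  set A : Finset (ℤ × ℤ) := Finset.Icc ((u i - c i) / n - 3) ((u i - c i) / n + 3) ×ˢ
    Finset.Icc ((u j - c j) / n - 3) ((u j - c j) / n + 3) with hA
  have hAc : A.card = 49 := by
    rw [hA, Finset.card_product, Int.card_Icc, Int.card_Icc]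
    have e1 : ∀ a : ℤ, (a + 3 + 1 - (a - 3)).toNat = 7 := fun a => by
      have : a + 3 + 1 - (a - 3) = 7 := by ring
      rw [this]; rfl
    rw [e1, e1]
  have hdiv : ∀ a y : ℤ, a - 3 * n ≤ n * y → n * y ≤ a + 3 * n → a / n - 3 ≤ y ∧ y ≤ a / n + 3 := by
    intro a y k1 k2
    have hn' : (0 : ℤ) < n := by exact_mod_cast hn
    have e1 := Int.mul_ediv_add_emod a n
    have e2 := Int.emod_nonneg a hn'.ne'
    have e3 := Int.emod_lt_of_pos a hn'
    constructor
    · by_contra hcon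
      have : y + 1 ≤ a / n - 3 := by omega
      nlinarith
    · by_contra hcon
      have : a / n + 4 ≤ y := by omega
      nlinarith
  have hyA : ∀ y, u ∈ Bl (ctr c i j n y) (3 * n) → y ∈ A := by
    intro y hy
    rw [mem_Bl] at hy
    have e1 := hy i
    have e2 := hy j
    simp only [ctr, if_true, hij.symm, if_false] at e1 e2
    push_cast at e1 e2
    rw [hA, Finset.mem_product, Finset.mem_Icc, Finset.mem_Icc]
    exact ⟨hdiv _ _ (by linarith) (by linarith), hdiv _ _ (by linarith) (by linarith)⟩
  set w1 : Finset (Lay d) := {Lay.base s(u, v)}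
  set w2 : Finset (Lay d) := A.image (fun y => Lay.lay y s(u, v))
  set w3 : Finset (Lay d) := (A ×ˢ Bl u m).image (fun y => Lay.seed y.1 y.2 s(u, v))
  have hsub : w ⊆ w1 ∪ (w2 ∪ w3) := by
    intro l hl
    have hl1 := mem_sIdx.1 (hw hl)
    have hl2 := hwe l hl
    rw [Finset.mem_union, Finset.mem_union]
    rcases hl1 with ⟨e, he, _, rfl⟩ | ⟨y, hy, e, he, rfl⟩ | ⟨y, hy, q, hq, e, he, rfl⟩
    · left
      have : e = s(u, v) := hl2
      simp [w1, this]
    · right; left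
      have : e = s(u, v) := hl2
      subst this
      rw [mem_Ed] at he
      exact Finset.mem_image.2 ⟨y, hyA y he.1, rfl⟩
    · right; right
      have : e = s(u, v) := hl2
      subst this
      rw [mem_Ed] at he
      refine Finset.mem_image.2 ⟨(y, q), Finset.mem_product.2 ⟨hyA y ?_, ?_⟩, rfl⟩
      · exact Bl_sub hq (by omega) he.1
      · have := he.1
        rw [mem_Bl] at this ⊢
        intro k
        have := this k
        constructor <;> linarith
  have hd2 : Disjoint w2 w3 := by
    rw [Finset.disjoint_left]
    intro l hl hl'
    obtain ⟨y, _, rfl⟩ := Finset.mem_image.1 hl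
    obtain ⟨y', _, h⟩ := Finset.mem_image.1 hl'
    cases h
  have hd1 : Disjoint w1 (w2 ∪ w3) := by
    rw [Finset.disjoint_left]
    intro l hl hl'
    have := Finset.mem_singleton.1 hl
    subst this
    rcases Finset.mem_union.1 hl' with h | h
    · obtain ⟨y', _, h⟩ := Finset.mem_image.1 h; cases h
    · obtain ⟨y', _, h⟩ := Finset.mem_image.1 h; cases h
  refine le_trans ?_ (prod_ge_of_sub hsub (fun l => by linarith [(hW l).2]) (fun l => by linarith [(hW l).1]))
  rw [Finset.prod_union hd1, Finset.prod_union hd2, mul_assoc]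
  have g1 : ∏ l ∈ w1, (1 - lw p1 α β l) = 1 - p1 := by simp [w1, lw]
  have g2 : (1 - α) ^ 49 ≤ ∏ l ∈ w2, (1 - lw p1 α β l) := by
    rw [Finset.prod_eq_pow_card (b := 1 - α)]
    · exact pow_le_pow_of_le_one (by linarith [h2.2]) (by linarith [h2.1]) (Finset.card_image_le.trans hAc.le)
    · intro l hl
      obtain ⟨y, _, rfl⟩ := Finset.mem_image.1 hl
      rfl
  have g3 : (1 - β) ^ (49 * (Bx d m).card) ≤ ∏ l ∈ w3, (1 - lw p1 α β l) := by
    rw [Finset.prod_eq_pow_card (b := 1 - β)]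
    · refine pow_le_pow_of_le_one (by linarith [h3.2]) (by linarith [h3.1]) (Finset.card_image_le.trans ?_)
      rw [Finset.card_product, hAc, Bl, Finset.card_map]
    · intro l hl
      obtain ⟨y, _, rfl⟩ := Finset.mem_image.1 hl
      rfl
  rw [g1]
  have n1 : 0 ≤ 1 - p1 := by linarith [h1.2]
  have n2 : 0 ≤ (1 - α) ^ 49 := pow_nonneg (by linarith [h2.2]) _
  have n3 : 0 ≤ (1 - β) ^ (49 * (Bx d m).card) := pow_nonneg (by linarith [h3.2]) _
  have n4 : 0 ≤ ∏ l ∈ w2, (1 - lw p1 α β l) := Finset.prod_nonneg (fun l _ => by linarith [(hW l).2])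
  exact mul_le_mul_of_nonneg_left (mul_le_mul g2 g3 n3 n4) n1

theorem macro_arith {p0 p1 a b A B : ℝ} (h0 : 0 ≤ p1) (h1 : p1 < p0) (hp : p0 ≤ 1)
    (ha : a = (p0 - p1) / 100) (hb : b = (p0 - p1) / 100) (hA : 1 - 49 * a ≤ A) (hB : 1 - 49 * b ≤ B) :
    1 - p0 ≤ (1 - p1) * A * B := by
  have hx : 0 ≤ p0 - p1 := by linarith
  have hc : 0 ≤ 1 - 49 * ((p0 - p1) / 100) := by linarith
  have hAB : (1 - 49 * ((p0 - p1) / 100)) * (1 - 49 * ((p0 - p1) / 100)) ≤ A * B :=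
    mul_le_mul (by linarith) (by linarith) hc (by linarith)
  have h2 : 1 - (p0 - p1) ≤ A * B := by nlinarith
  have h3 : (1 - p1) * (1 - (p0 - p1)) ≤ (1 - p1) * (A * B) :=
    mul_le_mul_of_nonneg_left h2 (by linarith)
  nlinarith [mul_nonneg h0 hx]

set_option maxHeartbeats 1000000 in
theorem macro_perc (hd : 0 < d) {p1 p0 : ℝ} (h0 : 0 ≤ p1) (h1 : p1 < p0) (hp0 : p0 ≤ 1) {θ : ℝ} (hθ : 0 < θ)
    (hth : ∀ n, θ ≤ th d p1 n) {η : ℝ} (hη : 0 < η) (hη1 : η ≤ 1) :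
    ∃ n : ℕ, 0 < n ∧ ∀ i j : Fin d, i ≠ j → ∀ (c : V d) (G : Finset (V d)) (x z : ℤ × ℤ)
      (U : Finset (ℤ × ℤ)), (∀ y ∈ U, Bl (ctr c i j n y) (3 * n) ⊆ G) →
      Pr (fun _ => 1 - η) U (fun t => Reach2 (t ∪ {x}) x z) ≤
        PrE p0 G (fun t => ∃ a ∈ Bl (ctr c i j n x) n, ∃ w ∈ Bl (ctr c i j n z) n, Cn t G a w) := by
  classical
  have hp1 : p1 < 1 := lt_of_lt_of_le h1 hp0
  set α : ℝ := (p0 - p1) / 100 with hα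
  have hα0 : 0 < α := by rw [hα]; linarith
  have hα1 : α < 1 := by rw [hα]; linarith
  obtain ⟨K, hK⟩ := exists_pow_lt_of_lt_one (show (0 : ℝ) < η / 2 by linarith) (show 1 - α < 1 by linarith)
  have hpK : 0 < (1 - p1) ^ K := pow_pos (by linarith) _
  set ηz : ℝ := η / 4 * (1 - p1) ^ K with hηz
  have hηpos : 0 < ηz := by positivity
  obtain ⟨m, hm⟩ := seed_base hd h0 hp1 hθ hth hηpos
  set M : ℕ := (Bx d m).card with hM
  have hMpos : (1 : ℝ) ≤ M := by
    have : 0 < M := Finset.card_pos.2 ⟨0, zero_mem_Bx m⟩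
    exact_mod_cast this
  set β : ℝ := (p0 - p1) / (100 * M) with hβ
  have hβ0 : 0 < β := by
    rw [hβ]; apply div_pos <;> linarith
  have hβM : β * M = (p0 - p1) / 100 := by rw [hβ]; field_simp
  have hβ1 : β < 1 := by nlinarith
  set γ := β ^ (Ed (Bx d m)).card with hγ
  have hγ0 : 0 < γ := pow_pos hβ0 _
  obtain ⟨J, hJ⟩ := exists_pow_lt_of_lt_one hηpos (show 1 - γ < 1 by linarith)
  obtain ⟨n, hmn, hn⟩ := hm J
  refine ⟨n, by omega, fun i j hij c G x z U hU => ?_⟩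
  have hW : IsW (lw p1 α β : Lay d → ℝ) := lw_isW ⟨h0, hp1.le⟩ ⟨hα0.le, hα1.le⟩ ⟨hβ0.le, hβ1.le⟩
  have hstep : ∀ x y, adj2 x y → ∀ b ∈ Bl (ctr c i j n x) n, ∃ Q : Finset (V d), Q ⊆ Bl (ctr c i j n y) n ∧
      Q ⊆ Bl b n ∧ Bl b n ⊆ Bl (ctr c i j n y) (3 * n) ∧ ∀ R, Bl b m ⊆ R → ∀ s, sAtt (Bl b n) R Q m y ⊆ s →
        1 - η ≤ Pr (lw p1 α β) s (fun t => ∃ q, Hit (Bl b n) R Q m y t q) := by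
    intro x y hxy b hb
    obtain ⟨a, σ, k1, k2⟩ := ctr_step c hij n hxy hb
    refine ⟨Qf b n a σ, k1, fun v hv => (mem_Qf.1 hv).1, k2, fun R hR s hs => ?_⟩
    refine attempt h0 hp1 hα0.le hα1.le hβ0.le hβ1.le _ R _ (Bl b m) m y J K ηz η hR ?_ ?_ s hs
    · rw [RP_shift]; exact hn a σ
    · have e1 : (ηz + (1 - γ) ^ J) / (1 - p1) ^ K ≤ η / 2 := by
        rw [div_le_iff₀ hpK]
        have : ηz = η / 4 * (1 - p1) ^ K := hηz
        linarith
      linarith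
  have hdyn := dyn (lw p1 α β) hW G (ctr c i j n) n m hmn.le hη.le hη1 hstep z U hU {x}
    (Bl (ctr c i j n x) n) (fun x => ctr c i j n x) ?_
  · have e1 : Pr (fun _ => 1 - η) U (fun t => Reach2 (t ∪ {x}) x z) ≤
        Pr (fun _ => 1 - η) U (fun t => ∃ x' ∈ ({x} : Set (ℤ × ℤ)), Reach2 (t ∪ {x}) x' z) :=
      Pr_mono (isW_const (by linarith) (by linarith)) fun t _ h => ⟨x, rfl, h⟩
    refine (e1.trans hdyn).trans ?_
    unfold PrE Pr
    refine Ex_layer (f := fun t => ind (∃ a ∈ Bl (ctr c i j n x) n, ∃ w ∈ Bl (ctr c i j n z) n, Cn t G a w))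
      hW (isW_const (by linarith) hp0) pe (Ed G) _ ?_ ?_ ?_
    · intro t t' htt
      exact ind_mono fun ⟨a, ha, w, hw, h⟩ => ⟨a, ha, w, hw, h.mono htt le_rfl⟩
    · intro l hl
      rcases mem_sIdx.1 hl with ⟨e, he, _, rfl⟩ | ⟨y, hy, e, he, rfl⟩ | ⟨y, hy, q, hq, e, he, rfl⟩
      · exact he
      · exact Ed_mono (hU y hy) he
      · exact Ed_mono ((Bl_sub hq (by omega)).trans (hU y hy)) he
    · intro e _ w hw hwe
      refine le_trans ?_ (layer_bound ⟨h0, hp1.le⟩ ⟨hα0.le, hα1.le⟩ ⟨hβ0.le, hβ1.le⟩ hij c (by omega) hmn.le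
        G _ U e w hw hwe)
      have b1 := one_add_mul_le_pow (show (-2 : ℝ) ≤ -α by linarith) 49
      have b2 := one_add_mul_le_pow (show (-2 : ℝ) ≤ -β by linarith) (49 * M)
      rw [← sub_eq_add_neg] at b1 b2
      have b3 : 1 - 49 * (β * M) ≤ (1 - β) ^ (49 * M) := by
        refine le_trans (le_of_eq ?_) b2
        push_cast; ring
      have b4 : 1 - 49 * α ≤ (1 - α) ^ 49 := by
        refine le_trans (le_of_eq ?_) b1
        push_cast; ring
      exact macro_arith h0 h1 hp0 hα hβM b4 b3
  · intro x' hx'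
    rw [Set.mem_singleton_iff] at hx'
    subst hx'
    exact ⟨self_mem_Bl _ _, Bl_sub (self_mem_Bl _ 0) (by omega)⟩

end Macro

section Planar

/-- Rectangle in `ℤ²`. -/
def Rc (a b A B : ℤ) : Set (ℤ × ℤ) := {x | a ≤ x.1 ∧ x.1 ≤ A ∧ b ≤ x.2 ∧ x.2 ≤ B}

theorem mem_Rc {a b A B : ℤ} {x : ℤ × ℤ} : x ∈ Rc a b A B ↔ a ≤ x.1 ∧ x.1 ≤ A ∧ b ≤ x.2 ∧ x.2 ≤ B := Iff.rfl

/-- Step inside `R` avoiding the edges of `F`. -/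
def StF (R : Set (ℤ × ℤ)) (F : Set (Sym2 (ℤ × ℤ))) (u v : ℤ × ℤ) : Prop :=
  u ∈ R ∧ v ∈ R ∧ adj2 u v ∧ s(u, v) ∉ F

theorem adj2_comm {u v : ℤ × ℤ} (h : adj2 u v) : adj2 v u := by
  unfold adj2 at *; omega

theorem StF.symm {R F} {u v : ℤ × ℤ} (h : StF R F u v) : StF R F v u :=
  ⟨h.2.1, h.1, adj2_comm h.2.2.1, by rw [Sym2.eq_swap]; exact h.2.2.2⟩

/-- The edges of the unit square with lower left corner `c`. -/
def sqE (c : ℤ × ℤ) : Set (Sym2 (ℤ × ℤ)) :=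
  {e | e = s((c.1, c.2), (c.1 + 1, c.2)) ∨ e = s((c.1, c.2), (c.1, c.2 + 1)) ∨
    e = s((c.1 + 1, c.2), (c.1 + 1, c.2 + 1)) ∨ e = s((c.1, c.2 + 1), (c.1 + 1, c.2 + 1))}

theorem potential (a b A B : ℤ) (H V : ℤ → ℤ → ℤ)
    (hc : ∀ i j, a ≤ i → i < A → b ≤ j → j < B → H i j + V (i + 1) j = V i j + H i (j + 1)) :
    ∃ h : ℤ → ℤ → ℤ, (∀ i j, a ≤ i → i < A → b ≤ j → j ≤ B → h (i + 1) j - h i j = H i j) ∧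
      (∀ i j, a ≤ i → i ≤ A → b ≤ j → j < B → h i (j + 1) - h i j = V i j) := by
  set h : ℤ → ℤ → ℤ := fun i j => (∑ k ∈ Finset.range (i - a).toNat, H (a + k) b) +
    ∑ l ∈ Finset.range (j - b).toNat, V i (b + l) with hh
  have hV : ∀ i j, b ≤ j → h i (j + 1) - h i j = V i j := by
    intro i j hj
    have e1 : (j + 1 - b).toNat = (j - b).toNat + 1 := by omega
    have e2 : b + ((j - b).toNat : ℤ) = j := by omega
    simp only [hh, e1, Finset.sum_range_succ, e2]
    ring
  refine ⟨h, ?_, fun i j _ _ hj _ => hV i j hj⟩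
  intro i j hi hi' hj hj'
  obtain ⟨n, rfl⟩ : ∃ n : ℕ, j = b + n := ⟨(j - b).toNat, by omega⟩
  induction n with
  | zero =>
    have e1 : (i + 1 - a).toNat = (i - a).toNat + 1 := by omega
    have e2 : a + ((i - a).toNat : ℤ) = i := by omega
    have e3 : a + max (i - a) 0 = i := by omega
    simp [hh, e1, Finset.sum_range_succ, e3]
  | succ n ih =>
    have ih' := ih (by omega) (by push_cast at hj'; omega)
    have k1 := hV i (b + n) (by omega)
    have k2 := hV (i + 1) (b + n) (by omega)
    have k3 := hc i (b + n) hi hi' (by omega) (by push_cast at hj'; omega)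
    push_cast
    rw [← add_assoc]
    linarith

theorem rtg_const {α : Type*} {r : α → α → Prop} (f : α → ℤ) (h : ∀ u v, r u v → f v = f u) {x y : α}
    (hxy : Relation.ReflTransGen r x y) : f y = f x := by
  induction hxy with
  | refl => rfl
  | tail _ h2 ih => rw [h _ _ h2, ih]

theorem planar_two_cuts {a b A B : ℤ} (F1 F2 : Set (Sym2 (ℤ × ℤ)))
    (hsq : ∀ c : ℤ × ℤ, a ≤ c.1 → c.1 < A → b ≤ c.2 → c.2 < B →
      (∀ e ∈ sqE c, e ∉ F1) ∨ (∀ e ∈ sqE c, e ∉ F2)) {x y : ℤ × ℤ}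
    (h1 : Relation.ReflTransGen (StF (Rc a b A B) F1) x y)
    (h2 : Relation.ReflTransGen (StF (Rc a b A B) F2) x y) :
    Relation.ReflTransGen (StF (Rc a b A B) (F1 ∪ F2)) x y := by
  classical
  set R := Rc a b A B with hR
  set f : ℤ × ℤ → ℤ := fun u => if Relation.ReflTransGen (StF R (F1 ∪ F2)) x u then 1 else 0 with hf
  have hfe : ∀ u v, StF R (F1 ∪ F2) u v → f v = f u := by
    intro u v huv
    have : Relation.ReflTransGen (StF R (F1 ∪ F2)) x u ↔ Relation.ReflTransGen (StF R (F1 ∪ F2)) x v :=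
      ⟨fun h => h.tail huv, fun h => h.tail huv.symm⟩
    simp only [hf, this]
  set g : ℤ × ℤ → ℤ × ℤ → ℤ := fun u v => if s(u, v) ∈ F2 then f v - f u else 0 with hg
  have gF1 : ∀ u v, u ∈ R → v ∈ R → adj2 u v → s(u, v) ∉ F1 → g u v = f v - f u := by
    intro u v hu hv huv hF
    by_cases h : s(u, v) ∈ F2
    · simp [hg, h]
    · have := hfe u v ⟨hu, hv, huv, by simp [hF, h]⟩
      simp [hg, h, this]
  obtain ⟨h, hH, hV⟩ := potential a b A B (fun i j => g (i, j) (i + 1, j)) (fun i j => g (i, j) (i, j + 1)) (by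
    intro i j hi hi' hj hj'
    rcases hsq (i, j) hi hi' hj hj' with hs | hs
    · have q1 := hs s((i, j), (i + 1, j)) (by simp [sqE])
      have q2 := hs s((i, j), (i, j + 1)) (by simp [sqE])
      have q3 := hs s((i + 1, j), (i + 1, j + 1)) (by simp [sqE])
      have q4 := hs s((i, j + 1), (i + 1, j + 1)) (by simp [sqE])
      rw [gF1 _ _ ?_ ?_ ?_ q1, gF1 _ _ ?_ ?_ ?_ q2, gF1 _ _ ?_ ?_ ?_ q3, gF1 _ _ ?_ ?_ ?_ q4]
      · ring
      all_goals first | (simp only [hR, mem_Rc]; omega) | (simp [adj2])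
    · have q1 := hs s((i, j), (i + 1, j)) (by simp [sqE])
      have q2 := hs s((i, j), (i, j + 1)) (by simp [sqE])
      have q3 := hs s((i + 1, j), (i + 1, j + 1)) (by simp [sqE])
      have q4 := hs s((i, j + 1), (i + 1, j + 1)) (by simp [sqE])
      simp [hg, q1, q2, q3, q4])
  have gs : ∀ u v, g v u = - g u v := by
    intro u v
    simp only [hg, Sym2.eq_swap (a := v) (b := u)]
    split_ifs <;> ring
  have hδ : ∀ u v, u ∈ R → v ∈ R → adj2 u v → h v.1 v.2 - h u.1 u.2 = g u v := by
    rintro ⟨u1, u2⟩ ⟨v1, v2⟩ hu hv huv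
    simp only [hR, mem_Rc] at hu hv
    simp only [adj2] at huv
    rcases huv with ⟨rfl, rfl | rfl⟩ | ⟨rfl, rfl | rfl⟩
    · exact hV _ _ hu.1 hu.2.1 hu.2.2.1 (by omega)
    · rw [gs, ← hV u1 v2 hu.1 hu.2.1 (by omega) (by omega)]; ring
    · exact hH _ _ (by omega) (by omega) (by omega) (by omega)
    · rw [gs, ← hH v1 u2 (by omega) (by omega) (by omega) (by omega)]; ring
  have c2 := rtg_const (fun u => h u.1 u.2) (fun u v huv => by
    have := hδ u v huv.1 huv.2.1 huv.2.2.1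
    have e : g u v = 0 := by simp [hg, huv.2.2.2]
    linarith) h2
  have c1 := rtg_const (fun u => f u - h u.1 u.2) (fun u v huv => by
    have := hδ u v huv.1 huv.2.1 huv.2.2.1
    have e := gF1 u v huv.1 huv.2.1 huv.2.2.1 huv.2.2.2
    linarith) h1
  have : f y = f x := by linarith
  have fx : f x = 1 := by simp [hf, Relation.ReflTransGen.refl]
  rw [fx] at this
  by_contra hcon
  simp [hf, hcon] at this

/-- Square adjacency of edges in the rectangle. -/
def SqA (a b A B : ℤ) (e e' : Sym2 (ℤ × ℤ)) : Prop :=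
  ∃ c : ℤ × ℤ, a ≤ c.1 ∧ c.1 < A ∧ b ≤ c.2 ∧ c.2 < B ∧ e ∈ sqE c ∧ e' ∈ sqE c

theorem SqA.symm {a b A B : ℤ} {e e' : Sym2 (ℤ × ℤ)} (h : SqA a b A B e e') : SqA a b A B e' e := by
  obtain ⟨c, h1, h2, h3, h4, h5, h6⟩ := h
  exact ⟨c, h1, h2, h3, h4, h6, h5⟩

theorem sep_component {a b A B : ℤ} (F : Finset (Sym2 (ℤ × ℤ))) {x y : ℤ × ℤ}
    (h : ¬ Relation.ReflTransGen (StF (Rc a b A B) (F : Set (Sym2 (ℤ × ℤ)))) x y) :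
    ∃ K : Finset (Sym2 (ℤ × ℤ)), K ⊆ F ∧ ¬ Relation.ReflTransGen (StF (Rc a b A B) (K : Set (Sym2 (ℤ × ℤ)))) x y ∧
      ∀ e ∈ K, ∀ e' ∈ K, Relation.ReflTransGen (fun u v => u ∈ K ∧ v ∈ K ∧ SqA a b A B u v) e e' := by
  classical
  induction hn : F.card using Nat.strong_induction_on generalizing F with
  | _ n ih =>
    by_cases hall : ∀ e ∈ F, ∀ e' ∈ F, Relation.ReflTransGen (fun u v => u ∈ F ∧ v ∈ F ∧ SqA a b A B u v) e e'
    · exact ⟨F, le_rfl, h, hall⟩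
    · push Not at hall
      obtain ⟨e, he, e', he', hne⟩ := hall
      set r : Sym2 (ℤ × ℤ) → Sym2 (ℤ × ℤ) → Prop := fun u v => u ∈ F ∧ v ∈ F ∧ SqA a b A B u v with hr
      set K1 := F.filter (fun u => Relation.ReflTransGen r e u) with hK1
      set K2 := F.filter (fun u => ¬ Relation.ReflTransGen r e u) with hK2
      have hu : (K1 : Set (Sym2 (ℤ × ℤ))) ∪ K2 = F := by
        rw [← Finset.coe_union, Finset.filter_union_filter_not_eq]
      have c1 : K1.card < n := by
        rw [← hn]
        refine Finset.card_lt_card (Finset.filter_ssubset.2 ⟨e', he', hne⟩)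
      have c2 : K2.card < n := by
        rw [← hn]
        refine Finset.card_lt_card (Finset.filter_ssubset.2 ⟨e, he, ?_⟩)
        simp [Relation.ReflTransGen.refl]
      by_cases s1 : Relation.ReflTransGen (StF (Rc a b A B) (K1 : Set (Sym2 (ℤ × ℤ)))) x y
      · by_cases s2 : Relation.ReflTransGen (StF (Rc a b A B) (K2 : Set (Sym2 (ℤ × ℤ)))) x y
        · exfalso
          apply h
          rw [← hu]
          refine planar_two_cuts _ _ ?_ s1 s2
          intro c h1 h2 h3 h4
          by_contra hcon
          push Not at hcon
          obtain ⟨⟨u, hu1, hu2⟩, ⟨v, hv1, hv2⟩⟩ := hcon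
          have hu2' := Finset.mem_filter.1 (Finset.mem_coe.1 hu2)
          have hv2' := Finset.mem_filter.1 (Finset.mem_coe.1 hv2)
          exact hv2'.2 (hu2'.2.tail ⟨hu2'.1, hv2'.1, c, h1, h2, h3, h4, hu1, hv1⟩)
        · obtain ⟨K, k1, k2, k3⟩ := ih _ c2 K2 s2 rfl
          exact ⟨K, k1.trans (Finset.filter_subset _ _), k2, k3⟩
      · obtain ⟨K, k1, k2, k3⟩ := ih _ c1 K1 s1 rfl
        exact ⟨K, k1.trans (Finset.filter_subset _ _), k2, k3⟩

end Planar

section Peierls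
open Relation

def star2 (u v : ℤ × ℤ) : Prop := (u.1 ≤ v.1 + 1 ∧ v.1 ≤ u.1 + 1) ∧ u.2 ≤ v.2 + 1 ∧ v.2 ≤ u.2 + 1

/-- sup-distance at least `r` -/
def far2 (w v : ℤ × ℤ) (r : ℕ) : Prop :=
  w.1 + r ≤ v.1 ∨ v.1 + r ≤ w.1 ∨ w.2 + r ≤ v.2 ∨ v.2 + r ≤ w.2

def CStp (t : Set (ℤ × ℤ)) (R : Set (ℤ × ℤ)) (u v : ℤ × ℤ) : Prop :=
  (u ∈ R ∧ u ∉ t) ∧ (v ∈ R ∧ v ∉ t) ∧ star2 u v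

def SArm (t : Set (ℤ × ℤ)) (R : Set (ℤ × ℤ)) (w : ℤ × ℤ) (r : ℕ) : Prop :=
  w ∈ R ∧ w ∉ t ∧ ∃ v, ReflTransGen (CStp t R) w v ∧ far2 w v r

lemma SArm_local {t R R' : Set (ℤ × ℤ)} (h : R ⊆ R') {w : ℤ × ℤ} {r : ℕ} :
    SArm t R w r ↔ SArm (t ∩ R') R w r := by
  have e : ∀ u, (u ∈ R ∧ u ∉ t) ↔ (u ∈ R ∧ u ∉ t ∩ R') := fun u =>
    ⟨fun h' => ⟨h'.1, fun h2 => h'.2 h2.1⟩, fun h' => ⟨h'.1, fun h2 => h'.2 ⟨h2, h h'.1⟩⟩⟩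
  have : CStp t R = CStp (t ∩ R') R := by
    funext u v
    simp only [CStp]
    rw [e u, e v]
  unfold SArm
  rw [this, ← and_assoc, ← and_assoc, e w]

theorem SArm_bound {η : ℝ} (h0 : 0 ≤ η) (h1 : η ≤ 1) (r : ℕ) :
    ∀ (U R : Finset (ℤ × ℤ)) (_ : R ⊆ U) (w : ℤ × ℤ),
      Pr (fun _ => 1 - η) U (fun t => SArm t R w r) ≤ 9 ^ r * η ^ (r + 1) := by
  classical
  have hW : IsW (fun _ : ℤ × ℤ => 1 - η) := isW_const (by linarith) (by linarith)
  have hcl : ∀ (U : Finset (ℤ × ℤ)) (w : ℤ × ℤ), w ∈ U → Pr (fun _ => 1 - η) U (fun t => w ∉ t) = η := by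
    intro U w hw
    have := Pr_none (p := fun _ : ℤ × ℤ => 1 - η) (s := U) {w} (by simpa using hw)
    simpa using this
  induction r with
  | zero =>
    intro U R hR w
    by_cases hw : w ∈ R
    · rw [pow_zero, one_mul, zero_add, pow_one]
      calc _ ≤ Pr (fun _ => 1 - η) U (fun t => w ∉ t) := Pr_mono hW fun t _ h => h.2.1
        _ = η := hcl U w (hR hw)
    · rw [Pr_false (fun t _ h => hw h.1)]
      simpa using h0
  | succ r ih =>
    intro U R hR w
    by_cases hw : w ∈ R
    swap
    · rw [Pr_false (fun t _ h => hw h.1)]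
      positivity
    set nb : Finset (ℤ × ℤ) := Finset.Icc (w.1 - 1) (w.1 + 1) ×ˢ Finset.Icc (w.2 - 1) (w.2 + 1) with hnb
    have hnbc : nb.card = 9 := by
      rw [hnb, Finset.card_product, Int.card_Icc, Int.card_Icc]
      have e1 : (w.1 + 1 + 1 - (w.1 - 1)).toNat = 3 := by omega
      have e2 : (w.2 + 1 + 1 - (w.2 - 1)).toNat = 3 := by omega
      rw [e1, e2]
    have step : Pr (fun _ => 1 - η) U (fun t => SArm t R w (r + 1)) ≤
        ∑ w' ∈ nb, Pr (fun _ => 1 - η) U (fun t => w ∉ t ∧ SArm t (R.erase w : Finset (ℤ × ℤ)) w' r) := by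
      refine Pr_union_le hW nb _ ?_
      rintro t _ ⟨_, hwt, v, hv, hf⟩
      have hvw : v ≠ w := by
        rintro rfl
        unfold far2 at hf; push_cast at hf; omega
      obtain ⟨c, e, _, hc, hce, he, hev⟩ := last_exit (P := fun u => u = w) hv rfl hvw
      subst hc
      have hst := hce.2.2
      refine ⟨e, ?_, hwt, ?_, hce.2.1.2, v, ?_, ?_⟩
      · unfold star2 at hst
        rw [hnb, Finset.mem_product, Finset.mem_Icc, Finset.mem_Icc]; omega
      · rw [Finset.mem_coe, Finset.mem_erase]; exact ⟨he, hce.2.1.1⟩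
      · refine rtg_mono ?_ hev
        rintro x y ⟨hx, hy, h⟩
        exact ⟨⟨by rw [Finset.mem_coe, Finset.mem_erase]; exact ⟨hx, h.1.1⟩, h.1.2⟩,
          ⟨by rw [Finset.mem_coe, Finset.mem_erase]; exact ⟨hy, h.2.1.1⟩, h.2.1.2⟩, h.2.2⟩
      · unfold far2 star2 at *; push_cast at hf; omega
    refine step.trans ?_
    have each : ∀ w' ∈ nb, Pr (fun _ => 1 - η) U (fun t => w ∉ t ∧ SArm t (R.erase w : Finset (ℤ × ℤ)) w' r) ≤
        η * (9 ^ r * η ^ (r + 1)) := by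
      intro w' _
      rw [Pr_indep (s1 := {w}) (s2 := R.erase w) (A := fun t => w ∉ t)
        (B := fun t => SArm t (R.erase w : Finset (ℤ × ℤ)) w' r) (by simpa using hR hw)
        ((Finset.erase_subset _ _).trans hR) (by simp) (fun t _ => by simp)
        (fun t _ => SArm_local (le_refl _))]
      rw [hcl {w} w (by simp)]
      exact mul_le_mul_of_nonneg_left (ih _ _ le_rfl w') h0
    refine (Finset.sum_le_card_nsmul _ _ _ each).trans (le_of_eq ?_)
    rw [hnbc, nsmul_eq_mul]
    push_cast
    ring

lemma hline {R : Set (ℤ × ℤ)} {F : Set (Sym2 (ℤ × ℤ))} {y s s' : ℤ} (hs : s ≤ s')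
    (h : ∀ k, s ≤ k → k < s' → StF R F (k, y) (k + 1, y)) : ReflTransGen (StF R F) (s, y) (s', y) := by
  induction s', hs using Int.leInduction with
  | base => exact ReflTransGen.refl
  | succ n hn ih => exact (ih fun k h1 h2 => h k h1 (by omega)).tail (h n hn (by omega))

lemma vline {R : Set (ℤ × ℤ)} {F : Set (Sym2 (ℤ × ℤ))} {y s s' : ℤ} (hs : s ≤ s')
    (h : ∀ k, s ≤ k → k < s' → StF R F (y, k) (y, k + 1)) : ReflTransGen (StF R F) (y, s) (y, s') := by
  induction s', hs using Int.leInduction with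
  | base => exact ReflTransGen.refl
  | succ n hn ih => exact (ih fun k h1 h2 => h k h1 (by omega)).tail (h n hn (by omega))

lemma StF_symm_rtg {R : Set (ℤ × ℤ)} {F : Set (Sym2 (ℤ × ℤ))} {x y : ℤ × ℤ}
    (h : ReflTransGen (StF R F) x y) : ReflTransGen (StF R F) y x := rtg_symm (fun _ _ => StF.symm) h

lemma sq_vertex {c : ℤ × ℤ} {e : Sym2 (ℤ × ℤ)} (he : e ∈ sqE c) {p : ℤ × ℤ} (hp : p ∈ e) :
    c.1 ≤ p.1 ∧ p.1 ≤ c.1 + 1 ∧ c.2 ≤ p.2 ∧ p.2 ≤ c.2 + 1 := by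
  rcases he with rfl | rfl | rfl | rfl <;> rw [Sym2.mem_iff] at hp <;>
    rcases hp with rfl | rfl <;> simp

/-- Deterministic part of the Peierls argument. -/
theorem peierls_det {a b A B y x z : ℤ} {M : ℕ} (hx : a ≤ x) (hxz : x < z) (hz : z ≤ A) (hy : b ≤ y) (hy' : y ≤ B)
    (hM : 2 * (M : ℤ) + 2 ≤ B - b) (U : Finset (ℤ × ℤ)) (hU : ∀ v, v ∈ U ↔ v ∈ Rc a b A B)
    (t : Set (ℤ × ℤ)) (hn : ¬ Reach2 (t ∪ {(x, y)}) (x, y) (z, y)) :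
    ∃ τ : ℕ, 1 ≤ τ ∧ x + τ ≤ z ∧
      SArm t (U.erase (x, y) : Finset (ℤ × ℤ)) (x + τ, y) (min (min τ ((z - x).toNat - τ)) M) := by
  classical
  set R := (U.erase (x, y) : Finset (ℤ × ℤ)) with hR
  have hmR : ∀ v, v ∈ R ↔ v ≠ (x, y) ∧ v ∈ Rc a b A B := fun v => by rw [hR, Finset.mem_erase, hU]
  set F : Finset (Sym2 (ℤ × ℤ)) := U.sym2.filter
    (fun e => (∃ v ∈ e, v ∈ R ∧ v ∉ t) ∧ ∃ u v, e = s(u, v) ∧ adj2 u v) with hF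
  have hsep : ¬ ReflTransGen (StF (Rc a b A B) (F : Set (Sym2 (ℤ × ℤ)))) (x, y) (z, y) := by
    intro h
    apply hn
    refine rtg_mono ?_ h
    rintro u v ⟨hu, hv, huv, hF'⟩
    have key : ∀ w, w = u ∨ w = v → w ∈ t ∪ {(x, y)} := by
      intro w hw
      by_contra hcon
      simp only [Set.union_singleton, Set.mem_insert_iff, not_or] at hcon
      apply hF'
      rw [Finset.mem_coe, hF, Finset.mem_filter, Finset.mk_mem_sym2_iff, hU, hU]
      refine ⟨⟨hu, hv⟩, ⟨w, Sym2.mem_iff.2 hw, (hmR w).2 ⟨hcon.1, ?_⟩, hcon.2⟩, u, v, rfl, huv⟩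
      rcases hw with rfl | rfl <;> assumption
    exact ⟨key u (Or.inl rfl), key v (Or.inr rfl), huv⟩
  obtain ⟨K, hKF, hKs, hKc⟩ := sep_component F hsep
  have hKcl : ∀ e ∈ K, ∃ v ∈ e, v ∈ R ∧ v ∉ t := fun e he => (Finset.mem_filter.1 (hKF he)).2.1
  -- star connectedness
  have hstar : ∀ e ∈ K, ∀ e' ∈ K, ∀ p ∈ e, p ∈ R → p ∉ t → ∀ p' ∈ e', p' ∈ R → p' ∉ t →
      ReflTransGen (CStp t R) p p' := by
    intro e he e' he' p hp hpR hpt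
    have := hKc e he e' he'
    induction this with
    | refl =>
      intro p' hp' hpR' hpt'
      obtain ⟨u, v, huv, hadj⟩ := (Finset.mem_filter.1 (hKF he)).2.2
      rw [huv, Sym2.mem_iff] at hp hp'
      refine ReflTransGen.single ⟨⟨hpR, hpt⟩, ⟨hpR', hpt'⟩, ?_⟩
      unfold adj2 at hadj
      unfold star2
      rcases hp with rfl | rfl <;> rcases hp' with rfl | rfl <;> omega
    | tail _ h2 ih =>
      intro p'' hp'' hpR'' hpt''
      obtain ⟨p', hp', hpR', hpt'⟩ := hKcl _ h2.1
      refine (ih h2.1 p' hp' hpR' hpt').tail ⟨⟨hpR', hpt'⟩, ⟨hpR'', hpt''⟩, ?_⟩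
      obtain ⟨c, _, _, _, _, h5, h6⟩ := h2.2.2
      have q1 := sq_vertex h5 hp'
      have q2 := sq_vertex h6 hp''
      unfold star2; omega
  -- a closed site on the row
  obtain ⟨k, hk1, hk2, hkK⟩ : ∃ k, x ≤ k ∧ k < z ∧ s((k, y), (k + 1, y)) ∈ K := by
    by_contra hcon
    push Not at hcon
    refine hKs (hline hxz.le fun k h1 h2 => ⟨?_, ?_, ?_, fun h => hcon k h1 h2 (Finset.mem_coe.1 h)⟩)
    · simp only [mem_Rc]; omega
    · simp only [mem_Rc]; omega
    · simp [adj2]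
  obtain ⟨w, hwe, hwR, hwt⟩ := hKcl _ hkK
  have hw2 : w.2 = y ∧ x < w.1 ∧ w.1 ≤ z := by
    have h3 := ((hmR w).1 hwR).1
    rw [Sym2.mem_iff] at hwe
    rcases hwe with rfl | rfl
    · refine ⟨rfl, ?_, ?_⟩ <;> simp only
      · rcases hk1.eq_or_lt with h | h
        · subst h; exact absurd rfl h3
        · exact h
      · omega
    · exact ⟨rfl, by simp only; omega, by simp only; omega⟩
  obtain ⟨w1, w2⟩ := w
  obtain ⟨rfl, hw3, hw4⟩ := hw2
  simp only at *
  set τ := (w1 - x).toNat with hτ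
  have hwτ : w1 = x + τ := by omega
  set r := min (min τ ((z - x).toNat - τ)) M with hr
  have hr1 : r ≤ τ := by omega
  have hr2 : (r : ℤ) ≤ z - w1 := by omega
  have hr3 : r ≤ M := by omega
  refine ⟨τ, by omega, by omega, ?_⟩
  rw [← hwτ]
  refine ⟨hwR, hwt, ?_⟩
  by_contra hcon
  push Not at hcon
  have hav : ∀ u v, adj2 u v → u ∈ Rc a b A B → v ∈ Rc a b A B → far2 (w1, w2) u r → far2 (w1, w2) v r →
      StF (Rc a b A B) (K : Set (Sym2 (ℤ × ℤ))) u v := by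
    intro u v huv hu hv fu fv
    refine ⟨hu, hv, huv, fun h => ?_⟩
    obtain ⟨p, hp, hpR, hpt⟩ := hKcl _ h
    refine hcon p (hstar _ hkK _ h _ hwe hwR hwt p hp hpR hpt) ?_
    rw [Sym2.mem_iff] at hp
    rcases hp with rfl | rfl <;> assumption
  apply hKs
  -- detour height
  have g1 : ReflTransGen (StF (Rc a b A B) (K : Set (Sym2 (ℤ × ℤ)))) (x, w2) (w1 - r, w2) := by
    refine hline (by omega) fun k h1 h2 => hav _ _ (by simp [adj2]) ?_ ?_ ?_ ?_
    · simp only [mem_Rc]; omega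
    · simp only [mem_Rc]; omega
    · simp only [far2]; omega
    · simp only [far2]; omega
  have g5 : ReflTransGen (StF (Rc a b A B) (K : Set (Sym2 (ℤ × ℤ)))) (w1 + r, w2) (z, w2) := by
    refine hline (by omega) fun k h1 h2 => hav _ _ (by simp [adj2]) ?_ ?_ ?_ ?_
    · simp only [mem_Rc]; omega
    · simp only [mem_Rc]; omega
    · simp only [far2]; omega
    · simp only [far2]; omega
  refine (g1.trans ?_).trans g5
  by_cases hup : w2 + r ≤ B
  · have g2 : ReflTransGen (StF (Rc a b A B) (K : Set (Sym2 (ℤ × ℤ)))) (w1 - r, w2) (w1 - r, w2 + r) := by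
      refine vline (by omega) fun k h1 h2 => hav _ _ (by simp [adj2]) ?_ ?_ ?_ ?_
      · simp only [mem_Rc]; omega
      · simp only [mem_Rc]; omega
      · simp only [far2]; omega
      · simp only [far2]; omega
    have g3 : ReflTransGen (StF (Rc a b A B) (K : Set (Sym2 (ℤ × ℤ)))) (w1 - r, w2 + r) (w1 + r, w2 + r) := by
      refine hline (by omega) fun k h1 h2 => hav _ _ (by simp [adj2]) ?_ ?_ ?_ ?_
      · simp only [mem_Rc]; omega
      · simp only [mem_Rc]; omega
      · simp only [far2]; omega
      · simp only [far2]; omega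
    have g4 : ReflTransGen (StF (Rc a b A B) (K : Set (Sym2 (ℤ × ℤ)))) (w1 + r, w2) (w1 + r, w2 + r) := by
      refine vline (by omega) fun k h1 h2 => hav _ _ (by simp [adj2]) ?_ ?_ ?_ ?_
      · simp only [mem_Rc]; omega
      · simp only [mem_Rc]; omega
      · simp only [far2]; omega
      · simp only [far2]; omega
    exact (g2.trans g3).trans (StF_symm_rtg g4)
  · have g2 : ReflTransGen (StF (Rc a b A B) (K : Set (Sym2 (ℤ × ℤ)))) (w1 - r, w2 - r) (w1 - r, w2) := by
      refine vline (by omega) fun k h1 h2 => hav _ _ (by simp [adj2]) ?_ ?_ ?_ ?_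
      · simp only [mem_Rc]; omega
      · simp only [mem_Rc]; omega
      · simp only [far2]; omega
      · simp only [far2]; omega
    have g3 : ReflTransGen (StF (Rc a b A B) (K : Set (Sym2 (ℤ × ℤ)))) (w1 - r, w2 - r) (w1 + r, w2 - r) := by
      refine hline (by omega) fun k h1 h2 => hav _ _ (by simp [adj2]) ?_ ?_ ?_ ?_
      · simp only [mem_Rc]; omega
      · simp only [mem_Rc]; omega
      · simp only [far2]; omega
      · simp only [far2]; omega
    have g4 : ReflTransGen (StF (Rc a b A B) (K : Set (Sym2 (ℤ × ℤ)))) (w1 + r, w2 - r) (w1 + r, w2) := by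
      refine vline (by omega) fun k h1 h2 => hav _ _ (by simp [adj2]) ?_ ?_ ?_ ?_
      · simp only [mem_Rc]; omega
      · simp only [mem_Rc]; omega
      · simp only [far2]; omega
      · simp only [far2]; omega
    exact ((StF_symm_rtg g2).trans g3).trans g4

lemma peierls_sum (D M : ℕ) (hD : D ≤ 2 ^ M) :
    ∑ τ ∈ Finset.Icc 1 D, (9 : ℝ) ^ (min (min τ (D - τ)) M) * (1 / 100 : ℝ) ^ (min (min τ (D - τ)) M + 1) ≤ 1 / 2 := by
  have hq : ∀ τ ∈ Finset.Icc 1 D, (9 : ℝ) ^ (min (min τ (D - τ)) M) * (1 / 100 : ℝ) ^ (min (min τ (D - τ)) M + 1) ≤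
      1 / 100 * ((1 / 2 : ℝ) ^ τ + (1 / 2 : ℝ) ^ (D - τ) + (1 / 2 : ℝ) ^ M) := by
    intro τ _
    have e : (9 : ℝ) ^ (min (min τ (D - τ)) M) * (1 / 100 : ℝ) ^ (min (min τ (D - τ)) M + 1) =
        1 / 100 * (9 / 100 : ℝ) ^ (min (min τ (D - τ)) M) := by
      rw [pow_succ, ← mul_assoc, ← mul_pow]; norm_num; ring
    rw [e]
    refine mul_le_mul_of_nonneg_left ?_ (by norm_num)
    refine (pow_le_pow_left₀ (by norm_num) (show (9 / 100 : ℝ) ≤ 1 / 2 by norm_num) _).trans ?_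
    have p1 : (0 : ℝ) ≤ (1 / 2) ^ τ := by positivity
    have p2 : (0 : ℝ) ≤ (1 / 2) ^ (D - τ) := by positivity
    have p3 : (0 : ℝ) ≤ (1 / 2) ^ M := by positivity
    rcases min_choice (min τ (D - τ)) M with h | h
    · rcases min_choice τ (D - τ) with h' | h'
      · rw [h, h']; linarith
      · rw [h, h']; linarith
    · rw [h]; linarith
  refine (Finset.sum_le_sum hq).trans ?_
  rw [← Finset.mul_sum, Finset.sum_add_distrib, Finset.sum_add_distrib, Finset.sum_const, Nat.card_Icc, nsmul_eq_mul]
  have hgeo : ∀ n : ℕ, ∑ i ∈ Finset.range n, (1 / 2 : ℝ) ^ i ≤ 2 := fun n => sum_geometric_two_le n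
  have s1 : ∑ τ ∈ Finset.Icc 1 D, (1 / 2 : ℝ) ^ τ ≤ 2 := by
    refine le_trans (Finset.sum_le_sum_of_subset_of_nonneg (t := Finset.range (D + 1)) ?_ ?_) (hgeo _)
    · intro i hi; rw [Finset.mem_Icc] at hi; rw [Finset.mem_range]; omega
    · intros; positivity
  have s2 : ∑ τ ∈ Finset.Icc 1 D, (1 / 2 : ℝ) ^ (D - τ) ≤ 2 := by
    rw [← Finset.sum_image (f := fun i => (1 / 2 : ℝ) ^ i) (g := fun τ => D - τ)]
    · refine le_trans (Finset.sum_le_sum_of_subset_of_nonneg (t := Finset.range (D + 1)) ?_ ?_) (hgeo _)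
      · intro i hi
        obtain ⟨j, hj, rfl⟩ := Finset.mem_image.1 hi
        rw [Finset.mem_range]; omega
      · intros; positivity
    · intro i hi j hj hij
      rw [Finset.mem_coe, Finset.mem_Icc] at hi hj
      simp only at hij; omega
  have s3 : ((D + 1 - 1 : ℕ) : ℝ) * (1 / 2) ^ M ≤ 1 := by
    rw [Nat.add_sub_cancel, one_div, inv_pow]
    rw [mul_inv_le_iff₀ (by positivity), one_mul]
    exact_mod_cast hD
  linarith

theorem peierls {a b A B y x z : ℤ} {M : ℕ} (hx : a ≤ x) (hxz : x ≤ z) (hz : z ≤ A) (hy : b ≤ y) (hy' : y ≤ B)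
    (hM : 2 * (M : ℤ) + 2 ≤ B - b) (hD : z - x ≤ 2 ^ M) (U : Finset (ℤ × ℤ)) (hU : ∀ v, v ∈ U ↔ v ∈ Rc a b A B) :
    1 / 2 ≤ Pr (fun _ => 1 - (1 / 100 : ℝ)) U (fun t => Reach2 (t ∪ {(x, y)}) (x, y) (z, y)) := by
  have hW : IsW (fun _ : ℤ × ℤ => 1 - (1 / 100 : ℝ)) := isW_const (by norm_num) (by norm_num)
  rcases hxz.eq_or_lt with rfl | hxz
  · rw [Pr_true (A := fun t => Reach2 (t ∪ {(x, y)}) (x, y) (x, y)) (fun t _ => ReflTransGen.refl)]; norm_num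
  have h1 := Pr_not (p := fun _ : ℤ × ℤ => 1 - (1 / 100 : ℝ)) (s := U)
    (A := fun t => Reach2 (t ∪ {(x, y)}) (x, y) (z, y))
  have h2 : Pr (fun _ => 1 - (1 / 100 : ℝ)) U (fun t => ¬ Reach2 (t ∪ {(x, y)}) (x, y) (z, y)) ≤
      ∑ τ ∈ Finset.Icc 1 (z - x).toNat, Pr (fun _ => 1 - (1 / 100 : ℝ)) U (fun t =>
        SArm t (U.erase (x, y) : Finset (ℤ × ℤ)) (x + τ, y) (min (min τ ((z - x).toNat - τ)) M)) := by
    refine Pr_union_le hW _ _ fun t _ ht => ?_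
    obtain ⟨τ, k1, k2, k3⟩ := peierls_det hx hxz hz hy hy' hM U hU t ht
    exact ⟨τ, Finset.mem_Icc.2 ⟨k1, by omega⟩, k3⟩
  have h3 := h2.trans (Finset.sum_le_sum fun τ _ =>
    SArm_bound (η := 1 / 100) (by norm_num) (by norm_num) (min (min τ ((z - x).toNat - τ)) M) U
      (U.erase (x, y)) (Finset.erase_subset _ _) (x + τ, y))
  have h4 := h3.trans (peierls_sum (z - x).toNat M (by
    have : ((z - x).toNat : ℤ) ≤ ((2 ^ M : ℕ) : ℤ) := by push_cast; omega
    exact_mod_cast this))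
  linarith

end Peierls

section MCL
variable {d : ℕ}

/-- macroscopic coordinate of a point of an interval -/
def mco (n lo hi u : ℤ) : ℤ := max 0 (min ((hi - lo - 6 * n) / n) ((u - lo - 3 * n) / n))

lemma mco_spec {n lo hi u : ℤ} (hn : 0 < n) (h1 : lo ≤ u) (h2 : u ≤ hi) (h3 : 6 * n ≤ hi - lo) :
    0 ≤ mco n lo hi u ∧ mco n lo hi u ≤ (hi - lo - 6 * n) / n ∧
      lo + 3 * n + n * mco n lo hi u ≤ hi - 3 * n ∧
      u - 4 * n ≤ lo + 3 * n + n * mco n lo hi u ∧ lo + 3 * n + n * mco n lo hi u ≤ u + 4 * n := by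
  have hA : 0 ≤ (hi - lo - 6 * n) / n := Int.ediv_nonneg (by linarith) hn.le
  have a1 := Int.ediv_mul_le (hi - lo - 6 * n) hn.ne'
  have a2 := Int.lt_ediv_add_one_mul_self (hi - lo - 6 * n) hn
  have b1 := Int.ediv_mul_le (u - lo - 3 * n) hn.ne'
  have b2 := Int.lt_ediv_add_one_mul_self (u - lo - 3 * n) hn
  unfold mco
  set A := (hi - lo - 6 * n) / n
  set s := (u - lo - 3 * n) / n
  refine ⟨le_max_left _ _, max_le hA (min_le_left _ _), ?_⟩
  rcases le_total A s with h | h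
  · rw [min_eq_left h, max_eq_right hA]
    have : A * n ≤ s * n := mul_le_mul_of_nonneg_right h hn.le
    refine ⟨by linarith, by linarith, by linarith⟩
  · rw [min_eq_right h]
    have : s * n ≤ A * n := mul_le_mul_of_nonneg_right h hn.le
    rcases le_total 0 s with h' | h'
    · rw [max_eq_right h']
      refine ⟨by linarith, by linarith, by linarith⟩
    · rw [max_eq_left h']
      have h'' : s * n ≤ 0 := mul_nonpos_of_nonpos_of_nonneg h' hn.le
      refine ⟨by linarith, by linarith, by linarith⟩

lemma mco_mono {n lo hi u v : ℤ} (hn : 0 < n) (h : u ≤ v) : mco n lo hi u ≤ mco n lo hi v := by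
  unfold mco
  exact max_le_max le_rfl (min_le_min le_rfl (Int.ediv_le_ediv hn (by linarith)))

lemma exp_beats (T : ℕ) : ∃ M0 : ℕ, ∀ M, M0 ≤ M → T * (2 * M + 12) ≤ 2 ^ M := by
  refine ⟨14 * T + 4, fun M hM => ?_⟩
  have h1 : M * M ≤ 2 ^ M := by
    have h4 : 4 ≤ M := by omega
    clear hM
    induction M, h4 using Nat.le_induction with
    | base => norm_num
    | succ k hk ih => rw [pow_succ]; nlinarith
  refine le_trans ?_ h1
  nlinarith

lemma Pr_open_ge {ι : Type*} {p : ℝ} (h0 : 0 ≤ p) (h1 : p ≤ 1) {s u : Finset ι} (hu : u ⊆ s) {k : ℕ} (hk : u.card ≤ k) :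
    p ^ k ≤ Pr (fun _ => p) s (fun t => ↑u ⊆ t) := by
  rw [Pr_all u hu, Finset.prod_const]
  exact pow_le_pow_of_le_one h0 h1 hk

lemma card_Ed_le {S : Finset (V d)} {k : ℕ} (h : S.card ≤ k) : (Ed S).card ≤ (k + 1).choose 2 := by
  refine (Finset.card_filter_le _ _).trans ?_
  rw [Finset.card_sym2]
  exact Nat.choose_le_choose 2 (by omega)

set_option maxHeartbeats 1600000 in
theorem mcl_aux {p1 p0 : ℝ} (h0 : 0 ≤ p1) (h1 : p1 < p0) (hp0 : p0 ≤ 1) {θ : ℝ} (hθ : 0 < θ)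
    (hth : ∀ n, θ ≤ th d p1 n) (hd : 0 < d) :
    ∃ δ : ℝ, 0 < δ ∧ ∀ T : ℕ, ∃ L0 : ℕ, ∀ (lo hi : V d), (∀ l, (L0 : ℤ) ≤ hi l - lo l) → ∀ i j, i ≠ j →
      hi i - lo i ≤ T * (hi j - lo j) → ∀ G : Finset (V d), (∀ x, x ∈ G ↔ ∀ l, lo l ≤ x l ∧ x l ≤ hi l) →
      ∀ u ∈ G, ∀ v ∈ G, (∀ l, l ≠ i → u l = v l) → u i ≤ v i → δ ≤ PrE p0 G (fun t => Cn t G u v) := by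
  classical
  obtain ⟨n, hn, hmac⟩ := macro_perc hd h0 h1 hp0 hθ hth (η := 1 / 100) (by norm_num) (by norm_num)
  set k := ((Bx d (5 * n)).card + 1).choose 2 with hk
  have hp0' : 0 < p0 := by linarith
  refine ⟨p0 ^ (k + k) * (1 / 2), by positivity, fun T => ?_⟩
  obtain ⟨M0, hM0⟩ := exp_beats T
  refine ⟨n * (2 * M0 + 20), fun lo hi hL i j hij hT G hG u hu v hv huv hui => ?_⟩
  have hnZ : (0 : ℤ) < n := by exact_mod_cast hn
  have hL6 : ∀ l, 6 * (n : ℤ) ≤ hi l - lo l := by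
    intro l
    have := hL l
    push_cast at this
    have : (0 : ℤ) ≤ n * M0 := by positivity
    linarith
  have hu' := (hG u).1 hu
  have hv' := (hG v).1 hv
  -- center
  set c : V d := fun l => if l = i ∨ l = j then lo l + 3 * n else max (lo l + 3 * n) (min (hi l - 3 * n) (u l)) with hc
  set A : ℤ := (hi i - lo i - 6 * n) / n with hA
  set B : ℤ := (hi j - lo j - 6 * n) / n with hB
  set x1 := mco n (lo i) (hi i) (u i) with hx1
  set z1 := mco n (lo i) (hi i) (v i) with hz1
  set y := mco n (lo j) (hi j) (u j) with hy
  have sx := mco_spec hnZ (hu' i).1 (hu' i).2 (hL6 i)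
  have sz := mco_spec hnZ (hv' i).1 (hv' i).2 (hL6 i)
  have sy := mco_spec hnZ (hu' j).1 (hu' j).2 (hL6 j)
  have hxz : x1 ≤ z1 := mco_mono hnZ hui
  rw [← hx1, ← hA] at sx
  rw [← hz1, ← hA] at sz
  rw [← hy, ← hB] at sy
  set U : Finset (ℤ × ℤ) := Finset.Icc 0 A ×ˢ Finset.Icc 0 B with hU
  have hUm : ∀ v, v ∈ U ↔ v ∈ Rc 0 0 A B := by
    intro v
    rw [hU, Finset.mem_product, Finset.mem_Icc, Finset.mem_Icc, mem_Rc]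
    tauto
  have hci : ∀ s : ℤ × ℤ, ctr c i j n s i = lo i + 3 * n + n * s.1 := by
    intro s; simp [ctr, hc]
  have hcj : ∀ s : ℤ × ℤ, ctr c i j n s j = lo j + 3 * n + n * s.2 := by
    intro s; simp [ctr, hc, hij.symm]
  have hcl : ∀ (s : ℤ × ℤ) l, l ≠ i → l ≠ j → ctr c i j n s l = max (lo l + 3 * n) (min (hi l - 3 * n) (u l)) := by
    intro s l h1 h2; simp [ctr, hc, h1, h2]
  have a1 := Int.ediv_mul_le (hi i - lo i - 6 * n) hnZ.ne'
  have b1 := Int.ediv_mul_le (hi j - lo j - 6 * n) hnZ.ne'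
  rw [← hA] at a1
  rw [← hB] at b1
  have hUG : ∀ s ∈ U, Bl (ctr c i j n s) (3 * n) ⊆ G := by
    intro s hs w hw
    rw [hUm, mem_Rc] at hs
    rw [mem_Bl] at hw
    rw [hG]
    intro l
    have hwl := hw l
    push_cast at hwl
    have hs1 : n * s.1 ≤ A * n := by rw [mul_comm]; exact mul_le_mul_of_nonneg_right hs.2.1 hnZ.le
    have hs2 : n * s.2 ≤ B * n := by rw [mul_comm]; exact mul_le_mul_of_nonneg_right hs.2.2.2 hnZ.le
    have hs3 : 0 ≤ n * s.1 := mul_nonneg hnZ.le hs.1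
    have hs4 : 0 ≤ n * s.2 := mul_nonneg hnZ.le hs.2.2.1
    by_cases hli : l = i
    · subst hli
      rw [hci] at hwl
      constructor <;> linarith
    · by_cases hlj : l = j
      · subst hlj
        rw [hcj] at hwl
        constructor <;> linarith
      · rw [hcl s l hli hlj] at hwl
        have := hL6 l
        omega
  have hm := hmac i j hij c G (x1, y) (z1, y) U hUG
  have hD : z1 - x1 ≤ 2 ^ ((B - 2) / 2).toNat := by
    have b2 := Int.lt_ediv_add_one_mul_self (hi j - lo j - 6 * n) hnZ
    rw [← hB] at b2
    have hLj := hL j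
    push_cast at hLj
    have hBge : 2 * (M0 : ℤ) + 13 < B := by
      by_contra hcon
      push Not at hcon
      have : (B + 1) * n ≤ (2 * M0 + 14) * n := mul_le_mul_of_nonneg_right (by linarith) hnZ.le
      nlinarith
    set M := ((B - 2) / 2).toNat with hM
    have hMge : M0 ≤ M := by omega
    have hBM : B ≤ 2 * M + 4 := by omega
    have hA2 : A ≤ T * (B + 8) := by
      have hB0 : A * n ≤ (T * (B + 8)) * n := by
        have : (T : ℤ) * (hi j - lo j) ≤ T * ((B + 8) * n) :=
          mul_le_mul_of_nonneg_left (by nlinarith) (by positivity)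
        nlinarith
      exact le_of_mul_le_mul_right hB0 hnZ
    have h5 := hM0 M hMge
    have h6 : ((T * (2 * M + 12) : ℕ) : ℤ) ≤ 2 ^ M := by exact_mod_cast h5
    push_cast at h6
    have h7 : (T : ℤ) * (B + 8) ≤ T * (2 * M + 12) := mul_le_mul_of_nonneg_left (by linarith) (by positivity)
    linarith [sz.2.1, sx.1]
  have hB2 : (2 : ℤ) ≤ B := by
    have hLj := hL j
    push_cast at hLj
    rw [hB]
    refine (Int.le_ediv_iff_mul_le hnZ).2 ?_
    have : (0 : ℤ) ≤ n * M0 := by positivity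
    linarith
  have hpe := peierls (a := 0) (b := 0) (A := A) (B := B) (M := ((B - 2) / 2).toNat) sx.1 hxz sz.2.1 sy.1 sy.2.1
    (by omega) hD U hUm
  have hmac' := hpe.trans hm
  -- balls
  have near : ∀ (s : ℤ × ℤ) (w : V d), (w i - 4 * n ≤ lo i + 3 * n + n * s.1 ∧ lo i + 3 * n + n * s.1 ≤ w i + 4 * n) →
      s.2 = y → (∀ l, l ≠ i → u l = w l) → ∀ a ∈ Bl (ctr c i j n s) n, ∀ l, w l - 5 * n ≤ a l ∧ a l ≤ w l + 5 * n := by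
    intro s w hs hsy huw a ha l
    rw [mem_Bl] at ha
    have hal := ha l
    by_cases hli : l = i
    · subst hli
      rw [hci] at hal
      constructor <;> linarith [hs.1, hs.2]
    · have huwl := huw l hli
      by_cases hlj : l = j
      · subst hlj
        rw [hcj, hsy] at hal
        constructor <;> linarith [sy.2.2.2.1, sy.2.2.2.2]
      · rw [hcl s l hli hlj] at hal
        have := hu' l
        have := hL6 l
        omega
  have conn : ∀ (t : Set (Sym2 (V d))) (w : V d), w ∈ G → (Ed (Bl w (5 * n) ∩ G) : Set (Sym2 (V d))) ⊆ t →
      ∀ a ∈ G, (∀ l, w l - 5 * n ≤ a l ∧ a l ≤ w l + 5 * n) → Cn t G w a := by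
    intro t w hw ht a ha haw
    have hwG := (hG w).1 hw
    have haG := (hG a).1 ha
    have hbox : ∀ q : V d, (fun l => max (lo l) (w l - 5 * n)) ≤ q → q ≤ (fun l => min (hi l) (w l + 5 * n)) →
        q ∈ Bl w (5 * n) ∩ G := by
      intro q hq1 hq2
      rw [Finset.mem_inter, mem_Bl, hG]
      push_cast
      refine ⟨fun l => ?_, fun l => ?_⟩ <;>
      · have e1 := max_le_iff.1 (hq1 l)
        have e2 := le_min_iff.1 (hq2 l)
        exact ⟨by linarith [e1.1, e1.2], by linarith [e2.1, e2.2]⟩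
    refine Cn_box (lo := fun l => max (lo l) (w l - 5 * n)) (hi := fun l => min (hi l) (w l + 5 * n)) ?_ ?_ w a ?_ ?_ ?_ ?_
    · intro q hq1 hq2
      exact (Finset.mem_inter.1 (hbox q hq1 hq2)).2
    · intro q q' a1 a2 a3 a4 a5
      exact ht (Finset.mem_coe.2 (mem_Ed.2 ⟨hbox q a1 a2, hbox q' a3 a4, a5⟩))
    · intro l; exact max_le (hwG l).1 (by linarith)
    · intro l; exact le_min (hwG l).2 (by linarith)
    · intro l; exact max_le (haG l).1 (haw l).1
    · intro l; exact le_min (haG l).2 (haw l).2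
  set E1 := Ed (Bl u (5 * n) ∩ G) with hE1
  set E2 := Ed (Bl v (5 * n) ∩ G) with hE2
  have hcard : ∀ w : V d, (Ed (Bl w (5 * n) ∩ G)).card ≤ k := by
    intro w
    refine card_Ed_le ((Finset.card_le_card Finset.inter_subset_left).trans ?_)
    rw [Bl, Finset.card_map]
  have hE : E1 ∪ E2 ⊆ Ed G := Finset.union_subset (Ed_mono Finset.inter_subset_right) (Ed_mono Finset.inter_subset_right)
  have hop := Pr_open_ge hp0'.le hp0 hE (k := k + k)
    ((Finset.card_union_le _ _).trans (Nat.add_le_add (hcard u) (hcard v)))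
  have hW : IsW (fun _ : Sym2 (V d) => p0) := isW_const hp0'.le hp0
  unfold PrE at hmac' ⊢
  refine (mul_le_mul hop hmac' (by norm_num) (Pr_nonneg hW)).trans ((Pr_fkg hW ?_ ?_).trans ?_)
  · intro t t' htt h; exact h.trans htt
  · rintro t t' htt ⟨a, ha, w, hw, h⟩; exact ⟨a, ha, w, hw, h.mono htt le_rfl⟩
  · refine Pr_mono hW ?_
    rintro t _ ⟨ht, a, ha, w, hw, h⟩
    rw [Finset.coe_union, Set.union_subset_iff] at ht
    have hxU : ((x1, y) : ℤ × ℤ) ∈ U := (hUm _).2 ⟨sx.1, sx.2.1, sy.1, sy.2.1⟩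
    have hzU : ((z1, y) : ℤ × ℤ) ∈ U := (hUm _).2 ⟨sz.1, sz.2.1, sy.1, sy.2.1⟩
    have haG : a ∈ G := hUG _ hxU (Bl_sub (self_mem_Bl _ 0) (by omega) ha)
    have hwG : w ∈ G := hUG _ hzU (Bl_sub (self_mem_Bl _ 0) (by omega) hw)
    have c1 := conn t u hu ht.1 a haG (near (x1, y) u sx.2.2.2 rfl (fun _ _ => rfl) a ha)
    have c2 := conn t v hv ht.2 w hwG (near (z1, y) v sz.2.2.2 rfl huv w hw)
    exact (c1.trans h).trans c2.symm

theorem mcl {p1 p0 : ℝ} (h0 : 0 ≤ p1) (h1 : p1 < p0) (hp0 : p0 ≤ 1) {θ : ℝ} (hθ : 0 < θ)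
    (hth : ∀ n, θ ≤ th d p1 n) (hd : 0 < d) :
    ∃ δ : ℝ, 0 < δ ∧ ∀ T : ℕ, ∃ L0 : ℕ, ∀ (lo hi : V d), (∀ l, (L0 : ℤ) ≤ hi l - lo l) → ∀ i j, i ≠ j →
      hi i - lo i ≤ T * (hi j - lo j) → ∀ G : Finset (V d), (∀ x, x ∈ G ↔ ∀ l, lo l ≤ x l ∧ x l ≤ hi l) →
      ∀ u ∈ G, ∀ v ∈ G, (∀ l, l ≠ i → u l = v l) → ∀ p, p0 ≤ p → p ≤ 1 → δ ≤ PrE p G (fun t => Cn t G u v) := by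
  obtain ⟨δ, hδ, H⟩ := mcl_aux h0 h1 hp0 hθ hth hd
  refine ⟨δ, hδ, fun T => ?_⟩
  obtain ⟨L0, H⟩ := H T
  refine ⟨L0, fun lo hi hL i j hij hT G hG u hu v hv huv p hp hp' => ?_⟩
  have hpp : PrE p0 G (fun t => Cn t G u v) ≤ PrE p G (fun t => Cn t G u v) :=
    Pr_mono_p (isW_const (by linarith) hp0) (isW_const (by linarith) hp') (fun _ _ => hp) Cn_inc
  refine le_trans ?_ hpp
  rcases le_total (u i) (v i) with h | h
  · exact H lo hi hL i j hij hT G hG u hu v hv huv h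
  · refine (H lo hi hL i j hij hT G hG v hv u hu (fun l hl => (huv l hl).symm) h).trans (le_of_eq ?_)
    exact Pr_congr fun t _ => ⟨Cn.symm, Cn.symm⟩

end MCL

section Slab
variable {d : ℕ}
open Relation

lemma cond_fresh {ι κ : Type*} {p : ι → ℝ} (hp : IsW p) {s s1 s2 : Finset ι} (h1 : s1 ⊆ s) (h2 : s2 ⊆ s)
    (hd : Disjoint s1 s2) (A : Set ι → Prop) (X : Set ι → κ) (T : Finset κ) (link : κ → Set ι → Prop) (δ : ℝ)
    (hA : ∀ t, A t ↔ A (t ∩ s1)) (hX : ∀ t, X t = X (t ∩ s1)) (hT : ∀ t, A t → X t ∈ T)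
    (hl : ∀ c t, link c t ↔ link c (t ∩ s2)) (hδ : ∀ c ∈ T, δ ≤ Pr p s2 (link c)) :
    Pr p s (fun t => A t ∧ ¬ link (X t) t) ≤ (1 - δ) * Pr p s A := by
  classical
  have e1 : Pr p s (fun t => A t ∧ ¬ link (X t) t) ≤
      ∑ c ∈ T, Pr p s (fun t => (A t ∧ X t = c) ∧ ¬ link c t) :=
    Pr_union_le hp T _ fun t _ h => ⟨X t, hT t h.1, ⟨h.1, rfl⟩, h.2⟩
  have e2 : Pr p s A = ∑ c ∈ T, Pr p s (fun t => A t ∧ X t = c) := by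
    unfold Pr
    rw [← Ex_sum]
    refine Ex_congr fun t _ => ?_
    by_cases hAt : A t
    · rw [Finset.sum_eq_single (X t)]
      · rw [ind_pos hAt, ind_pos ⟨hAt, rfl⟩]
      · intro c _ hc
        exact ind_neg fun h => hc h.2.symm
      · intro h; exact absurd (hT t hAt) h
    · rw [ind_neg hAt, Finset.sum_eq_zero]
      intro c _
      exact ind_neg fun h => hAt h.1
  rw [e2, Finset.mul_sum]
  refine e1.trans (Finset.sum_le_sum fun c hc => ?_)
  have hloc : ∀ t : Set ι, t ⊆ s → ((A t ∧ X t = c) ↔ (A (t ∩ s1) ∧ X (t ∩ s1) = c)) := fun t _ => by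
    rw [← hA, ← hX]
  rw [Pr_indep (A := fun t => A t ∧ X t = c) (B := fun t => ¬ link c t) h1 h2 hd hloc
    (fun t _ => not_congr (hl c t)), Pr_not, Pr_local (A := fun t => A t ∧ X t = c) h1 hloc, mul_comm]
  refine mul_le_mul_of_nonneg_right ?_ (Pr_nonneg hp)
  linarith [hδ c hc]

/-- Connecting two arbitrary points of a box by hops along coordinates. -/
lemma hop_conn {p δ : ℝ} (h0 : 0 ≤ p) (h1 : p ≤ 1) (hδ0 : 0 ≤ δ) (hδ1 : δ ≤ 1) {lo hi : V d} {G : Finset (V d)}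
    (hG : ∀ x, x ∈ G ↔ ∀ l, lo l ≤ x l ∧ x l ≤ hi l)
    (H : ∀ i, ∀ u ∈ G, ∀ v ∈ G, (∀ l, l ≠ i → u l = v l) → δ ≤ PrE p G (fun t => Cn t G u v))
    {u v : V d} (hu : u ∈ G) (hv : v ∈ G) : δ ^ d ≤ PrE p G (fun t => Cn t G u v) := by
  classical
  have hW : IsW (fun _ : Sym2 (V d) => p) := isW_const h0 h1
  have main : ∀ (D : Finset (Fin d)) (v : V d), v ∈ G → (∀ l, l ∉ D → u l = v l) →
      δ ^ D.card ≤ PrE p G (fun t => Cn t G u v) := by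
    intro D
    induction D using Finset.induction_on with
    | empty =>
      intro v hv huv
      have : u = v := funext fun l => huv l (by simp)
      subst this
      unfold PrE
      rw [Pr_true (A := fun t => Cn t G u u) (fun t _ => Cn.refl _)]
      simp
    | insert i D hi ih =>
      intro v hv huv
      set v' : V d := Function.update v i (u i) with hv'
      have hv'G : v' ∈ G := by
        rw [hG]
        intro l
        by_cases hl : l = i
        · subst hl; rw [hv', Function.update_self]; exact (hG u).1 hu l
        · rw [hv', Function.update_of_ne hl]; exact (hG v).1 hv l
      have k1 := ih v' hv'G (by
        intro l hl
        by_cases hl' : l = i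
        · subst hl'; rw [hv', Function.update_self]
        · rw [hv', Function.update_of_ne hl']
          exact huv l (by simp [hl, hl']))
      have k2 := H i v' hv'G v hv (fun l hl => by rw [hv', Function.update_of_ne hl])
      rw [Finset.card_insert_of_notMem hi, pow_succ]
      unfold PrE at *
      refine (mul_le_mul k1 k2 hδ0 (Pr_nonneg hW)).trans ((Pr_fkg hW Cn_inc Cn_inc).trans ?_)
      exact Pr_mono hW fun t _ h => h.1.trans h.2
  have := main Finset.univ v hv (by simp)
  simpa using this

/-- `x` is connected to height `h` below height `h`. -/
def UpTo (G : Finset (V d)) (k : Fin d) (h : ℤ) (x : V d) (t : Set (Sym2 (V d))) : Prop :=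
  ∃ v, v k = h ∧ Cn t (G.filter (fun z => z k ≤ h) : Finset (V d)) x v

lemma adj_k {u v : V d} (h : dist1 u v = 1) (k : Fin d) : u k ≤ v k + 1 ∧ v k ≤ u k + 1 := by
  have := abs_le.1 (adj_abs h k)
  omega

lemma UpTo_of {G : Finset (V d)} {k : Fin d} {h : ℤ} {x w : V d} {t : Set (Sym2 (V d))} (S : Set (V d))
    (hS : S ⊆ G) (hc : Cn t S x w) (hx : x ∈ G) (hxk : x k ≤ h) (hw : h ≤ w k) : UpTo G k h x t := by
  classical
  by_cases hex : w k ≤ h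
  · by_cases hall : Cn t (G.filter (fun z => z k ≤ h) : Finset (V d)) x w
    · exact ⟨w, by omega, hall⟩
    · -- the path leaves the half space
      have key : ∀ b, Cn t S x b → UpTo G k h x t ∨ Cn t (G.filter (fun z => z k ≤ h) : Finset (V d)) x b := by
        intro b hb
        induction hb with
        | refl => right; exact Cn.refl _
        | tail _ h2 ih =>
          rename_i b c _
          rcases ih with ih | ih
          · left; exact ih
          · have hb := ih.mem (Finset.mem_coe.2 (Finset.mem_filter.2 ⟨hx, hxk⟩))
            have hb' := Finset.mem_filter.1 (Finset.mem_coe.1 hb)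
            by_cases hck : c k ≤ h
            · right
              refine ReflTransGen.tail ih ⟨hb, ?_, h2.2.2⟩
              exact Finset.mem_coe.2 (Finset.mem_filter.2 ⟨hS h2.2.1, hck⟩)
            · left
              refine ⟨b, ?_, ih⟩
              have := (adj_k h2.2.2.1 k).2
              omega
      rcases key w hc with h' | h'
      · exact h'
      · exact absurd h' hall
  · obtain ⟨c, e, h1, h2, h3, h4, h5⟩ := first_exit (P := fun z => z k ≤ h) hc hxk hex
    refine ⟨c, ?_, ?_⟩
    · have := (adj_k h3.2.2.1 k).2
      omega
    · refine rtg_mono ?_ h1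
      rintro a b ⟨ha, hb, hab⟩
      exact ⟨Finset.mem_coe.2 (Finset.mem_filter.2 ⟨hS hab.1, ha⟩), Finset.mem_coe.2 (Finset.mem_filter.2 ⟨hS hab.2.1, hb⟩), hab.2.2⟩

/-- the two-arm event at height `h` -/
def TwoArm (G : Finset (V d)) (k : Fin d) (h : ℤ) (x y : V d) (t : Set (Sym2 (V d))) : Prop :=
  UpTo G k h x t ∧ UpTo G k h y t ∧ ¬ Cn t (G.filter (fun z => z k ≤ h) : Finset (V d)) x y

lemma up_dist (u : V d) (k : Fin d) : dist1 u (Function.update u k (u k + 1)) = 1 := by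
  rw [dist1_eq_one_iff]
  refine ⟨k, by simp, fun l hl => by rw [Function.update_of_ne hl]⟩

theorem twoArm_step {p δ : ℝ} (h0 : 0 ≤ p) (h1 : p ≤ 1) {lo hi : V d} {G : Finset (V d)}
    (hG : ∀ x, x ∈ G ↔ ∀ l, lo l ≤ x l ∧ x l ≤ hi l) (k : Fin d) (h : ℤ) (L : ℕ) (hl : lo k ≤ h)
    (hh : h + (L + 1) ≤ hi k) (S : Finset (V d)) (hSdef : S = G.filter (fun z => h + 1 ≤ z k ∧ z k ≤ h + (L + 1)))
    (hS : ∀ u ∈ S, ∀ v ∈ S, δ ≤ PrE p S (fun t => Cn t S u v)) (hδ0 : 0 ≤ δ) {x y : V d}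
    (hx : x ∈ G) (hy : y ∈ G) (hxk : x k ≤ h) (hyk : y k ≤ h) :
    PrE p G (TwoArm G k (h + (L + 1)) x y) ≤ (1 - p ^ 2 * δ) * PrE p G (TwoArm G k h x y) := by
  classical
  have hW : IsW (fun _ : Sym2 (V d) => p) := isW_const h0 h1
  set Gh := G.filter (fun z => z k ≤ h) with hGh
  set Gh' := G.filter (fun z => z k ≤ h + (L + 1)) with hGh'
  have hGG : Gh ⊆ Gh' := by
    intro z hz
    rw [hGh, Finset.mem_filter] at hz
    rw [hGh', Finset.mem_filter]
    exact ⟨hz.1, by omega⟩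
  have hSG : S ⊆ Gh' := by
    intro z hz
    rw [hSdef, Finset.mem_filter] at hz
    rw [hGh', Finset.mem_filter]
    exact ⟨hz.1, hz.2.2⟩
  have hGhG : Gh' ⊆ G := Finset.filter_subset _ _
  -- tips
  set tip : V d → Set (Sym2 (V d)) → V d := fun x t =>
    if hu : UpTo G k h x (t ∩ Ed Gh) then hu.choose else x with htip
  have tip_spec : ∀ x ∈ G, x k ≤ h → ∀ t, UpTo G k h x t → tip x t ∈ Gh ∧ tip x t k = h ∧ Cn t Gh x (tip x t) := by
    intro x hx hxk t hu
    have hu' : UpTo G k h x (t ∩ Ed Gh) := by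
      obtain ⟨v, h1, h2⟩ := hu
      exact ⟨v, h1, Cn_local.1 h2⟩
    have e : tip x t = hu'.choose := by simp only [htip, hu', dif_pos]
    have hs := hu'.choose_spec
    rw [← e] at hs
    have hc : Cn t Gh x (tip x t) := hs.2.mono Set.inter_subset_left le_rfl
    exact ⟨Finset.mem_coe.1 (hc.mem (Finset.mem_coe.2 (Finset.mem_filter.2 ⟨hx, hxk⟩))), hs.1, hc⟩
  have tip_loc : ∀ x t, tip x t = tip x (t ∩ Ed Gh) := by
    intro x t
    simp only [htip, Set.inter_assoc, Set.inter_self]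
  set e : V d → V d := fun u => Function.update u k (u k + 1) with he
  set link : V d × V d → Set (Sym2 (V d)) → Prop := fun c t =>
    (↑({s(c.1, e c.1), s(c.2, e c.2)} : Finset (Sym2 (V d))) ⊆ t) ∧ Cn t S (e c.1) (e c.2) with hlink
  set lev := G.filter (fun z => z k = h) with hlev
  set s2 : Finset (Sym2 (V d)) := (lev.image (fun u => s(u, e u))) ∪ Ed S with hs2
  have heS : ∀ u ∈ lev, e u ∈ S := by
    intro u hu
    rw [hlev, Finset.mem_filter] at hu
    rw [hSdef, Finset.mem_filter, hG]
    have hu1 := (hG u).1 hu.1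
    refine ⟨fun l => ?_, ?_⟩
    · by_cases hl : l = k
      · subst hl; simp only [he, Function.update_self]; constructor <;> omega
      · simp only [he, Function.update_of_ne hl]; exact hu1 l
    · simp only [he, Function.update_self]; omega
  have heE : ∀ u ∈ lev, s(u, e u) ∈ Ed G := by
    intro u hu
    exact mem_Ed.2 ⟨(Finset.mem_filter.1 hu).1, hGhG (hSG (heS u hu)), up_dist u k⟩
  have hs2G : s2 ⊆ Ed G := by
    refine Finset.union_subset ?_ (Ed_mono (hSG.trans hGhG))
    intro f hf
    obtain ⟨u, hu, rfl⟩ := Finset.mem_image.1 hf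
    exact heE u hu
  have hdis : Disjoint (Ed Gh) s2 := by
    rw [Finset.disjoint_left]
    intro f hf hf2
    rcases Finset.mem_union.1 hf2 with hf2 | hf2
    · obtain ⟨u, hu, rfl⟩ := Finset.mem_image.1 hf2
      have h3 := (Finset.mem_filter.1 (mem_Ed.1 hf).2.1).2
      have h4 := (Finset.mem_filter.1 hu).2
      simp only [he, Function.update_self] at h3
      omega
    · induction f with | _ u v
      have h3 := (Finset.mem_filter.1 (mem_Ed.1 hf).1).2
      have h4 := (mem_Ed.1 hf2).1
      rw [hSdef, Finset.mem_filter] at h4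
      omega
  have hfresh := cond_fresh (p := fun _ => p) hW (s := Ed G) (Ed_mono (hGG.trans hGhG)) hs2G hdis
    (TwoArm G k h x y) (fun t => (tip x t, tip y t)) (lev ×ˢ lev) (fun c t => link c (t ∩ s2)) (p ^ 2 * δ)
    ?_ ?_ ?_ ?_ ?_
  · refine le_trans ?_ hfresh
    refine Pr_mono hW ?_
    rintro t _ ⟨hX, hY, hXY⟩
    have hUx : UpTo G k h x t := by
      obtain ⟨v, hv1, hv2⟩ := hX
      exact UpTo_of _ (by exact_mod_cast hGhG) hv2 hx hxk (by omega)
    have hUy : UpTo G k h y t := by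
      obtain ⟨v, hv1, hv2⟩ := hY
      exact UpTo_of _ (by exact_mod_cast hGhG) hv2 hy hyk (by omega)
    refine ⟨⟨hUx, hUy, fun hc => hXY (hc.mono le_rfl (by exact_mod_cast hGG))⟩, fun hlk => hXY ?_⟩
    obtain ⟨l1, l2⟩ := hlk
    have t1 := tip_spec x hx hxk t hUx
    have t2 := tip_spec y hy hyk t hUy
    have q1 : tip x t ∈ lev := Finset.mem_filter.2 ⟨(Finset.mem_filter.1 t1.1).1, t1.2.1⟩
    have q2 : tip y t ∈ lev := Finset.mem_filter.2 ⟨(Finset.mem_filter.1 t2.1).1, t2.2.1⟩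
    have st : ∀ u ∈ lev, u ∈ Gh → s(u, e u) ∈ t → Cn t Gh' u (e u) := by
      intro u hu hu' hut
      exact ReflTransGen.single ⟨hGG hu', hSG (heS u hu), up_dist u k, hut⟩
    have m1 : s(tip x t, e (tip x t)) ∈ t := (l1 (by simp)).1
    have m2 : s(tip y t, e (tip y t)) ∈ t := (l1 (by simp)).1
    have c1 : Cn t Gh' x (tip x t) := t1.2.2.mono le_rfl (by exact_mod_cast hGG)
    have c2 : Cn t Gh' y (tip y t) := t2.2.2.mono le_rfl (by exact_mod_cast hGG)
    have c3 : Cn t Gh' (e (tip x t)) (e (tip y t)) := l2.mono Set.inter_subset_left (by exact_mod_cast hSG)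
    exact ((c1.trans (st _ q1 t1.1 m1)).trans c3).trans ((c2.trans (st _ q2 t2.1 m2)).symm)
  · intro t
    exact and_congr (exists_congr fun v => and_congr_right fun _ => Cn_local)
      (and_congr (exists_congr fun v => and_congr_right fun _ => Cn_local) (not_congr Cn_local))
  · intro t
    rw [← tip_loc, ← tip_loc]
  · intro t ht
    have t1 := tip_spec x hx hxk t ht.1
    have t2 := tip_spec y hy hyk t ht.2.1
    rw [Finset.mem_product]
    exact ⟨Finset.mem_filter.2 ⟨(Finset.mem_filter.1 t1.1).1, t1.2.1⟩, Finset.mem_filter.2 ⟨(Finset.mem_filter.1 t2.1).1, t2.2.1⟩⟩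
  · intro c t
    rw [Set.inter_assoc, Set.inter_self]
  · intro c hc
    rw [Finset.mem_product] at hc
    have e1 : Pr (fun _ => p) s2 (fun t => link c (t ∩ s2)) = Pr (fun _ => p) s2 (link c) :=
      Pr_congr fun t ht => by rw [Set.inter_eq_left.2 ht]
    rw [e1]
    have hsub : ({s(c.1, e c.1), s(c.2, e c.2)} : Finset (Sym2 (V d))) ⊆ s2 := by
      intro f hf
      rw [Finset.mem_insert, Finset.mem_singleton] at hf
      refine Finset.mem_union_left _ (Finset.mem_image.2 ?_)
      rcases hf with rfl | rfl
      · exact ⟨c.1, hc.1, rfl⟩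
      · exact ⟨c.2, hc.2, rfl⟩
    have k1 := Pr_open_ge h0 h1 hsub (k := 2) Finset.card_le_two
    have k2 : δ ≤ Pr (fun _ => p) s2 (fun t => Cn t S (e c.1) (e c.2)) :=
      (hS _ (heS _ hc.1) _ (heS _ hc.2)).trans (Pr_mono_s hW Finset.subset_union_right Cn_inc)
    exact (mul_le_mul k1 k2 hδ0 (Pr_nonneg hW)).trans (Pr_fkg hW (fun t t' htt h => h.trans htt) Cn_inc)

theorem twoArm_bound {p δ : ℝ} (h0 : 0 ≤ p) (h1 : p ≤ 1) (hδ0 : 0 ≤ δ) {lo hi : V d} {G : Finset (V d)}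
    (hG : ∀ x, x ∈ G ↔ ∀ l, lo l ≤ x l ∧ x l ≤ hi l) (k : Fin d) (L : ℕ)
    (hS : ∀ h, lo k ≤ h → h + (L + 1) ≤ hi k → ∀ S : Finset (V d), S = G.filter (fun z => h + 1 ≤ z k ∧ z k ≤ h + (L + 1)) →
      ∀ u ∈ S, ∀ v ∈ S, δ ≤ PrE p S (fun t => Cn t S u v)) {x y : V d}
    (hx : x ∈ G) (hy : y ∈ G) (hyx : y k ≤ x k) (hδ1 : p ^ 2 * δ ≤ 1) (j : ℕ) (hj : x k + j * (L + 1) ≤ hi k) :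
    PrE p G (TwoArm G k (x k + j * (L + 1)) x y) ≤ (1 - p ^ 2 * δ) ^ j := by
  have hW : IsW (fun _ : Sym2 (V d) => p) := isW_const h0 h1
  induction j with
  | zero => rw [pow_zero]; exact Pr_le_one hW
  | succ j ih =>
    have hxk := ((hG x).1 hx k).1
    have hnn : (0 : ℤ) ≤ j * (L + 1) := by positivity
    push_cast at hj ⊢
    have e : x k + ((j : ℤ) + 1) * (L + 1) = (x k + j * (L + 1)) + (L + 1) := by ring
    rw [e] at hj ⊢
    refine (twoArm_step h0 h1 hG k _ L (by linarith) hj _ rfl (hS _ (by linarith) hj _ rfl) hδ0 hx hy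
      (by linarith) (by linarith)).trans ?_
    rw [pow_succ, mul_comm]
    exact mul_le_mul_of_nonneg_right (ih (by linarith)) (by linarith)

end Slab

section TDsec
open Relation
variable {d : ℕ}

/-- the box `[-N, N)^d` -/
noncomputable def GB (d N : ℕ) : Finset (V d) := Finset.Icc (fun _ => -(N : ℤ)) (fun _ => (N : ℤ) - 1)

lemma mem_GB {N : ℕ} {x : V d} : x ∈ GB d N ↔ ∀ k, -(N : ℤ) ≤ x k ∧ x k ≤ (N : ℤ) - 1 := by
  simp only [GB, Finset.mem_Icc, Pi.le_def]
  exact forall_and.symm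

lemma card_GB (N : ℕ) : (GB d N).card = (2 * N) ^ d := by
  unfold GB
  rw [Pi.card_Icc]
  simp only [Int.card_Icc, Finset.prod_const, Finset.card_univ, Fintype.card_fin]
  congr 1
  omega

/-- The discrete version of the event `T_{m,N}`. -/
def TD (d N m : ℕ) (t : Set (Sym2 (V d))) : Prop :=
  ∃ y0 ∈ GB d N, (∀ k, ∃ a b, Cn t (GB d N) y0 a ∧ Cn t (GB d N) y0 b ∧ a k = -(N : ℤ) ∧ b k = (N : ℤ) - 1) ∧
    ∃ x ∈ GB d N, ∃ x' k, Cn t (GB d N) x x' ∧ (m : ℤ) ≤ x' k - x k ∧ ¬ Cn t (GB d N) x y0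

lemma TD_extent {N m : ℕ} {t : Set (Sym2 (V d))} (h : TD d N m t) : (m : ℤ) ≤ 2 * N - 1 := by
  obtain ⟨y0, hy0, -, x, hx, x', k, hc, hm, -⟩ := h
  have h1 := mem_GB.1 hx k
  have h2 := mem_GB.1 (Finset.mem_coe.1 (hc.mem (Finset.mem_coe.2 hx))) k
  omega

set_option maxHeartbeats 1000000 in
theorem td_bound3 {p1 p0 θ : ℝ} (h0 : 0 ≤ p1) (h1 : p1 < p0) (hp0 : p0 ≤ 1) (hθ : 0 < θ)
    (hth : ∀ n, θ ≤ th d p1 n) (hd : 3 ≤ d) :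
    ∃ (L : ℕ) (ρ K : ℝ), 1 ≤ L ∧ 0 < ρ ∧ ρ < 1 ∧ 0 < K ∧ ∀ p, p0 ≤ p → p ≤ 1 → ∀ N : ℕ, 1 ≤ N → ∀ m : ℕ,
      PrE p (GB d N) (TD d N m) ≤ K * (N : ℝ) ^ (2 * d) * ρ ^ (m / L) := by
  classical
  obtain ⟨δ, hδ, H⟩ := mcl h0 h1 hp0 hθ hth (by omega)
  obtain ⟨L0, hL0⟩ := H 1
  set L := max L0 1 with hL
  have hLL : L0 ≤ L := le_max_left _ _
  have hL1 : 1 ≤ L := le_max_right _ _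
  set δ' := min δ 1 with hδ'
  have hδ'0 : 0 < δ' := lt_min hδ one_pos
  have hδ'1 : δ' ≤ 1 := min_le_right _ _
  set q := p0 ^ 2 * δ' ^ d with hq
  have hp00 : 0 < p0 := h0.trans_lt h1
  have hq0 : 0 < q := by positivity
  have hpd : δ' ^ d ≤ 1 := pow_le_one₀ hδ'0.le hδ'1
  have hq1 : q ≤ 1 := mul_le_one₀ (pow_le_one₀ hp00.le hp0) (by positivity) hpd
  refine ⟨L + 1, max (1 - q) (1 / 2), d * 2 ^ (2 * d) + 1, by omega, by positivity, max_lt (by linarith) (by norm_num),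
    by positivity, ?_⟩
  set ρ := max (1 - q) (1 / 2 : ℝ) with hρ
  have hρ0 : 0 < ρ := by positivity
  intro p hp hp1 N hN m
  have hW : IsW (fun _ : Sym2 (V d) => p) := isW_const (hp00.le.trans hp) hp1
  have hN1 : (1 : ℝ) ≤ N := by exact_mod_cast hN
  have hNp : (1 : ℝ) ≤ (N : ℝ) ^ (2 * d) := one_le_pow₀ hN1
  by_cases hm : m < L + 1
  · rw [Nat.div_eq_of_lt hm, pow_zero, mul_one]
    have : (0 : ℝ) ≤ d * 2 ^ (2 * d) := by positivity
    exact (Pr_le_one hW).trans (by nlinarith)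
  by_cases hmN : (m : ℤ) ≤ 2 * N - 1
  swap
  · unfold PrE
    rw [Pr_false fun t _ h => hmN (TD_extent h)]
    positivity
  set J := m / (L + 1) with hJ
  have hJm : J * (L + 1) ≤ m := Nat.div_mul_le_self _ _
  have hG : ∀ x : V d, x ∈ GB d N ↔ ∀ l, (fun _ => -(N : ℤ)) l ≤ x l ∧ x l ≤ (fun _ => (N : ℤ) - 1) l := fun x => mem_GB
  have hS : ∀ k : Fin d, ∀ h, -(N : ℤ) ≤ h → h + (L + 1) ≤ (N : ℤ) - 1 → ∀ S : Finset (V d),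
      S = (GB d N).filter (fun z => h + 1 ≤ z k ∧ z k ≤ h + (L + 1)) →
      ∀ u ∈ S, ∀ v ∈ S, δ' ^ d ≤ PrE p S (fun t => Cn t S u v) := by
    intro k h hlo hhi S hS u hu v hv
    set lo : V d := Function.update (fun _ => -(N : ℤ)) k (h + 1) with hlo'
    set hi : V d := Function.update (fun _ => (N : ℤ) - 1) k (h + (L + 1)) with hhi'
    have hside : ∀ l, hi l - lo l = if l = k then (L : ℤ) else 2 * N - 1 := by
      intro l
      by_cases hl : l = k
      · subst hl; simp only [hlo', hhi', Function.update_self, if_true]; ring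
      · simp only [hlo', hhi', Function.update_of_ne hl, if_neg hl]; ring
    have hSG : ∀ x, x ∈ S ↔ ∀ l, lo l ≤ x l ∧ x l ≤ hi l := by
      intro x
      rw [hS, Finset.mem_filter, mem_GB]
      constructor
      · rintro ⟨h1, h2⟩ l
        by_cases hl : l = k
        · subst hl; simp only [hlo', hhi', Function.update_self]; exact h2
        · simp only [hlo', hhi', Function.update_of_ne hl]; exact h1 l
      · intro h1
        have hk := h1 k
        simp only [hlo', hhi', Function.update_self] at hk
        refine ⟨fun l => ?_, hk⟩
        by_cases hl : l = k
        · subst hl; omega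
        · have := h1 l
          simpa only [hlo', hhi', Function.update_of_ne hl] using this
    refine hop_conn (hp00.le.trans hp) hp1 hδ'0.le hδ'1 hSG ?_ hu hv
    intro i u hu v hv huv
    obtain ⟨j, hji, hjk⟩ : ∃ j : Fin d, j ≠ i ∧ j ≠ k := by
      have hc : (({i, k} : Finset (Fin d))ᶜ).Nonempty := by
        rw [← Finset.card_pos, Finset.card_compl, Fintype.card_fin]
        have := Finset.card_le_two (a := i) (b := k)
        omega
      obtain ⟨j, hj⟩ := hc
      simp only [Finset.mem_compl, Finset.mem_insert, Finset.mem_singleton, not_or] at hj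
      exact ⟨j, hj⟩
    refine (min_le_left δ 1).trans (hL0 lo hi ?_ i j (Ne.symm hji) ?_ S hSG u hu v hv huv p hp hp1)
    · intro l
      rw [hside]
      split_ifs <;> omega
    · rw [hside, hside, if_neg hjk]
      split_ifs <;> push_cast <;> omega
  have hqp : q ≤ p ^ 2 * δ' ^ d := by
    rw [hq]; gcongr
  have hqp1 : p ^ 2 * δ' ^ d ≤ 1 := mul_le_one₀ (pow_le_one₀ (hp00.le.trans hp) hp1) (by positivity) hpd
  have hub : PrE p (GB d N) (TD d N m) ≤ ∑ c ∈ (Finset.univ : Finset (Fin d)) ×ˢ (GB d N ×ˢ GB d N),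
      Pr (fun _ => p) (Ed (GB d N)) (fun t => (c.2.2 c.1 ≤ c.2.1 c.1 ∧ c.2.1 c.1 + J * (L + 1) ≤ (N : ℤ) - 1) ∧
        TwoArm (GB d N) c.1 (c.2.1 c.1 + J * (L + 1)) c.2.1 c.2.2 t) := by
    unfold PrE
    refine Pr_union_le hW _ _ ?_
    rintro t - ⟨y0, hy0, hcr, x, hx, x', k, hc, hmx, hnc⟩
    obtain ⟨a, b, ha, hb, hak, hbk⟩ := hcr k
    have haG := Finset.mem_coe.1 (ha.mem (Finset.mem_coe.2 hy0))
    have hx'G := Finset.mem_coe.1 (hc.mem (Finset.mem_coe.2 hx))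
    refine ⟨(k, x, a), by simp [hx, haG], ?_⟩
    have e1 := mem_GB.1 hx k
    have e2 := mem_GB.1 hx'G k
    have e3 : (J : ℤ) * (L + 1) ≤ m := by exact_mod_cast hJm
    have e4 : (0 : ℤ) ≤ (J : ℤ) * (L + 1) := by positivity
    refine ⟨⟨?_, ?_⟩, ?_, ?_, ?_⟩
    · show a k ≤ x k
      omega
    · show x k + (J : ℤ) * (L + 1) ≤ N - 1
      omega
    · exact UpTo_of _ (le_refl _) hc hx (by dsimp only; omega) (by dsimp only; omega)
    · exact UpTo_of _ (le_refl _) (ha.symm.trans hb) haG (by dsimp only; omega) (by dsimp only; omega)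
    · intro hca
      refine hnc ((hca.mono le_rfl ?_).trans ha.symm)
      intro z hz
      exact Finset.mem_coe.2 (Finset.mem_filter.1 (Finset.mem_coe.1 hz)).1
  refine hub.trans ?_
  have each : ∀ c ∈ (Finset.univ : Finset (Fin d)) ×ˢ (GB d N ×ˢ GB d N),
      Pr (fun _ => p) (Ed (GB d N)) (fun t => (c.2.2 c.1 ≤ c.2.1 c.1 ∧ c.2.1 c.1 + J * (L + 1) ≤ (N : ℤ) - 1) ∧
        TwoArm (GB d N) c.1 (c.2.1 c.1 + J * (L + 1)) c.2.1 c.2.2 t) ≤ ρ ^ J := by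
    intro c hc
    simp only [Finset.mem_product] at hc
    by_cases hcc : (c.2.2 c.1 ≤ c.2.1 c.1 ∧ c.2.1 c.1 + J * (L + 1) ≤ (N : ℤ) - 1)
    · have := twoArm_bound (hp00.le.trans hp) hp1 (by positivity : (0:ℝ) ≤ δ' ^ d) hG c.1 L (hS c.1) hc.2.1 hc.2.2 hcc.1
        hqp1 J hcc.2
      refine (Pr_mono hW (fun t _ h => h.2)).trans (this.trans ?_)
      exact pow_le_pow_left₀ (by linarith) ((by linarith : 1 - p ^ 2 * δ' ^ d ≤ 1 - q).trans (le_max_left _ _)) _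
    · rw [Pr_false fun t _ h => hcc h.1]
      positivity
  refine (Finset.sum_le_card_nsmul _ _ _ each).trans ?_
  rw [Finset.card_product, Finset.card_product, card_GB, Finset.card_univ, Fintype.card_fin, nsmul_eq_mul]
  refine mul_le_mul_of_nonneg_right ?_ (by positivity)
  push_cast
  have e : ((2 : ℝ) * N) ^ d * (2 * N) ^ d = 2 ^ (2 * d) * N ^ (2 * d) := by
    rw [← pow_add, ← two_mul, mul_pow]
  rw [e]
  nlinarith
end TDsec

section Cross
open Relation

lemma cross_aux (n : ℕ) (X Y : ℕ → ℤ)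
    (hst : ∀ s < n, (X (s + 1) = X s ∧ (Y (s + 1) = Y s + 1 ∨ Y s = Y (s + 1) + 1)) ∨
      (Y (s + 1) = Y s ∧ (X (s + 1) = X s + 1 ∨ X s = X (s + 1) + 1)))
    {a A b B : ℤ} (hX : ∀ s ≤ n, a ≤ X s ∧ X s ≤ A) (hY : ∀ s ≤ n, b ≤ Y s ∧ Y s ≤ B) (h0 : X 0 = a) (hn : X n = A) :
    ∃ h : ℤ → ℤ → ℤ, (∀ x y, x ≤ A → (∀ s ≤ n, ¬ (X s = x ∧ Y s = y)) → h x (y + 1) = h x y) ∧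
      (∀ x y, a ≤ x → (∀ s ≤ n, ¬ (X s = x + 1 ∧ Y s = y)) → h (x + 1) y = h x y) ∧ (∀ x, h x b = 0) ∧
      (∀ x, a ≤ x → h x (B + 1) = 1) := by
  classical
  set c : ℤ → ℤ → ℤ := fun u v => if u ≤ v then 1 else 0 with hc
  have tel : ∀ g : ℕ → ℤ, ∑ s ∈ Finset.range n, (g s - g (s + 1)) + g n = g 0 := by
    intro g
    rw [Finset.sum_range_sub']; ring
  refine ⟨fun x y => ∑ s ∈ Finset.range n, c (Y s + 1) y * (c (X s) x - c (X (s + 1)) x) + c (Y n + 1) y * c (X n) x,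
    ?_, ?_, ?_, ?_⟩
  · intro x y hxA hoff
    have e1 : c (Y n + 1) (y + 1) * c (X n) x = c (Y n + 1) y * c (X n) x := by
      have := hoff n le_rfl
      simp only [hc]
      split_ifs <;> omega
    dsimp only
    rw [e1]
    congr 1
    refine Finset.sum_congr rfl fun s hs => ?_
    have hs' := Finset.mem_range.1 hs
    have o1 := hoff s hs'.le
    have o2 := hoff (s + 1) hs'
    have o3 := hst s hs'
    simp only [hc]
    split_ifs <;> omega
  · intro x y hx hoff
    dsimp only
    have key := tel (fun s => c (Y s + 1) y * (c (X s) (x + 1) - c (X s) x))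
    have z0 : c (Y 0 + 1) y * (c (X 0) (x + 1) - c (X 0) x) = 0 := by
      simp only [hc]
      split_ifs <;> omega
    rw [z0] at key
    have e : ∀ s ∈ Finset.range n, c (Y s + 1) y * (c (X s) (x + 1) - c (X s) x) -
        c (Y (s + 1) + 1) y * (c (X (s + 1)) (x + 1) - c (X (s + 1)) x) =
        c (Y s + 1) y * (c (X s) (x + 1) - c (X (s + 1)) (x + 1)) - c (Y s + 1) y * (c (X s) x - c (X (s + 1)) x) := by
      intro s hs
      have hs' := Finset.mem_range.1 hs
      have o1 := hoff s hs'.le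
      have o2 := hoff (s + 1) hs'
      have o3 := hst s hs'
      have : c (Y (s + 1) + 1) y * (c (X (s + 1)) (x + 1) - c (X (s + 1)) x) =
          c (Y s + 1) y * (c (X (s + 1)) (x + 1) - c (X (s + 1)) x) := by
        simp only [hc]
        split_ifs <;> omega
      rw [this]; ring
    rw [Finset.sum_congr rfl e, Finset.sum_sub_distrib] at key
    linarith
  · intro x
    dsimp only
    have : ∀ s ≤ n, c (Y s + 1) b = 0 := by
      intro s hs
      have := hY s hs
      simp only [hc]
      rw [if_neg (by omega)]
    rw [this n le_rfl, Finset.sum_eq_zero (fun s hs => by rw [this s (Finset.mem_range.1 hs).le, zero_mul])]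
    simp
  · intro x hx
    dsimp only
    have : ∀ s ≤ n, c (Y s + 1) (B + 1) = 1 := by
      intro s hs
      have := hY s hs
      simp only [hc]
      rw [if_pos (by omega)]
    rw [this n le_rfl, Finset.sum_congr rfl (fun s hs => by rw [this s (Finset.mem_range.1 hs).le, one_mul])]
    rw [one_mul, tel]
    simp only [hc]
    rw [if_pos (by omega)]

lemma two_cases {i j : Fin 2} (hij : i ≠ j) (l : Fin 2) : l = i ∨ l = j := by omega

lemma adj_two {u v : V 2} {i j : Fin 2} (hij : i ≠ j) (h : dist1 u v = 1) :
    (v i = u i ∧ (v j = u j + 1 ∨ u j = v j + 1)) ∨ (v j = u j ∧ (v i = u i + 1 ∨ u i = v i + 1)) := by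
  obtain ⟨k, hk, hl⟩ := dist1_eq_one_iff.1 h
  rcases two_cases hij k with rfl | rfl
  · have := hl j hij.symm
    right
    refine ⟨this.symm, ?_⟩
    rcases (abs_eq (by norm_num)).1 hk with e | e <;> omega
  · have := hl i hij
    left
    refine ⟨this.symm, ?_⟩
    rcases (abs_eq (by norm_num)).1 hk with e | e <;> omega

theorem cross_meet {i j : Fin 2} (hij : i ≠ j) {a A b B : ℤ} {r1 r2 : V 2 → V 2 → Prop}
    (hr1 : ∀ u v, r1 u v → dist1 u v = 1 ∧ (a ≤ v i ∧ v i ≤ A) ∧ (b ≤ v j ∧ v j ≤ B))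
    (hr2 : ∀ u v, r2 u v → dist1 u v = 1 ∧ (a ≤ v i ∧ v i ≤ A) ∧ (b ≤ v j ∧ v j ≤ B)) {u u' v v' : V 2}
    (h1 : ReflTransGen r1 u u') (h2 : ReflTransGen r2 v v') (hu : b ≤ u j ∧ u j ≤ B) (hv : a ≤ v i ∧ v i ≤ A)
    (hua : u i = a) (huA : u' i = A) (hvb : v j = b) (hvB : v' j = B) :
    ∃ w, ReflTransGen r1 u w ∧ ReflTransGen r2 v w := by
  by_contra hno
  push Not at hno
  obtain ⟨n, f, hf0, hfn, hf⟩ := rtg_path h1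
  have haA : a ≤ A := by omega
  have hreach : ∀ s ≤ n, ReflTransGen r1 u (f s) := by
    intro s
    induction s with
    | zero => intro _; rw [hf0]
    | succ s ih => intro hs; exact (ih (by omega)).tail (hf s (by omega))
  have hin : ∀ s ≤ n, (a ≤ f s i ∧ f s i ≤ A) ∧ (b ≤ f s j ∧ f s j ≤ B) := by
    intro s hs
    cases s with
    | zero => rw [hf0]; exact ⟨by omega, hu⟩
    | succ s => exact (hr1 _ _ (hf s (by omega))).2
  obtain ⟨h, k1, k2, k3, k4⟩ := cross_aux n (fun s => f s i) (fun s => f s j)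
    (fun s hs => adj_two hij (hr1 _ _ (hf s hs)).1) (fun s hs => (hin s hs).1) (fun s hs => (hin s hs).2)
    (by simp only [hf0, hua]) (by simp only [hfn, huA])
  have off : ∀ w, ReflTransGen r2 v w → ∀ s ≤ n, ¬ (f s i = w i ∧ f s j = w j) := by
    intro w hw s hs he
    have : f s = w := by
      funext l
      rcases two_cases hij l with rfl | rfl
      · exact he.1
      · exact he.2
    exact hno w (this ▸ hreach s hs) hw
  have main : ∀ w, ReflTransGen r2 v w → h (w i) (w j) = 0 ∧ (a ≤ w i ∧ w i ≤ A) := by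
    intro w hw
    induction hw with
    | refl => exact ⟨by rw [hvb]; exact k3 _, hv⟩
    | tail h1 h2 ih =>
      rename_i x y
      have hy := hr2 _ _ h2
      refine ⟨?_, hy.2.1⟩
      have offx := off x h1
      have offy := off y (h1.tail h2)
      rw [← ih.1]
      rcases adj_two hij hy.1 with ⟨e, e' | e'⟩ | ⟨e, e' | e'⟩
      · rw [e, e']; exact k1 _ _ ih.2.2 offx
      · rw [e']
        rw [e] at offy ⊢
        exact (k1 _ _ ih.2.2 offy).symm
      · rw [e, e']
        rw [e, e'] at offy
        exact k2 _ _ ih.2.1 offy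
      · rw [e, e']
        rw [e'] at offx
        exact (k2 _ _ hy.2.1.1 offx).symm
  have f1 := main v' h2
  have f2 := k1 (v' i) (v' j) f1.2.2 (off v' h2)
  rw [hvB, k4 _ f1.2.1] at f2
  rw [hvB] at f1
  omega
end Cross

section BArmSec
open Relation

theorem BArm_bound {ι : Type*} {p : ι → ℝ} (hW : IsW p) {s : Finset ι} (E : ℤ × ℤ → Finset ι)
    (B : ℤ × ℤ → Set ι → Prop) {ε : ℝ} (hε : 0 ≤ ε) (r : ℕ) : ∀ (R : Finset (ℤ × ℤ)), (∀ z ∈ R, E z ⊆ s) →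
    (∀ z ∈ R, ∀ t : Set ι, B z t ↔ B z (t ∩ E z)) →
    (∀ z ∈ R, ∀ z' ∈ R, far2 z z' 3 → Disjoint (E z) (E z')) → (∀ z ∈ R, Pr p s (B z) ≤ ε) →
    ∀ w, Pr p s (fun t => SArm {z | ¬ B z t} R w (3 * r)) ≤ (49 * ε) ^ r := by
  classical
  induction r with
  | zero => intro R _ _ _ _ w; rw [pow_zero]; exact Pr_le_one hW
  | succ r ih =>
    intro R hE hB hdis hbd w
    by_cases hw : w ∈ R
    swap
    · rw [Pr_false (fun t _ h => hw h.1)]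
      positivity
    set R' := R.filter (fun z => far2 w z 3) with hR'
    have hsub : R' ⊆ R := Finset.filter_subset _ _
    set nb : Finset (ℤ × ℤ) := Finset.Icc (w.1 - 3) (w.1 + 3) ×ˢ Finset.Icc (w.2 - 3) (w.2 + 3) with hnb
    have hnbc : nb.card = 49 := by
      rw [hnb, Finset.card_product, Int.card_Icc, Int.card_Icc]
      have e1 : (w.1 + 3 + 1 - (w.1 - 3)).toNat = 7 := by omega
      have e2 : (w.2 + 3 + 1 - (w.2 - 3)).toNat = 7 := by omega
      rw [e1, e2]
    have step : Pr p s (fun t => SArm {z | ¬ B z t} R w (3 * (r + 1))) ≤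
        ∑ w' ∈ nb, Pr p s (fun t => B w t ∧ SArm {z | ¬ B z t} R' w' (3 * r)) := by
      refine Pr_union_le hW nb _ ?_
      rintro t _ ⟨_, hwt, v, hv, hf⟩
      have hvw : ¬ ¬ far2 w v 3 := by
        rw [not_not]
        unfold far2 at *; push_cast at hf ⊢; omega
      obtain ⟨c, e, _, hc, hce, he, hev⟩ := last_exit (P := fun u => ¬ far2 w u 3) hv (by simp only [far2]; push_cast; omega) hvw
      have hst := hce.2.2
      rw [not_not] at he
      refine ⟨e, ?_, ?_, ?_, hce.2.1.2, v, ?_, ?_⟩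
      · unfold star2 at hst
        unfold far2 at hc
        push_cast at hc
        rw [hnb, Finset.mem_product, Finset.mem_Icc, Finset.mem_Icc]; omega
      · exact not_not.1 hwt
      · rw [Finset.mem_coe, Finset.mem_filter]; exact ⟨hce.2.1.1, he⟩
      · refine rtg_mono ?_ hev
        rintro x y ⟨hx, hy, h⟩
        exact ⟨⟨by rw [Finset.mem_coe, Finset.mem_filter]; exact ⟨h.1.1, not_not.1 hx⟩, h.1.2⟩,
          ⟨by rw [Finset.mem_coe, Finset.mem_filter]; exact ⟨h.2.1.1, not_not.1 hy⟩, h.2.1.2⟩, h.2.2⟩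
      · unfold far2 star2 at *; push_cast at hf hc ⊢; omega
    refine step.trans ?_
    set s2 := R'.biUnion E with hs2
    have hs2s : s2 ⊆ s := by
      rw [hs2, Finset.biUnion_subset]
      exact fun z hz => hE z (hsub hz)
    have hd2 : Disjoint (E w) s2 := by
      rw [hs2, Finset.disjoint_biUnion_right]
      intro z hz
      exact hdis w hw z (hsub hz) (Finset.mem_filter.1 hz).2
    have hloc : ∀ w' (t : Set ι), SArm {z | ¬ B z t} R' w' (3 * r) ↔ SArm {z | ¬ B z (t ∩ s2)} R' w' (3 * r) := by
      intro w' t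
      have e : {z | ¬ B z t} ∩ (R' : Set (ℤ × ℤ)) = {z | ¬ B z (t ∩ s2)} ∩ R' := by
        ext z
        refine and_congr_left fun hz => ?_
        have hz' : z ∈ R' := Finset.mem_coe.1 hz
        have h1 := hB z (hsub hz') t
        have h2 := hB z (hsub hz') (t ∩ s2)
        have h3 : t ∩ ↑s2 ∩ ↑(E z) = t ∩ (E z : Set ι) := by
          have hsz : (E z : Set ι) ⊆ s2 := by exact_mod_cast Finset.subset_biUnion_of_mem E hz'
          rw [Set.inter_assoc, Set.inter_eq_right.2 hsz]
        rw [h3] at h2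
        exact not_congr (h1.trans h2.symm)
      rw [SArm_local (t := {z | ¬ B z t}) (le_refl (R' : Set (ℤ × ℤ))), e, ← SArm_local (le_refl _)]
    have each : ∀ w' ∈ nb, Pr p s (fun t => B w t ∧ SArm {z | ¬ B z t} R' w' (3 * r)) ≤ ε * (49 * ε) ^ r := by
      intro w' _
      rw [Pr_indep (s1 := E w) (s2 := s2) (A := B w) (B := fun t => SArm {z | ¬ B z t} R' w' (3 * r)) (hE w hw) hs2s hd2
        (fun t _ => hB w hw t) (fun t _ => hloc w' t)]
      rw [← Pr_local (A := B w) (hE w hw) (fun t _ => hB w hw t),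
        ← Pr_local (A := fun t => SArm {z | ¬ B z t} R' w' (3 * r)) hs2s (fun t _ => hloc w' t)]
      exact mul_le_mul (hbd w hw) (ih R' (fun z hz => hE z (hsub hz)) (fun z hz => hB z (hsub hz))
        (fun z hz z' hz' => hdis z (hsub hz) z' (hsub hz')) (fun z hz => hbd z (hsub hz)) w') (Pr_nonneg hW) hε
    refine (Finset.sum_le_card_nsmul _ _ _ each).trans (le_of_eq ?_)
    rw [hnbc, nsmul_eq_mul]
    push_cast
    ring

end BArmSec

section Ring
open Relation

/-- lower end of the window -/
def wlo (N M : ℕ) (c : V 2) (l : Fin 2) : ℤ := max (-(N : ℤ)) (c l - (2 * M + 1))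
/-- upper end of the window -/
def whi (N M : ℕ) (c : V 2) (l : Fin 2) : ℤ := min ((N : ℤ) - 1) (c l + (2 * M + 1))

/-- window around `c` -/
noncomputable def Qw (N M : ℕ) (c : V 2) : Finset (V 2) := Finset.Icc (wlo N M c) (whi N M c)

lemma mem_Qw {N M : ℕ} {c x : V 2} : x ∈ Qw N M c ↔ ∀ l, wlo N M c l ≤ x l ∧ x l ≤ whi N M c l := by
  simp only [Qw, Finset.mem_Icc, Pi.le_def]
  exact forall_and.symm

lemma Qw_sub {N M : ℕ} {c : V 2} : Qw N M c ⊆ GB 2 N := by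
  intro x hx
  rw [mem_Qw] at hx
  rw [mem_GB]
  intro l
  have := hx l
  unfold wlo whi at this
  omega

/-- slab of the window -/
noncomputable def Sw (N M : ℕ) (c : V 2) (l : Fin 2) (α : ℤ) : Finset (V 2) :=
  (Qw N M c).filter (fun z => α ≤ z l ∧ z l ≤ α + M - 1)

lemma mem_Sw {N M : ℕ} {c x : V 2} {l : Fin 2} {α : ℤ} :
    x ∈ Sw N M c l α ↔ x ∈ Qw N M c ∧ α ≤ x l ∧ x l ≤ α + M - 1 := by
  unfold Sw; rw [Finset.mem_filter]

/-- the slab of direction `l` at `α` is one of the sides of the annulus -/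
def Vld (N M : ℕ) (c : V 2) (l : Fin 2) (α : ℤ) : Prop :=
  (α = c l + M + 2 ∧ c l + (2 * M + 1) ≤ (N : ℤ) - 1) ∨ (α = c l - (2 * M + 1) ∧ -(N : ℤ) ≤ c l - (2 * M + 1))

/-- lengthwise crossing of a slab -/
def Crs (N M : ℕ) (c : V 2) (l : Fin 2) (α : ℤ) (t : Set (Sym2 (V 2))) : Prop :=
  ∃ u ∈ Sw N M c l α, ∃ v, Cn t (Sw N M c l α) u v ∧ ∀ j, j ≠ l → u j = wlo N M c j ∧ v j = whi N M c j

/-- the annulus is good -/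
def GoodB (N M : ℕ) (c : V 2) (t : Set (Sym2 (V 2))) : Prop := ∀ l α, Vld N M c l α → Crs N M c l α t

lemma Sw_sub_Qw {N M : ℕ} {c : V 2} {l : Fin 2} {α : ℤ} : (Sw N M c l α : Set (V 2)) ⊆ Qw N M c := by
  intro x hx
  exact Finset.mem_coe.2 (mem_Sw.1 (Finset.mem_coe.1 hx)).1

lemma Crs_local {N M : ℕ} {c : V 2} {l : Fin 2} {α : ℤ} {t : Set (Sym2 (V 2))} {s : Finset (Sym2 (V 2))}
    (hs : Ed (Sw N M c l α) ⊆ s) : Crs N M c l α t ↔ Crs N M c l α (t ∩ s) := by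
  unfold Crs
  exact exists_congr fun u => and_congr_right fun _ => exists_congr fun v => and_congr_left fun _ => Cn_local_of hs

lemma GoodB_local {N M : ℕ} {c : V 2} {t : Set (Sym2 (V 2))} : GoodB N M c t ↔ GoodB N M c (t ∩ Ed (Qw N M c)) := by
  unfold GoodB
  refine forall_congr' fun l => forall_congr' fun α => imp_congr_right fun _ => Crs_local (Ed_mono ?_)
  exact Finset.filter_subset _ _

/-- slab crossings in different directions meet -/
lemma crs_meet {N M : ℕ} {c : V 2} {l l' : Fin 2} (hl : l ≠ l') {α α' : ℤ} {t : Set (Sym2 (V 2))} {u v u' v' : V 2}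
    (hu : u ∈ Sw N M c l α) (h : Cn t (Sw N M c l α) u v) (hj : ∀ j, j ≠ l → u j = wlo N M c j ∧ v j = whi N M c j)
    (hu' : u' ∈ Sw N M c l' α') (h' : Cn t (Sw N M c l' α') u' v')
    (hj' : ∀ j, j ≠ l' → u' j = wlo N M c j ∧ v' j = whi N M c j) :
    ∃ w, Cn t (Sw N M c l α) u w ∧ Cn t (Sw N M c l' α') u' w := by
  have hQ := mem_Qw.1 (mem_Sw.1 hu).1
  have hQ' := mem_Qw.1 (mem_Sw.1 hu').1
  refine cross_meet hl.symm (a := wlo N M c l') (A := whi N M c l') (b := wlo N M c l) (B := whi N M c l) ?_ ?_ h h'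
    (hQ l) (hQ' l') (hj l' hl.symm).1 (hj l' hl.symm).2 (hj' l hl).1 (hj' l hl).2
  · intro a b hab
    have := mem_Qw.1 (mem_Sw.1 (Finset.mem_coe.1 hab.2.1)).1
    exact ⟨hab.2.2.1, this l', this l⟩
  · intro a b hab
    have := mem_Qw.1 (mem_Sw.1 (Finset.mem_coe.1 hab.2.1)).1
    exact ⟨hab.2.2.1, this l', this l⟩

theorem good_ring {N M : ℕ} {c : V 2} {t : Set (Sym2 (V 2))} (hg : GoodB N M c t) (hN : 2 * (2 * (M : ℤ) + 1) ≤ 2 * N - 1)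
    (hM : 1 ≤ M) :
    ∃ O : Set (V 2), (∀ o ∈ O, ∀ o' ∈ O, Cn t (GB 2 N) o o') ∧
      ∀ r : V 2 → V 2 → Prop, (∀ u v, r u v → r v u) → (∀ u v, r u v → u ∈ GB 2 N ∧ v ∈ GB 2 N ∧ dist1 u v = 1) →
      ∀ z z', z ∈ GB 2 N → (∀ l, c l - (M + 1) ≤ z l ∧ z l ≤ c l + (M + 1)) → (∃ l, z' l < c l - (2 * M + 1) ∨ c l + (2 * M + 1) < z' l) →
      ReflTransGen r z z' → ∃ w ∈ O, ReflTransGen r z w := by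
  classical
  choose! st hst en hen hwo using hg
  refine ⟨{o | ∃ l α, Vld N M c l α ∧ Cn t (Sw N M c l α) (st l α) o}, ?_, ?_⟩
  · have sub : ∀ l α, (Sw N M c l α : Set (V 2)) ⊆ GB 2 N := fun l α =>
      Sw_sub_Qw.trans (by exact_mod_cast Qw_sub)
    have c1 : ∀ l l', l ≠ l' → ∀ α α', Vld N M c l α → Vld N M c l' α' → Cn t (GB 2 N) (st l α) (st l' α') := by
      intro l l' hl α α' h h'
      obtain ⟨w, h1, h2⟩ := crs_meet hl (hst l α h) (hen l α h) (hwo l α h) (hst l' α' h') (hen l' α' h') (hwo l' α' h')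
      exact (h1.mono le_rfl (sub _ _)).trans (h2.mono le_rfl (sub _ _)).symm
    have c2 : ∀ l l' α α', Vld N M c l α → Vld N M c l' α' → Cn t (GB 2 N) (st l α) (st l' α') := by
      intro l l' α α' h h'
      by_cases hl : l = l'
      · subst hl
        obtain ⟨j, hj⟩ : ∃ j : Fin 2, j ≠ l := exists_ne l
        obtain ⟨β, hβ⟩ : ∃ β, Vld N M c j β := by
          by_cases hc : c j + (2 * M + 1) ≤ (N : ℤ) - 1
          · exact ⟨_, Or.inl ⟨rfl, hc⟩⟩
          · exact ⟨_, Or.inr ⟨rfl, by omega⟩⟩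
        exact (c1 l j hj.symm α β h hβ).trans (c1 j l hj β α' hβ h')
      · exact c1 l l' hl α α' h h'
    rintro o ⟨l, α, h, ho⟩ o' ⟨l', α', h', ho'⟩
    exact ((ho.mono le_rfl (sub _ _)).symm.trans (c2 l l' α α' h h')).trans (ho'.mono le_rfl (sub _ _))
  · intro r hsym hr z z' hz hzc hz' hzz'
    obtain ⟨a, e, h1, h2, h3, h4, -⟩ := first_exit
      (P := fun x : V 2 => ∀ l, c l - (2 * M + 1) ≤ x l ∧ x l ≤ c l + (2 * M + 1)) hzz'
      (fun l => by have := hzc l; constructor <;> omega) (by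
        intro h
        obtain ⟨l, hl⟩ := hz'
        have := h l
        omega)
    have hza : ReflTransGen r z a := rtg_mono (fun _ _ h => h.2.2) h1
    push Not at h4
    obtain ⟨l, hl⟩ := h4
    have hae := adj_k (hr _ _ h3).2.2 l
    have heG := mem_GB.1 (hr _ _ h3).2.1 l
    have hal := h2 l
    obtain ⟨j, hj⟩ : ∃ j : Fin 2, j ≠ l := exists_ne l
    have inQ : ∀ x, x ∈ GB 2 N → (∀ l, c l - (2 * M + 1) ≤ x l ∧ x l ≤ c l + (2 * M + 1)) → ∀ i, wlo N M c i ≤ x i ∧ x i ≤ whi N M c i := by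
      intro x hx hx2 i
      have e1 := mem_GB.1 hx i
      have e2 := hx2 i
      unfold wlo whi
      omega
    by_cases hup : c l + (2 * M + 1) < e l
    · have hv : Vld N M c l (c l + M + 2) := Or.inl ⟨rfl, by omega⟩
      obtain ⟨x, f, g1, g2, g3, g4, g5⟩ := last_exit (P := fun x : V 2 => x l ≤ c l + (M + 1)) h1 (hzc l).2
        (by show ¬ a l ≤ _; omega)
      have hxf := adj_k (hr _ _ g3.2.2).2.2 l
      have hf0 := inQ f (hr _ _ g3.2.2).2.1 g3.2.1
      have hs0 := mem_Sw.1 (hst _ _ hv)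
      have hs1 := mem_Qw.1 hs0.1
      have hB : ∀ y y', Stp t (Sw N M c l (c l + M + 2)) y y' → dist1 y y' = 1 ∧ (c l + M + 2 ≤ y' l ∧ y' l ≤ c l + (2 * M + 1)) ∧
          (wlo N M c j ≤ y' j ∧ y' j ≤ whi N M c j) := by
        intro y y' hy
        have q0 := mem_Sw.1 (Finset.mem_coe.1 hy.2.1)
        have q1 := mem_Qw.1 q0.1 j
        exact ⟨hy.2.2.1, ⟨by omega, by omega⟩, q1⟩
      obtain ⟨w, w1, w2⟩ := cross_meet hj.symm (a := c l + M + 2) (A := c l + (2 * M + 1)) (b := wlo N M c j)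
        (B := whi N M c j) (fun y y' ⟨k1, k2, k3, k4, k5⟩ => ⟨(hr _ _ k5).2.2, ⟨by omega, (k4 l).2⟩, inQ y' (hr _ _ k5).2.1 k4 j⟩) hB g5 (hen _ _ hv) (hf0 j) ⟨hs0.2.1, by omega⟩ (by omega) (by omega)
        ((hwo _ _ hv) j hj).1 ((hwo _ _ hv) j hj).2
      · refine ⟨w, ⟨l, _, hv, w2⟩, ?_⟩
        refine ReflTransGen.trans (rtg_mono (fun _ _ h => h.2.2) g1) (ReflTransGen.head g3.2.2 ?_)
        exact rtg_mono (fun _ _ h => h.2.2.2.2) w1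
    · have hdn : e l < c l - (2 * M + 1) := by
        by_contra hcon
        exact absurd (hl (by omega)) (by omega)
      have hv : Vld N M c l (c l - (2 * M + 1)) := Or.inr ⟨rfl, by omega⟩
      obtain ⟨x, f, g1, g2, g3, g4, g5⟩ := last_exit (P := fun x : V 2 => c l - (M + 1) ≤ x l) h1 (hzc l).1
        (by show ¬ _ ≤ a l; omega)
      have g6 := rtg_symm (fun x y h => (⟨h.2.1, h.1, h.2.2.2.1, h.2.2.1, hsym _ _ h.2.2.2.2⟩ :
        ¬ (c l - (M + 1) ≤ y l) ∧ ¬ (c l - (M + 1) ≤ x l) ∧ (∀ l, c l - (2 * M + 1) ≤ y l ∧ y l ≤ c l + (2 * M + 1)) ∧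
          (∀ l, c l - (2 * M + 1) ≤ x l ∧ x l ≤ c l + (2 * M + 1)) ∧ r y x)) g5
      have hxf := adj_k (hr _ _ g3.2.2).2.2 l
      have ha0 := inQ a (hr _ _ h3).1 h2
      have hs0 := mem_Sw.1 (hst _ _ hv)
      have hB : ∀ y y', Stp t (Sw N M c l (c l - (2 * M + 1))) y y' → dist1 y y' = 1 ∧ (c l - (2 * M + 1) ≤ y' l ∧ y' l ≤ c l - M - 2) ∧
          (wlo N M c j ≤ y' j ∧ y' j ≤ whi N M c j) := by
        intro y y' hy
        have q0 := mem_Sw.1 (Finset.mem_coe.1 hy.2.1)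
        have q1 := mem_Qw.1 q0.1 j
        exact ⟨hy.2.2.1, ⟨by omega, by omega⟩, q1⟩
      obtain ⟨w, w1, w2⟩ := cross_meet hj.symm (a := c l - (2 * M + 1)) (A := c l - M - 2) (b := wlo N M c j)
        (B := whi N M c j) (fun y y' ⟨k1, k2, k3, k4, k5⟩ => ⟨(hr _ _ k5).2.2, ⟨(k4 l).1, by omega⟩, inQ y' (hr _ _ k5).2.1 k4 j⟩) hB g6 (hen _ _ hv) (ha0 j) ⟨hs0.2.1, by omega⟩ (by omega) (by omega)
        ((hwo _ _ hv) j hj).1 ((hwo _ _ hv) j hj).2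
      · refine ⟨w, ⟨l, _, hv, w2⟩, hza.trans ?_⟩
        exact rtg_mono (fun _ _ h => h.2.2.2.2) w1

end Ring

section BadBlock
open Relation

set_option maxHeartbeats 800000 in
lemma crs_prob {δ p : ℝ} (h0 : 0 ≤ p) (h1 : p ≤ 1) {T L0 ℓ : ℕ} (hℓ : 1 ≤ ℓ) (hT : 1 ≤ T) (hL : L0 ≤ ℓ)
    (hδ : ∀ (lo hi : V 2), (∀ l, (L0 : ℤ) ≤ hi l - lo l) → ∀ i j, i ≠ j →
      hi i - lo i ≤ ((10 * T : ℕ) : ℤ) * (hi j - lo j) → ∀ G : Finset (V 2), (∀ x, x ∈ G ↔ ∀ l, lo l ≤ x l ∧ x l ≤ hi l) →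
      ∀ u ∈ G, ∀ v ∈ G, (∀ l, l ≠ i → u l = v l) → δ ≤ PrE p G (fun t => Cn t G u v))
    {M N : ℕ} (hM : M = T * (ℓ + 1)) (hN : 2 * (2 * (M : ℤ) + 1) ≤ 2 * N - 1) {c : V 2}
    (hc : ∀ l, -(N : ℤ) - M ≤ c l ∧ c l ≤ N - 1 + M) {l : Fin 2} {α : ℤ} (hv : Vld N M c l α) :
    Pr (fun _ => p) (Ed (Qw N M c)) (fun t => ¬ Crs N M c l α t) ≤ (1 - δ) ^ T := by
  classical
  have hW : IsW (fun _ : Sym2 (V 2) => p) := isW_const h0 h1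
  have hlen : ∀ j, (M : ℤ) + 1 ≤ whi N M c j - wlo N M c j ∧ whi N M c j - wlo N M c j ≤ 4 * M + 2 := by
    intro j
    have := hc j
    unfold whi wlo
    omega
  have hα : wlo N M c l ≤ α ∧ α + M - 1 ≤ whi N M c l := by
    have := hc l
    unfold whi wlo
    rcases hv with ⟨rfl, h⟩ | ⟨rfl, h⟩ <;> omega
  obtain ⟨j, hj⟩ : ∃ j : Fin 2, j ≠ l := exists_ne l
  let lo : ℕ → V 2 := fun q => Function.update (wlo N M c) l (α + q * (ℓ + 1))
  let hi : ℕ → V 2 := fun q => Function.update (whi N M c) l (α + q * (ℓ + 1) + ℓ)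
  let G : ℕ → Finset (V 2) := fun q => Finset.Icc (lo q) (hi q)
  have hG : ∀ q x, x ∈ G q ↔ ∀ l, lo q l ≤ x l ∧ x l ≤ hi q l := by
    intro q x
    simp only [G, Finset.mem_Icc, Pi.le_def]
    exact forall_and.symm
  have lol : ∀ q, lo q l = α + q * (ℓ + 1) := fun q => Function.update_self _ _ _
  have hil : ∀ q, hi q l = α + q * (ℓ + 1) + ℓ := fun q => Function.update_self _ _ _
  have loj : ∀ q i, i ≠ l → lo q i = wlo N M c i := fun q i h => Function.update_of_ne h _ _
  have hij : ∀ q i, i ≠ l → hi q i = whi N M c i := fun q i h => Function.update_of_ne h _ _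
  have hM1 : (M : ℤ) = T * (ℓ + 1) := by rw [hM]; push_cast; ring
  have hMl : (ℓ : ℤ) + 1 ≤ M := by rw [hM1]; nlinarith
  have hq : ∀ q, q < T → (0 : ℤ) ≤ q * (ℓ + 1) ∧ (q : ℤ) * (ℓ + 1) + ℓ + 1 ≤ M := by
    intro q hqT
    have : (q : ℤ) + 1 ≤ T := by exact_mod_cast hqT
    rw [hM1]
    constructor
    · positivity
    · nlinarith
  have hGS : ∀ q, q < T → G q ⊆ Sw N M c l α := by
    intro q hqT x hx
    rw [hG] at hx
    have h3 := hq q hqT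
    have h4 := hx l
    rw [lol, hil] at h4
    rw [mem_Sw, mem_Qw]
    refine ⟨?_, by omega, by omega⟩
    intro i
    by_cases hi' : i = l
    · subst hi'; omega
    · have := hx i
      rwa [loj q i hi', hij q i hi'] at this
  let u : ℕ → V 2 := lo
  let v : ℕ → V 2 := fun q => Function.update (lo q) j (whi N M c j)
  have vj : ∀ q, v q j = whi N M c j := fun q => Function.update_self _ _ _
  have vl : ∀ q i, i ≠ j → v q i = lo q i := fun q i h => Function.update_of_ne h _ _
  have hGu : ∀ q, u q ∈ G q := by
    intro q
    rw [hG]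
    intro i
    refine ⟨le_rfl, ?_⟩
    show lo q i ≤ hi q i
    by_cases hi' : i = l
    · subst hi'; rw [lol, hil]; omega
    · rw [loj q i hi', hij q i hi']; have := hlen i; omega
  have hGv : ∀ q, v q ∈ G q := by
    intro q
    rw [hG]
    intro i
    have h5 := (hG q _).1 (hGu q) i
    by_cases hi' : i = j
    · subst hi'; rw [vj, loj q i hj, hij q i hj]; have := hlen i; omega
    · rw [vl q i hi']; exact h5
  have key : ∀ q, δ ≤ PrE p (G q) (fun t => Cn t (G q) (u q) (v q)) := by
    intro q
    refine hδ (lo q) (hi q) ?_ j l hj ?_ (G q) (hG q) _ (hGu q) _ (hGv q) ?_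
    · intro i
      by_cases hi' : i = l
      · subst hi'; rw [lol, hil]; omega
      · rw [loj q i hi', hij q i hi']; have := hlen i; omega
    · rw [loj q j hj, hij q j hj, lol, hil]
      have := (hlen j).2
      push_cast
      have h6 : (1 : ℤ) ≤ T := by exact_mod_cast hT
      have h7 : (1 : ℤ) ≤ ℓ := by exact_mod_cast hℓ
      nlinarith [mul_nonneg (sub_nonneg.2 h6) (sub_nonneg.2 h7)]
    · intro i hi'
      rw [vl q i hi']
  have step : Pr (fun _ => p) (Ed (Qw N M c)) (fun t => ¬ Crs N M c l α t) ≤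
      Pr (fun _ => p) (Ed (Qw N M c)) (fun t => ∀ q ∈ Finset.range T, ¬ Cn t (G q) (u q) (v q)) := by
    refine Pr_mono hW fun t _ h q hqT hcon => h ?_
    have hs := hGS q (Finset.mem_range.1 hqT)
    refine ⟨u q, hs (hGu q), v q, hcon.mono le_rfl (by exact_mod_cast hs), ?_⟩
    intro i hi'
    have : i = j := by
      rcases two_cases hj i with h | h
      · exact h
      · exact absurd h hi'
    subst this
    exact ⟨loj q i hi', vj q⟩
  refine step.trans ?_
  rw [Pr_forall_indep (Finset.range T) (fun q => Ed (G q)) (fun q t => ¬ Cn t (G q) (u q) (v q))]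
  · calc _ ≤ ∏ q ∈ Finset.range T, (1 - δ) := by
          refine Finset.prod_le_prod (fun q _ => Pr_nonneg hW) fun q _ => ?_
          rw [Pr_not]
          have := key q
          unfold PrE at this
          linarith
      _ = _ := by rw [Finset.prod_const, Finset.card_range]
  · intro q hqT
    exact Ed_mono ((hGS q (Finset.mem_range.1 hqT)).trans (Finset.filter_subset _ _))
  · intro q hq1 q' hq2 hne
    rw [Finset.disjoint_left]
    intro e he he'
    induction e with | _ a b
    have e1 := (hG q a).1 (mem_Ed.1 he).1 l
    have e2 := (hG q' a).1 (mem_Ed.1 he').1 l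
    rw [lol, hil] at e1 e2
    rcases lt_or_gt_of_ne hne with h | h
    · have : (q : ℤ) + 1 ≤ q' := by exact_mod_cast h
      nlinarith
    · have : (q' : ℤ) + 1 ≤ q := by exact_mod_cast h
      nlinarith
  · intro q _ t _
    exact not_congr Cn_local

theorem bad_block {p1 p0 : ℝ} (h0 : 0 ≤ p1) (h1 : p1 < p0) (hp0 : p0 ≤ 1) {θ : ℝ} (hθ : 0 < θ)
    (hth : ∀ n, θ ≤ th 2 p1 n) {ε : ℝ} (hε : 0 < ε) :
    ∃ M : ℕ, 1 ≤ M ∧ ∀ N : ℕ, 2 * (2 * (M : ℤ) + 1) ≤ 2 * N - 1 → ∀ c : V 2,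
      (∀ l, -(N : ℤ) - M ≤ c l ∧ c l ≤ N - 1 + M) → ∀ p, p0 ≤ p → p ≤ 1 →
      Pr (fun _ => p) (Ed (Qw N M c)) (fun t => ¬ GoodB N M c t) ≤ ε := by
  classical
  obtain ⟨δ0, hδ0, hmcl⟩ := mcl h0 h1 hp0 hθ hth (by norm_num : 0 < 2)
  obtain ⟨δ, hδ1, hδ2, hδ3⟩ : ∃ δ : ℝ, 0 < δ ∧ δ ≤ δ0 ∧ δ ≤ 1 :=
    ⟨min δ0 1, lt_min hδ0 one_pos, min_le_left _ _, min_le_right _ _⟩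
  obtain ⟨T0, hT0⟩ := exists_pow_lt_of_lt_one (show 0 < ε / 4 by positivity) (show 1 - δ < 1 by linarith)
  obtain ⟨L0, hL0⟩ := hmcl (10 * (T0 + 1))
  refine ⟨(T0 + 1) * (L0 + 1 + 1), Nat.mul_pos (by omega) (by omega), ?_⟩
  intro N hN c hc p hp hp1
  have hW : IsW (fun _ : Sym2 (V 2) => p) := isW_const (by linarith) hp1
  have hpow : (1 - δ) ^ (T0 + 1) ≤ ε / 4 := by
    rw [pow_succ]
    have : 0 ≤ (1 - δ) ^ T0 := pow_nonneg (by linarith) _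
    nlinarith
  have each : ∀ l α, Vld N ((T0 + 1) * (L0 + 1 + 1)) c l α →
      Pr (fun _ => p) (Ed (Qw N ((T0 + 1) * (L0 + 1 + 1)) c)) (fun t => ¬ Crs N ((T0 + 1) * (L0 + 1 + 1)) c l α t) ≤ ε / 4 := by
    intro l α hv
    refine le_trans (crs_prob (δ := δ) (T := T0 + 1) (L0 := L0) (ℓ := L0 + 1) (by linarith) hp1 (by omega) (by omega)
      (by omega) ?_ rfl hN hc hv) hpow
    intro lo hi a1 i j a2 a3 G a4 u a5 v a6 a7
    exact hδ2.trans (hL0 lo hi a1 i j a2 a3 G a4 u a5 v a6 a7 p hp hp1)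
  generalize (T0 + 1) * (L0 + 1 + 1) = M at *
  let αf : Fin 2 × Bool → ℤ := fun q => if q.2 then c q.1 + M + 2 else c q.1 - (2 * M + 1)
  refine (Pr_union_le hW (Finset.univ : Finset (Fin 2 × Bool))
    (fun q t => Vld N M c q.1 (αf q) ∧ ¬ Crs N M c q.1 (αf q) t) ?_).trans ?_
  · intro t _ h
    unfold GoodB at h
    push Not at h
    obtain ⟨l, α, hv, hcr⟩ := h
    rcases hv with ⟨e, h'⟩ | ⟨e, h'⟩
    · refine ⟨(l, true), Finset.mem_univ _, ?_⟩
      have : αf (l, true) = α := by simp [αf, e]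
      rw [this]
      exact ⟨Or.inl ⟨e, h'⟩, hcr⟩
    · refine ⟨(l, false), Finset.mem_univ _, ?_⟩
      have : αf (l, false) = α := by simp [αf, e]
      rw [this]
      exact ⟨Or.inr ⟨e, h'⟩, hcr⟩
  · calc _ ≤ ∑ q : Fin 2 × Bool, ε / 4 := by
          refine Finset.sum_le_sum fun q _ => ?_
          by_cases hv : Vld N M c q.1 (αf q)
          · exact (Pr_mono hW fun t _ h => h.2).trans (each _ _ hv)
          · rw [Pr_false fun t _ h => hv h.1]; positivity
      _ = ε := by simp; ring

end BadBlock

section Decomp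
open Relation
variable {d : ℕ}

/-- Splitting a connected region into two lattice-connected pieces with no open edge in between. -/
theorem xy_decomp {G : Set (V d)} (hG : ∀ u ∈ G, ∀ v ∈ G, Cn Set.univ G u v) {t : Set (Sym2 (V d))} {x y0 : V d}
    (hx : x ∈ G) (hy0 : y0 ∈ G) (hxy : ¬ Cn t G x y0) :
    ∃ X Y : Set (V d), X ⊆ G ∧ Y ⊆ G ∧ x ∈ X ∧ y0 ∈ Y ∧ (∀ z ∈ G, z ∈ X ∨ z ∈ Y) ∧ (∀ z ∈ X, z ∉ Y) ∧
      (∀ z ∈ X, Cn Set.univ X x z) ∧ (∀ z ∈ Y, Cn Set.univ Y y0 z) ∧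
      (∀ o o', o ∈ X → Cn t G o o' → o' ∈ X) := by
  classical
  set C : Set (V d) := {z | Cn t G x z} with hC
  set Y : Set (V d) := {z | Cn Set.univ (G \ C) y0 z} with hY
  have hy0' : y0 ∈ G \ C := ⟨hy0, hxy⟩
  have hYs : ∀ z ∈ Y, z ∈ G \ C := fun z hz => Cn.mem hz hy0'
  have hxC : x ∈ C := Cn.refl x
  have hCG : C ⊆ G := fun z hz => Cn.mem hz hx
  have hCX : C ⊆ G \ Y := fun z hz => ⟨hCG hz, fun h => (hYs z h).2 hz⟩
  have hYadj : ∀ u v, u ∈ Y → v ∈ G → v ∉ C → dist1 u v = 1 → v ∈ Y := fun u v hu hv hvC h =>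
    ReflTransGen.tail (show ReflTransGen _ _ _ from hu) ⟨hYs u hu, ⟨hv, hvC⟩, h, Set.mem_univ _⟩
  have hCx : ∀ z ∈ C, Cn Set.univ (G \ Y) x z := by
    intro z hz
    have h1 : Cn t G x z := hz
    have h2 : z ∈ C ∧ Cn Set.univ (G \ Y) x z := by
      refine rtg_inv (P := fun z => z ∈ C ∧ Cn Set.univ (G \ Y) x z) h1 ⟨hxC, Cn.refl x⟩ ?_
      rintro a b ⟨ha, hab⟩ hs
      have hb : b ∈ C := ReflTransGen.tail (show ReflTransGen _ _ _ from ha) hs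
      exact ⟨hb, ReflTransGen.tail hab ⟨hCX ha, hCX hb, hs.2.2.1, Set.mem_univ _⟩⟩
    exact h2.2
  refine ⟨G \ Y, Y, Set.sdiff_subset, fun z hz => (hYs z hz).1, hCX hxC, Cn.refl y0, ?_, fun z hz => hz.2, ?_, ?_, ?_⟩
  · intro z hz
    by_cases h : z ∈ Y
    · exact Or.inr h
    · exact Or.inl ⟨hz, h⟩
  · intro z hz
    by_cases hzC : z ∈ C
    · exact hCx z hzC
    · obtain ⟨c, e, h1, h2, h3, h4, -⟩ := first_exit (P := fun w => w ∉ C) (hG z hz.1 x hx) hzC (by simpa using hxC)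
      have h5 : c ∉ Y ∧ Cn Set.univ (G \ Y) z c := by
        refine rtg_inv (P := fun w => w ∉ Y ∧ Cn Set.univ (G \ Y) z w) h1 ⟨hz.2, Cn.refl z⟩ ?_
        rintro a b ⟨ha, hab⟩ ⟨haC, hbC, hs⟩
        have hb : b ∉ Y := fun hb => ha (hYadj b a hb hs.1 haC (by rw [dist1_comm]; exact hs.2.2.1))
        exact ⟨hb, ReflTransGen.tail hab ⟨⟨hs.1, ha⟩, ⟨hs.2.1, hb⟩, hs.2.2.1, Set.mem_univ _⟩⟩
      have heC : e ∈ C := by simpa using h4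
      refine (hCx e heC).trans (Cn.symm ?_)
      exact ReflTransGen.tail h5.2 ⟨⟨h3.1, h5.1⟩, hCX heC, h3.2.2.1, Set.mem_univ _⟩
  · intro z hz
    have h2 : z ∈ Y ∧ Cn Set.univ Y y0 z := by
      refine rtg_inv (P := fun z => z ∈ Y ∧ Cn Set.univ Y y0 z) (show ReflTransGen _ _ _ from hz) ⟨Cn.refl y0, Cn.refl y0⟩ ?_
      rintro a b ⟨ha, hab⟩ hs
      have hb : b ∈ Y := ReflTransGen.tail (show ReflTransGen _ _ _ from ha) hs
      exact ⟨hb, ReflTransGen.tail hab ⟨ha, hb, hs.2.2.1, Set.mem_univ _⟩⟩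
    exact h2.2
  · intro o o' ho h
    refine rtg_inv h ho ?_
    intro a b ha hs
    refine ⟨hs.2.1, fun hb => ?_⟩
    by_cases haC : a ∈ C
    · exact (hYs b hb).2 (ReflTransGen.tail (show ReflTransGen _ _ _ from haC) hs)
    · exact ha.2 (hYadj b a hb hs.1 haC (by rw [dist1_comm]; exact hs.2.2.1))

/-- macroscopic site of a vertex -/
def mac (M : ℕ) (u : V 2) : ℤ × ℤ := ((u 0 + M) / (2 * M + 1), (u 1 + M) / (2 * M + 1))

/-- centre of a macroscopic site -/
def mctr (M : ℕ) (z : ℤ × ℤ) : V 2 := ![(2 * M + 1) * z.1, (2 * M + 1) * z.2]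

/-- macroscopic region -/
noncomputable def Rg (N M : ℕ) : Finset (ℤ × ℤ) := (GB 2 N).image (mac M)

/-- planar coordinates -/
def pl (u : V 2) : ℤ × ℤ := (u 0, u 1)

/-- inverse of `pl` -/
def unpl (z : ℤ × ℤ) : V 2 := ![z.1, z.2]

lemma unpl_pl (u : V 2) : unpl (pl u) = u := by
  funext i; fin_cases i <;> rfl

lemma pl_unpl (z : ℤ × ℤ) : pl (unpl z) = z := rfl

lemma pl_inj {u v : V 2} (h : pl u = pl v) : u = v := by
  rw [← unpl_pl u, h, unpl_pl]

lemma adj2_pl {u v : V 2} : adj2 (pl u) (pl v) ↔ dist1 u v = 1 := by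
  constructor
  · intro h
    unfold adj2 pl at h
    dsimp only at h
    unfold dist1
    rw [Fin.sum_univ_two]
    omega
  · intro h
    have := adj_two (i := 0) (j := 1) (by decide) h
    unfold adj2 pl
    dsimp only
    omega

lemma pl_mem_Rc {N : ℕ} {u : V 2} : pl u ∈ Rc (-(N : ℤ)) (-(N : ℤ)) (N - 1) (N - 1) ↔ u ∈ GB 2 N := by
  rw [mem_GB, mem_Rc, Fin.forall_fin_two]
  unfold pl
  dsimp only
  omega

lemma mctr_mac (M : ℕ) (u : V 2) (l : Fin 2) : mctr M (mac M u) l - M ≤ u l ∧ u l ≤ mctr M (mac M u) l + M := by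
  have key : ∀ a : ℤ, (2 * M + 1) * ((a + M) / (2 * (M : ℤ) + 1)) - M ≤ a ∧ a ≤ (2 * M + 1) * ((a + M) / (2 * (M : ℤ) + 1)) + M := by
    intro a
    have h1 := Int.mul_ediv_add_emod (a + M) (2 * (M : ℤ) + 1)
    have h2 := Int.emod_nonneg (a + M) (show (2 * (M : ℤ) + 1) ≠ 0 by omega)
    have h3 := Int.emod_lt_of_pos (a + M) (show 0 < (2 * (M : ℤ) + 1) by omega)
    constructor <;> linarith
  rcases two_cases (i := 0) (j := 1) (by decide) l with rfl | rfl
  · exact key (u 0)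
  · exact key (u 1)

lemma mac_star {M : ℕ} {a b : ℤ} (h : a ≤ b + 1) : (a + M) / (2 * (M : ℤ) + 1) ≤ (b + M) / (2 * (M : ℤ) + 1) + 1 := by
  calc (a + M) / (2 * (M : ℤ) + 1) ≤ (b + M + 1 * (2 * (M : ℤ) + 1)) / (2 * (M : ℤ) + 1) :=
        Int.ediv_le_ediv (by omega) (by omega)
    _ = _ := Int.add_mul_ediv_right _ _ (by omega)

lemma mac_far {M m : ℕ} {a b : ℤ} (h : a + m ≤ b) :
    (a + M) / (2 * (M : ℤ) + 1) + ((3 * (m / (2 * M + 1) / 3) : ℕ) : ℤ) ≤ (b + M) / (2 * (M : ℤ) + 1) := by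
  rw [← Int.add_mul_ediv_right _ _ (show (2 * (M : ℤ) + 1) ≠ 0 by omega)]
  refine Int.ediv_le_ediv (by omega) ?_
  have h1 : 3 * (m / (2 * M + 1) / 3) ≤ m / (2 * M + 1) := Nat.mul_div_le _ _
  have h2 : m / (2 * M + 1) * (2 * M + 1) ≤ m := Nat.div_mul_le_self _ _
  have h3 : 3 * (m / (2 * M + 1) / 3) * (2 * M + 1) ≤ m := (Nat.mul_le_mul_right _ h1).trans h2
  have h4 : ((3 * (m / (2 * M + 1) / 3) : ℕ) : ℤ) * (2 * (M : ℤ) + 1) ≤ m := by exact_mod_cast h3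
  linarith

end Decomp

section Arm
open Relation

lemma GB_conn {d N : ℕ} : ∀ u ∈ (GB d N : Set (V d)), ∀ v ∈ (GB d N : Set (V d)), Cn Set.univ (GB d N) u v := by
  intro u hu v hv
  have hu' := mem_GB.1 (Finset.mem_coe.1 hu)
  have hv' := mem_GB.1 (Finset.mem_coe.1 hv)
  exact Cn_box (lo := fun _ => -(N : ℤ)) (hi := fun _ => (N : ℤ) - 1)
    (fun x h1 h2 => Finset.mem_coe.2 (mem_GB.2 fun k => ⟨h1 k, h2 k⟩)) (fun _ _ _ _ _ _ _ => Set.mem_univ _) u v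
    (fun k => (hu' k).1) (fun k => (hu' k).2) (fun k => (hv' k).1) (fun k => (hv' k).2)

/-- level set segment -/
lemma GB_level_conn {d N : ℕ} {k : Fin d} {u v : V d} (hu : u ∈ GB d N) (hv : v ∈ GB d N) (h : v k = u k) :
    Cn Set.univ {z | z ∈ GB d N ∧ z k = u k} u v := by
  classical
  rw [mem_GB] at hu hv
  refine Cn_box (lo := Function.update (fun _ => -(N : ℤ)) k (u k)) (hi := Function.update (fun _ => (N : ℤ) - 1) k (u k))
    ?_ (fun _ _ _ _ _ _ _ => Set.mem_univ _) u v ?_ ?_ ?_ ?_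
  · intro x h1 h2
    have e1 := h1 k
    have e2 := h2 k
    rw [Function.update_self] at e1 e2
    refine ⟨mem_GB.2 fun i => ?_, le_antisymm e2 e1⟩
    by_cases hi : i = k
    · subst hi; have := hu i; constructor <;> linarith
    · have f1 := h1 i
      have f2 := h2 i
      rw [Function.update_of_ne hi] at f1 f2
      exact ⟨f1, f2⟩
  all_goals
    intro i
    by_cases hi : i = k
    · subst hi; rw [Function.update_self]; try linarith
    · rw [Function.update_of_ne hi]
      first | exact (hu i).1 | exact (hu i).2 | exact (hv i).1 | exact (hv i).2

set_option maxHeartbeats 1000000 in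
theorem td_arm {N M m : ℕ} {t : Set (Sym2 (V 2))} (hM : 1 ≤ M) (hm : 2 * (2 * M + 1) + 1 ≤ m) (h : TD 2 N m t) :
    ∃ w ∈ Rg N M, SArm {z | ¬ (¬ GoodB N M (mctr M z) t)} (Rg N M) w (3 * (m / (2 * M + 1) / 3)) := by
  classical
  have hext := TD_extent h
  have hN : 2 * (2 * (M : ℤ) + 1) ≤ 2 * N - 1 := by omega
  obtain ⟨y0, hy0, hcr, x, hx, x', k, hxx', hmk, hno⟩ := h
  obtain ⟨X, Y, hXG, hYG, hxX, hyY, hXY, hdis, hX, hY, hcl⟩ := xy_decomp GB_conn (Finset.mem_coe.2 hx) (Finset.mem_coe.2 hy0) hno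
  have hYc : ∀ z, Cn t (GB 2 N) y0 z → z ∈ Y := by
    intro z hz
    rcases hXY z (hz.mem (Finset.mem_coe.2 hy0)) with h1 | h1
    · exact absurd hyY (hdis _ (hcl _ _ h1 hz.symm))
    · exact h1
  have hx'X : x' ∈ X := hcl _ _ hxX hxx'
  let F : Finset (Sym2 (ℤ × ℤ)) := ((Ed (GB 2 N)).filter (fun e => ∃ u ∈ X, ∃ v ∈ Y, e = s(u, v))).image (Sym2.map pl)
  have memF : ∀ e, e ∈ F ↔ ∃ u ∈ X, ∃ v ∈ Y, dist1 u v = 1 ∧ e = s(pl u, pl v) := by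
    intro e
    simp only [F, Finset.mem_image, Finset.mem_filter]
    constructor
    · rintro ⟨e', ⟨h1, u, hu, v, hv, rfl⟩, rfl⟩
      exact ⟨u, hu, v, hv, (mem_Ed.1 h1).2.2, rfl⟩
    · rintro ⟨u, hu, v, hv, h1, rfl⟩
      exact ⟨s(u, v), ⟨mem_Ed.2 ⟨hXG hu, hYG hv, h1⟩, u, hu, v, hv, rfl⟩, rfl⟩
  set R := Rc (-(N : ℤ)) (-(N : ℤ)) (N - 1) (N - 1) with hR
  have hsep : ¬ ReflTransGen (StF R (F : Set (Sym2 (ℤ × ℤ)))) (pl x) (pl y0) := by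
    intro hcon
    have := rtg_inv (P := fun z => unpl z ∈ X) hcon (by rw [unpl_pl]; exact hxX) (by
      intro a b ha hs
      have hb : unpl b ∈ GB 2 N := by rw [← pl_mem_Rc, pl_unpl]; exact hs.2.1
      rcases hXY _ (Finset.mem_coe.2 hb) with h1 | h1
      · exact h1
      · refine absurd ?_ hs.2.2.2
        refine Finset.mem_coe.2 ((memF _).2 ⟨_, ha, _, h1, ?_, ?_⟩)
        · rw [← adj2_pl, pl_unpl, pl_unpl]; exact hs.2.2.1
        · rw [pl_unpl, pl_unpl])
    rw [unpl_pl] at this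
    exact hdis _ this hyY
  obtain ⟨K, hKF, hKsep, hKc⟩ := sep_component F hsep
  have inner : ∀ e ∈ K, ∀ u v, e = s(pl u, pl v) → ¬ (u ∈ X ∧ v ∈ X) ∧ ¬ (u ∈ Y ∧ v ∈ Y) := by
    intro e he u v huv
    obtain ⟨u', hu', v', hv', -, h2⟩ := (memF e).1 (hKF he)
    rw [huv, Sym2.eq_iff] at h2
    rcases h2 with ⟨e1, e2⟩ | ⟨e1, e2⟩
    · have e1 := pl_inj e1
      have e2 := pl_inj e2
      subst e1 e2
      exact ⟨fun h => hdis _ h.2 hv', fun h => hdis _ hu' h.1⟩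
    · have e1 := pl_inj e1
      have e2 := pl_inj e2
      subst e1 e2
      exact ⟨fun h => hdis _ h.1 hv', fun h => hdis _ hu' h.2⟩
  have liftX : ∀ z ∈ X, ReflTransGen (StF R (K : Set (Sym2 (ℤ × ℤ)))) (pl x) (pl z) := by
    intro z hz
    refine rtg_lift pl ?_ (hX z hz)
    intro a b hs
    refine ⟨pl_mem_Rc.2 (hXG hs.1), pl_mem_Rc.2 (hXG hs.2.1), adj2_pl.2 hs.2.2.1, fun hc => ?_⟩
    exact (inner _ hc a b rfl).1 ⟨hs.1, hs.2.1⟩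
  have liftY : ∀ z ∈ Y, ReflTransGen (StF R (K : Set (Sym2 (ℤ × ℤ)))) (pl z) (pl y0) := by
    intro z hz
    refine rtg_lift pl ?_ (hY z hz).symm
    intro a b hs
    refine ⟨pl_mem_Rc.2 (hYG hs.1), pl_mem_Rc.2 (hYG hs.2.1), adj2_pl.2 hs.2.2.1, fun hc => ?_⟩
    exact (inner _ hc a b rfl).2 ⟨hs.1, hs.2.1⟩
  -- edges of the cut at given levels
  have level : ∀ w ∈ X, ∃ e ∈ K, ∀ u, pl u ∈ e → u k = w k := by
    intro w hw
    have hwG : w ∈ GB 2 N := hXG hw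
    obtain ⟨a, b, ha, hb, hak, hbk⟩ := hcr k
    have haG : a ∈ GB 2 N := Finset.mem_coe.1 (ha.mem (Finset.mem_coe.2 hy0))
    have hwk := mem_GB.1 hwG k
    obtain ⟨w', hw'k, hw'⟩ := UpTo_of (GB 2 N : Set (V 2)) le_rfl (ha.symm.trans hb) haG (h := w k) (k := k) (by omega) (by omega)
    have hw'c : Cn t (GB 2 N) y0 w' := ha.trans (hw'.mono le_rfl (by
      intro z hz; exact Finset.mem_coe.2 (Finset.mem_filter.1 (Finset.mem_coe.1 hz)).1))
    have hw'Y := hYc w' hw'c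
    by_contra hcon
    push Not at hcon
    refine hKsep ((liftX w hw).trans (ReflTransGen.trans ?_ (liftY w' hw'Y)))
    refine rtg_lift pl ?_ (GB_level_conn hwG (hYG hw'Y) hw'k)
    intro p q hs
    refine ⟨pl_mem_Rc.2 hs.1.1, pl_mem_Rc.2 hs.2.1.1, adj2_pl.2 hs.2.2.1, fun hc => ?_⟩
    obtain ⟨u, hu, huk⟩ := hcon _ (Finset.mem_coe.1 hc)
    rw [Sym2.mem_iff] at hu
    rcases hu with hu | hu
    · rw [pl_inj hu] at huk; exact huk hs.1.2
    · rw [pl_inj hu] at huk; exact huk hs.2.1.2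
  obtain ⟨e1, he1, hl1⟩ := level x hxX
  obtain ⟨e2, he2, hl2⟩ := level x' hx'X
  have hends : ∀ e, ∃ u v, e ∈ K → (u ∈ X ∧ v ∈ Y ∧ dist1 u v = 1 ∧ e = s(pl u, pl v)) := by
    intro e
    by_cases he : e ∈ K
    · obtain ⟨u, hu, v, hv, h1, h2⟩ := (memF e).1 (hKF he)
      exact ⟨u, v, fun _ => ⟨hu, hv, h1, h2⟩⟩
    · exact ⟨0, 0, fun h => absurd h he⟩
  choose g g' hgg using hends
  have mem_of : ∀ (a b : ℤ × ℤ) (e : Sym2 (ℤ × ℤ)), e = s(a, b) → a ∈ e ∧ b ∈ e := by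
    rintro a b e rfl
    exact ⟨Sym2.mem_mk_left _ _, Sym2.mem_mk_right _ _⟩
  have mg : ∀ e ∈ K, pl (g e) ∈ e := fun e he => (mem_of _ _ _ (hgg e he).2.2.2).1
  have mg' : ∀ e ∈ K, pl (g' e) ∈ e := fun e he => (mem_of _ _ _ (hgg e he).2.2.2).2
  have g1k : g e1 k = x k := hl1 _ (mg _ he1)
  have g1k' : g' e1 k = x k := hl1 _ (mg' _ he1)
  have g2k : g e2 k = x' k := hl2 _ (mg _ he2)
  have g2k' : g' e2 k = x' k := hl2 _ (mg' _ he2)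
  have far : ∀ c : ℤ, (x k < c - (2 * M + 1) ∨ c + (2 * M + 1) < x k) ∨ (x' k < c - (2 * M + 1) ∨ c + (2 * M + 1) < x' k) := by
    intro c; omega
  have bad : ∀ e ∈ K, ¬ GoodB N M (mctr M (mac M (g e))) t := by
    intro e he hg
    obtain ⟨hu, hv, huv, -⟩ := hgg e he
    have hc := mctr_mac M (g e)
    generalize mctr M (mac M (g e)) = c at *
    obtain ⟨O, hO1, hO2⟩ := good_ring hg hN hM
    by_cases hOX : ∃ o ∈ O, o ∈ X
    · obtain ⟨o, ho, hoX⟩ := hOX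
      have := hO2 (Stp Set.univ Y) (fun _ _ h => h.symm) (fun u v h => ⟨hYG h.1, hYG h.2.1, h.2.2.1⟩) (g' e)
      obtain ⟨z', hz'Y, hz'⟩ : ∃ z' ∈ Y, ∃ l, z' l < c l - (2 * M + 1) ∨ c l + (2 * M + 1) < z' l := by
        rcases far (c k) with h1 | h1
        · exact ⟨g' e1, (hgg e1 he1).2.1, k, by rw [g1k']; exact h1⟩
        · exact ⟨g' e2, (hgg e2 he2).2.1, k, by rw [g2k']; exact h1⟩
      obtain ⟨w, hw, hcw⟩ := this z' (hYG hv) (fun l => by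
        have a1 := hc l
        have a2 := adj_k huv l
        constructor <;> omega) hz' ((hY _ hv).symm.trans (hY _ hz'Y))
      have hwY : w ∈ Y := Cn.mem hcw hv
      exact hdis _ (hcl _ _ hoX (hO1 _ ho _ hw)) hwY
    · have := hO2 (Stp Set.univ X) (fun _ _ h => h.symm) (fun u v h => ⟨hXG h.1, hXG h.2.1, h.2.2.1⟩) (g e)
      obtain ⟨z', hz'Y, hz'⟩ : ∃ z' ∈ X, ∃ l, z' l < c l - (2 * M + 1) ∨ c l + (2 * M + 1) < z' l := by
        rcases far (c k) with h1 | h1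
        · exact ⟨g e1, (hgg e1 he1).1, k, by rw [g1k]; exact h1⟩
        · exact ⟨g e2, (hgg e2 he2).1, k, by rw [g2k]; exact h1⟩
      obtain ⟨w, hw, hcw⟩ := this z' (hXG hu) (fun l => by
        have a1 := hc l
        constructor <;> omega) hz' ((hX _ hu).symm.trans (hX _ hz'Y))
      exact hOX ⟨w, hw, Cn.mem hcw hu⟩
  have inR : ∀ e ∈ K, mac M (g e) ∈ Rg N M := fun e he =>
    Finset.mem_image_of_mem _ (hXG (hgg e he).1)
  refine ⟨mac M (g e1), inR _ he1, Finset.mem_coe.2 (inR _ he1), fun h => h (bad _ he1), mac M (g e2), ?_, ?_⟩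
  · refine rtg_lift (fun e => mac M (g e)) ?_ (hKc e1 he1 e2 he2)
    rintro a b ⟨ha, hb, c, -, -, -, -, hca, hcb⟩
    refine ⟨⟨Finset.mem_coe.2 (inR _ ha), fun h => h (bad _ ha)⟩, ⟨Finset.mem_coe.2 (inR _ hb), fun h => h (bad _ hb)⟩, ?_⟩
    have a1 := sq_vertex hca (p := pl (g a)) (mg _ ha)
    have b1 := sq_vertex hcb (p := pl (g b)) (mg _ hb)
    unfold pl at a1 b1
    dsimp only at a1 b1
    exact ⟨⟨mac_star (by omega), mac_star (by omega)⟩, mac_star (by omega), mac_star (by omega)⟩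
  · have hfar : g e1 k + m ≤ g e2 k := by omega
    rcases two_cases (i := 0) (j := 1) (by decide) k with rfl | rfl
    · exact Or.inl (mac_far hfar)
    · exact Or.inr (Or.inr (Or.inl (mac_far hfar)))

end Arm

section Two
open Relation

theorem td_bound2 {p1 p0 : ℝ} (h0 : 0 ≤ p1) (h1 : p1 < p0) (hp0 : p0 ≤ 1) {θ : ℝ} (hθ : 0 < θ)
    (hth : ∀ n, θ ≤ th 2 p1 n) :
    ∃ (L : ℕ) (ρ K : ℝ), 1 ≤ L ∧ 0 < ρ ∧ ρ < 1 ∧ 0 < K ∧ ∀ p, p0 ≤ p → p ≤ 1 → ∀ N, 1 ≤ N → ∀ m,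
      PrE p (GB 2 N) (TD 2 N m) ≤ K * (N : ℝ) ^ (2 * 2) * ρ ^ (m / L) := by
  classical
  obtain ⟨M, hM, hbad⟩ := bad_block h0 h1 hp0 hθ hth (show (0 : ℝ) < 1 / 98 by norm_num)
  refine ⟨(2 * M + 1) * 3, 1 / 2, 4, by omega, by norm_num, by norm_num, by norm_num, ?_⟩
  intro p hp hp1 N hN m
  have hW : IsW (fun _ : Sym2 (V 2) => p) := isW_const (by linarith) hp1
  have hN1 : (1 : ℝ) ≤ N := by exact_mod_cast hN
  rw [← Nat.div_div_eq_div_mul]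
  unfold PrE
  have hN4 : (1 : ℝ) ≤ (N : ℝ) ^ (2 * 2) := one_le_pow₀ hN1
  by_cases hm : 2 * (2 * M + 1) + 1 ≤ m
  · by_cases hm2 : (m : ℤ) ≤ 2 * N - 1
    · have hcard : ((Rg N M).card : ℝ) ≤ 4 * (N : ℝ) ^ (2 * 2) := by
        have e1 : (Rg N M).card ≤ (2 * N) ^ 2 := by
          rw [← card_GB (d := 2)]; exact Finset.card_image_le
        have e2 : ((Rg N M).card : ℝ) ≤ (2 * (N : ℝ)) ^ 2 := by exact_mod_cast e1
        have e3 : (N : ℝ) ^ 2 ≤ (N : ℝ) ^ (2 * 2) := pow_le_pow_right₀ hN1 (by norm_num)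
        calc _ ≤ _ := e2
          _ = 4 * (N : ℝ) ^ 2 := by ring
          _ ≤ _ := by linarith
      refine (Pr_union_le hW (Rg N M) (fun w t => SArm {z | ¬ (¬ GoodB N M (mctr M z) t)} (Rg N M) w (3 * (m / (2 * M + 1) / 3)))
        (fun t _ h => td_arm hM hm h)).trans ?_
      have each : ∀ w ∈ Rg N M, Pr (fun _ => p) (Ed (GB 2 N))
          (fun t => SArm {z | ¬ (¬ GoodB N M (mctr M z) t)} (Rg N M) w (3 * (m / (2 * M + 1) / 3))) ≤
            (1 / 2 : ℝ) ^ (m / (2 * M + 1) / 3) := by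
        intro w _
        have hb := BArm_bound hW (s := Ed (GB 2 N)) (fun z => Ed (Qw N M (mctr M z)))
          (fun z t => ¬ GoodB N M (mctr M z) t) (ε := 1 / 98) (by norm_num) (m / (2 * M + 1) / 3) (Rg N M)
          (fun z _ => Ed_mono Qw_sub) (fun z _ t => not_congr GoodB_local) ?_ ?_ w
        · refine hb.trans (le_of_eq ?_)
          norm_num
        · intro z _ z' _ hfar
          rw [Finset.disjoint_left]
          intro e he he'
          induction e with | _ a b
          have a1 := mem_Qw.1 (mem_Ed.1 he).1
          have a2 := mem_Qw.1 (mem_Ed.1 he').1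
          have b0 : wlo N M (mctr M z) 0 ≤ a 0 ∧ a 0 ≤ whi N M (mctr M z) 0 := a1 0
          have b1 : wlo N M (mctr M z) 1 ≤ a 1 ∧ a 1 ≤ whi N M (mctr M z) 1 := a1 1
          have c0 : wlo N M (mctr M z') 0 ≤ a 0 ∧ a 0 ≤ whi N M (mctr M z') 0 := a2 0
          have c1 : wlo N M (mctr M z') 1 ≤ a 1 ∧ a 1 ≤ whi N M (mctr M z') 1 := a2 1
          unfold wlo whi at b0 b1 c0 c1
          simp only [mctr, Matrix.cons_val_zero, Matrix.cons_val_one, max_le_iff, le_min_iff] at b0 b1 c0 c1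
          have hL : (1 : ℤ) ≤ 2 * M + 1 := by omega
          rcases hfar with h | h | h | h <;> push_cast at h <;> nlinarith
        · intro z hz
          obtain ⟨u, hu, rfl⟩ := Finset.mem_image.1 hz
          rw [Pr_local (A := fun t => ¬ GoodB N M (mctr M (mac M u)) t) (Ed_mono Qw_sub) (fun t _ => not_congr GoodB_local)]
          refine hbad N (by omega) _ ?_ p hp hp1
          intro l
          have e1 := mctr_mac M u l
          have e2 := mem_GB.1 hu l
          omega
      calc _ ≤ ∑ w ∈ Rg N M, (1 / 2 : ℝ) ^ (m / (2 * M + 1) / 3) := Finset.sum_le_sum each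
        _ = (Rg N M).card * (1 / 2 : ℝ) ^ (m / (2 * M + 1) / 3) := by rw [Finset.sum_const, nsmul_eq_mul]
        _ ≤ _ := mul_le_mul_of_nonneg_right hcard (by positivity)
    · rw [Pr_false fun t _ h => hm2 (TD_extent h)]
      positivity
  · have : m / (2 * M + 1) / 3 = 0 := by
      rw [Nat.div_div_eq_div_mul, Nat.div_eq_of_lt (by omega)]
    rw [this, pow_zero, mul_one]
    have := Pr_le_one hW (s := Ed (GB 2 N)) (A := TD 2 N m)
    linarith

end Two

section Assembly
open Relation
variable {d : ℕ}

/-- the set of open edges -/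
def opn (ω : Config d) : Set (Sym2 (V d)) := {e | openE ω e}

lemma P_le (F : BernoulliFamily d) {p : ℝ} (h0 : 0 ≤ p) (h1 : p ≤ 1) (S : Finset (V d)) (A : Set (Sym2 (V d)) → Prop)
    (Ev : Set (Config d)) (h : ∀ ω ∈ Ev, A (opn ω ∩ Ed S)) : F.P p Ev ≤ ENNReal.ofReal (PrE p S A) := by
  classical
  let s' : Finset (Edge d) := (Ed S).subtype (fun e => sym2dist1 e = 1)
  let f : Finset (Sym2 (V d)) → Edge d → Bool := fun t e => decide (e.1 ∈ t)
  let Cy : Finset (Sym2 (V d)) → Set (Config d) := fun t => {ω | ∀ e ∈ s', ω e = f t e}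
  let W : Finset (Finset (Sym2 (V d))) := (Ed S).powerset.filter (fun t : Finset (Sym2 (V d)) => A (t : Set (Sym2 (V d))))
  have hsub : Ev ⊆ ⋃ t ∈ W, Cy t := by
    intro ω hω
    let t := (Ed S).filter (fun e => openE ω e)
    have ht : (t : Set (Sym2 (V d))) = opn ω ∩ Ed S := by
      ext e
      simp only [t, Finset.coe_filter, opn]
      exact and_comm
    rw [Set.mem_iUnion₂]
    refine ⟨t, ?_, ?_⟩
    · refine Finset.mem_filter.2 ⟨Finset.mem_powerset.2 (Finset.filter_subset _ _), ?_⟩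
      rw [ht]
      exact h ω hω
    · intro e he
      have heS : e.1 ∈ Ed S := Finset.mem_subtype.1 he
      show ω e = decide (e.1 ∈ t)
      have h3 : e.1 ∈ t ↔ ω e = true := by
        rw [Finset.mem_filter]
        constructor
        · rintro ⟨-, hh, h4⟩
          exact h4
        · intro h4
          exact ⟨heS, e.2, h4⟩
      by_cases h4 : ω e = true
      · rw [h4]; exact (decide_eq_true (h3.2 h4)).symm
      · rw [decide_eq_false (fun h5 => h4 (h3.1 h5))]
        simpa using h4
  have hprod : ∀ t, F.P p (Cy t) = ENNReal.ofReal (∏ i ∈ Ed S, if i ∈ t then p else 1 - p) := by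
    intro t
    rw [ENNReal.ofReal_prod_of_nonneg (fun i _ => by split <;> linarith)]
    rw [show F.P p (Cy t) = _ from F.iid p h0 h1 s' (f t)]
    rw [← Finset.prod_subtype_of_mem (p := fun e => sym2dist1 e = 1) (fun i => ENNReal.ofReal (if i ∈ t then p else 1 - p))]
    · refine Finset.prod_congr rfl fun e _ => ?_
      by_cases he : e.1 ∈ t
      · simp [f, he]
      · simp [f, he]
    · intro e he
      induction e with | _ a b
      rw [sym2dist1_mk]
      exact (mem_Ed.1 he).2.2
  calc F.P p Ev ≤ F.P p (⋃ t ∈ W, Cy t) := measure_mono hsub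
    _ ≤ ∑ t ∈ W, F.P p (Cy t) := measure_biUnion_finset_le _ _
    _ = ∑ t ∈ W, ENNReal.ofReal (∏ i ∈ Ed S, if i ∈ t then p else 1 - p) := Finset.sum_congr rfl fun t _ => hprod t
    _ = ENNReal.ofReal (∑ t ∈ W, ∏ i ∈ Ed S, if i ∈ t then p else 1 - p) := by
        rw [ENNReal.ofReal_sum_of_nonneg]
        intro t _
        exact Finset.prod_nonneg fun i _ => by split <;> linarith
    _ = ENNReal.ofReal (PrE p S A) := by
        congr 1
        unfold PrE Pr Ex
        rw [Finset.sum_filter]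
        refine Finset.sum_congr rfl fun t _ => ?_
        by_cases hA : A (t : Set (Sym2 (V d)))
        · simp only [hA, ind, if_true, mul_one]
        · simp [hA, ind]

lemma open_dist {ω : Config d} {x y : V d} (h : edgeOpen ω x y) : dist1 x y = 1 := by
  obtain ⟨h1, -⟩ := h
  rwa [sym2dist1_mk] at h1

lemma Cn_of_path {ω : Config d} {n : ℕ} {f : ℕ → V d} {S : Set (V d)} (hf : IsOpenPath ω n f) (hS : ∀ i ≤ n, f i ∈ S) :
    Cn (opn ω) S (f 0) (f n) :=
  path_rtg (n := n) (fun i hi => ⟨hS i (by omega), hS (i + 1) (by omega), open_dist (hf i hi), hf i hi⟩) (Nat.zero_le n) le_rfl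

lemma connIn_iff {ω : Config d} {S : Set (V d)} {x y : V d} (hx : x ∈ S) : ConnectedIn ω S x y ↔ Cn (opn ω) S x y := by
  constructor
  · rintro ⟨n, f, ⟨h1, h2⟩, rfl, rfl⟩
    exact Cn_of_path h1 h2
  · intro h
    obtain ⟨n, f, h1, h2, h3⟩ := rtg_path h
    refine ⟨n, f, ⟨fun i hi => (h3 i hi).2.2.2, fun i hi => ?_⟩, h1, h2⟩
    rcases Nat.lt_or_ge i n with h | h
    · exact (h3 i h).1
    · have : i = n := le_antisymm hi h
      subst this
      rw [h2]
      exact Cn.mem (by assumption) hx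

lemma conn_iff {ω : Config d} {x y : V d} : Connected ω x y ↔ Cn (opn ω) Set.univ x y := by
  unfold Connected chemDist
  constructor
  · intro h
    by_contra hcon
    apply h
    rw [sInf_eq_top]
    rintro r ⟨n, f, h1, rfl, rfl, -⟩
    exact absurd (Cn_of_path h1 fun _ _ => Set.mem_univ _) hcon
  · intro h
    obtain ⟨n, f, h1, h2, h3⟩ := rtg_path h
    refine ne_top_of_le_ne_top (ENNReal.natCast_ne_top n) (sInf_le ?_)
    exact ⟨n, f, fun i hi => (h3 i hi).2.2.2, h1, h2, rfl⟩

lemma th_ge (F : BernoulliFamily d) {p : ℝ} (h0 : 0 ≤ p) (h1 : p ≤ 1) (n : ℕ) :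
    (F.P p {ω : Config d | InInfiniteCluster ω 0}).toReal ≤ th d p n := by
  have hW : IsW (fun _ : Sym2 (V d) => p) := isW_const h0 h1
  refine ENNReal.toReal_le_of_le_ofReal (show 0 ≤ th d p n by unfold th PrE; exact Pr_nonneg hW)
    (P_le F h0 h1 (Bx d n) (fun t => ∃ v, Bd n v ∧ Cn t (Bx d n) 0 v) _ ?_)
  intro ω hω
  have hinf : (cluster ω 0).Infinite := hω
  obtain ⟨y, hy, hyB⟩ : ∃ y ∈ cluster ω 0, y ∉ (Bx d n : Set (V d)) := by
    by_contra hcon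
    push Not at hcon
    exact hinf ((Bx d n).finite_toSet.subset hcon)
  obtain ⟨c, e, a1, a2, a3, a4, -⟩ := first_exit (P := fun z => z ∈ Bx d n) (conn_iff.1 hy) (zero_mem_Bx n) hyB
  refine ⟨c, Bd_of_exit a2 a4 a3.2.2.1, Cn_local.1 ?_⟩
  exact rtg_mono (fun u v h => ⟨h.1, h.2.1, h.2.2.2.2.1, h.2.2.2.2.2⟩) a1

lemma one_mem (F : BernoulliFamily d) (hd : 0 < d) : 0 < F.P 1 {ω : Config d | InInfiniteCluster ω 0} := by
  have := F.prob 1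
  have : Countable (Edge d) := by unfold Edge; infer_instance
  have hsub : (Set.univ : Set (Config d)) ⊆ {ω : Config d | InInfiniteCluster ω 0} ∪ ⋃ e : Edge d, {ω | ω e = false} := by
    intro ω _
    by_cases hω : ∀ e, ω e = true
    · left
      have hall : cluster ω 0 = Set.univ := by
        refine Set.eq_univ_of_forall fun y => conn_iff.2 ?_
        refine Cn_box (lo := 0 ⊓ y) (hi := 0 ⊔ y) (fun _ _ _ => Set.mem_univ _) ?_ 0 y inf_le_left le_sup_left
          inf_le_right le_sup_right
        intro a b _ _ _ _ hab
        exact ⟨by rw [sym2dist1_mk]; exact hab, hω _⟩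
      show (cluster ω 0).Infinite
      rw [hall]
      have : Nonempty (Fin d) := ⟨⟨0, hd⟩⟩
      exact Set.infinite_univ
    · right
      push Not at hω
      obtain ⟨e, he⟩ := hω
      exact Set.mem_iUnion.2 ⟨e, by simpa using he⟩
  have hnull : F.P 1 (⋃ e : Edge d, {ω : Config d | ω e = false}) = 0 := by
    rw [measure_iUnion_null_iff]
    intro e
    have := F.iid 1 zero_le_one le_rfl {e} (fun _ => false)
    simpa using this
  have h1 : F.P 1 Set.univ ≤ _ := (measure_mono hsub).trans (measure_union_le _ _)
  rw [hnull, add_zero, measure_univ] at h1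
  exact lt_of_lt_of_le one_pos h1

lemma macroBox_eq {N : ℕ} : macroBox N (0 : V d) = (GB d N : Set (V d)) := by
  ext x
  rw [Finset.mem_coe, mem_GB]
  unfold macroBox boxC center
  refine forall_congr' fun k => ?_
  simp only [Pi.zero_apply, zero_mul]
  omega

lemma TD_of {N m : ℕ} {ω : Config d} (h : ∃ C : Set (V d),
    IsClusterIn ω (macroBox N 0) C ∧ CrossingFor ω C (center N 0) N ∧
    ∃ C' : Set (V d), IsClusterIn ω (macroBox N 0) C' ∧ C' ≠ C ∧ diamGE C' m) : TD d N m (opn ω ∩ Ed (GB d N)) := by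
  obtain ⟨C, ⟨y0, hy0, rfl⟩, hcr, C', ⟨x0, hx0, rfl⟩, hne, u, hu, v, hv, k, huv⟩ := h
  rw [macroBox_eq] at *
  have loc : ∀ a b, Cn (opn ω) (GB d N) a b ↔ Cn (opn ω ∩ Ed (GB d N)) (GB d N) a b := fun a b => Cn_local
  unfold TD
  simp only [← loc]
  have hu' : Cn (opn ω) (GB d N) x0 u := (connIn_iff hx0).1 hu
  have hv' : Cn (opn ω) (GB d N) x0 v := (connIn_iff hx0).1 hv
  have hno : ¬ Cn (opn ω) (GB d N) x0 y0 := by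
    intro hcon
    apply hne
    ext z
    show ConnectedIn ω _ x0 z ↔ ConnectedIn ω _ y0 z
    rw [connIn_iff hx0, connIn_iff hy0]
    exact ⟨fun h => hcon.symm.trans h, fun h => hcon.trans h⟩
  refine ⟨y0, hy0, ?_, ?_⟩
  · intro k
    obtain ⟨n, f, -, h2, h3, h4⟩ := hcr k
    refine ⟨f 0, f n, (connIn_iff hy0).1 (h2 0 (Nat.zero_le n)).1, (connIn_iff hy0).1 (h2 n le_rfl).1, ?_, ?_⟩
    · rw [h3]; simp [center]
    · rw [h4]; simp [center]
  · rcases le_abs.1 huv with h | h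
    · exact ⟨v, Finset.mem_coe.1 (hv'.mem hx0), u, k, hv'.symm.trans hu', h, fun hc => hno (hv'.trans hc)⟩
    · exact ⟨u, Finset.mem_coe.1 (hu'.mem hx0), v, k, hu'.symm.trans hv', by linarith, fun hc => hno (hu'.trans hc)⟩

lemma pow_exp {ρ : ℝ} (h0 : 0 < ρ) (h1 : ρ < 1) {L : ℕ} (hL : 1 ≤ L) (m : ℕ) :
    ρ ^ (m / L) ≤ ρ⁻¹ * Real.exp (-(-Real.log ρ / L * m)) := by
  have hl : Real.log ρ < 0 := Real.log_neg h0 h1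
  have hL0 : (0 : ℝ) < L := by exact_mod_cast hL
  have e1 : ρ ^ (m / L) = Real.exp (Real.log ρ * (m / L : ℕ)) := by
    rw [mul_comm, Real.exp_nat_mul, Real.exp_log h0]
  have e2 : ρ⁻¹ = Real.exp (-Real.log ρ) := by rw [Real.exp_neg, Real.exp_log h0]
  rw [e1, e2, ← Real.exp_add]
  apply Real.exp_le_exp.2
  have h3 : (m : ℝ) / L ≤ (m / L : ℕ) + 1 := by
    rw [div_le_iff₀ hL0]
    have := Nat.lt_div_mul_add (a := m) (show 0 < L by omega)
    have h4 : (m : ℝ) ≤ (m / L : ℕ) * L + L := by exact_mod_cast this.le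
    linarith
  have h5 : -(-Real.log ρ / L * m) = Real.log ρ * ((m : ℝ) / L) := by ring
  rw [h5]
  nlinarith

end Assembly

/-- **Unique big cluster: control of `T_{m,N}(p)`.**
Let `p₀ > p_c(d)`. There are `ν(p₀, d) > 0` and `κ(p₀, d) > 0` such that for all
`p ≥ p₀`, `N ≥ 1`, `m ≥ 1`, `ℙ(T_{m,N}(p)) ≤ κ N^{2d} exp(-ν m)`, where `T_{m,N}(p)` is
the event that `B_N` has a `p`-crossing cluster and contains some other `p`-open cluster
of diameter at least `m`. -/
theorem statement_9 (d : ℕ) (hd : 2 ≤ d) (F : BernoulliFamily d)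
    (p₀ : ℝ) (hp₀ : pc F < p₀) (hp₀1 : p₀ ≤ 1) :
    ∃ ν κ : ℝ, 0 < ν ∧ 0 < κ ∧
      ∀ p, p₀ ≤ p → p ≤ 1 → ∀ N : ℕ, 1 ≤ N → ∀ m : ℕ, 1 ≤ m →
        F.P p {ω : Config d | ∃ C : Set (V d),
            IsClusterIn ω (macroBox N 0) C ∧ CrossingFor ω C (center N 0) N ∧
            ∃ C' : Set (V d), IsClusterIn ω (macroBox N 0) C' ∧ C' ≠ C ∧ diamGE C' m}
          ≤ ENNReal.ofReal (κ * (N : ℝ) ^ (2 * d) * Real.exp (-(ν * m))) := by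
  obtain ⟨p1, ⟨hp10, hp11, hpos⟩, hlt⟩ := exists_lt_of_csInf_lt
    (show {p : ℝ | 0 ≤ p ∧ p ≤ 1 ∧ 0 < F.P p {ω : Config d | InInfiniteCluster ω 0}}.Nonempty from
      ⟨1, zero_le_one, le_rfl, one_mem F (by omega)⟩) hp₀
  have := F.prob p1
  have hθ : 0 < (F.P p1 {ω : Config d | InInfiniteCluster ω 0}).toReal := ENNReal.toReal_pos hpos.ne' (measure_ne_top _ _)
  obtain ⟨L, ρ, K, hL, hρ0, hρ1, hK, hb⟩ : ∃ (L : ℕ) (ρ K : ℝ), 1 ≤ L ∧ 0 < ρ ∧ ρ < 1 ∧ 0 < K ∧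
      ∀ p, p₀ ≤ p → p ≤ 1 → ∀ N, 1 ≤ N → ∀ m,
      PrE p (GB d N) (TD d N m) ≤ K * (N : ℝ) ^ (2 * d) * ρ ^ (m / L) := by
    rcases Nat.lt_or_ge 2 d with h | h
    · exact td_bound3 hp10 hlt hp₀1 hθ (fun n => th_ge F hp10 hp11 n) h
    · have : d = 2 := by omega
      subst this
      exact td_bound2 hp10 hlt hp₀1 hθ (fun n => th_ge F hp10 hp11 n)
  have hL0 : (0 : ℝ) < L := by exact_mod_cast hL
  refine ⟨-Real.log ρ / L, K * ρ⁻¹, div_pos (neg_pos.2 (Real.log_neg hρ0 hρ1)) hL0, by positivity, ?_⟩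
  intro p hp hp1 N hN m _
  refine (P_le F (by linarith) hp1 (GB d N) (TD d N m) _ fun ω hω => TD_of hω).trans (ENNReal.ofReal_le_ofReal ?_)
  calc _ ≤ _ := hb p hp hp1 N hN m
    _ ≤ K * (N : ℝ) ^ (2 * d) * (ρ⁻¹ * Real.exp (-(-Real.log ρ / L * m))) :=
        mul_le_mul_of_nonneg_left (pow_exp hρ0 hρ1 hL m) (by positivity)
    _ = _ := by ring

end Perco
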